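/- arXiv:2008.09888 — 2 statements merged into one kernel-verified Lean document; each statement's English description precedes it below -/
import Mathlib

section
/- Every digraph D with dichromatic number χ⃗(D) ≥ 4 contains a subdivision of K⃗₄ˢ, the unique strongly connected tournament on 4 vertices; consequently mader_χ⃗(K⃗₄ˢ) = 4. -/
/-- A digraph on a vertex type `V`: a set of arcs given by an adjacency relation. -/
structure Digraph' (V : Type) where
  Adj : V → V → Prop

namespace Digraph'

variable {V : Type}

/-- A digraph is loopless if it has no arc from a vertex to itself. -/
def Loopless (D : Digraph' V) : Prop := ∀ v, ¬ D.Adj v v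

/-- A set `S` of vertices is acyclic in `D` if the subdigraph induced by `S`
contains no directed cycle (equivalently, no vertex can reach itself by a
nontrivial directed walk staying inside `S`). -/
def AcyclicOn (D : Digraph' V) (S : Set V) : Prop :=
  ∀ v, ¬ Relation.TransGen (fun x y => x ∈ S ∧ y ∈ S ∧ D.Adj x y) v v

/-- An acyclic coloring of `D` with `k` colors: every color class induces an
acyclic subdigraph. -/
def IsAcyclicColoring (D : Digraph' V) {k : ℕ} (c : V → Fin k) : Prop :=
  ∀ i : Fin k, D.AcyclicOn {v | c v = i}

/-- The dichromatic number of `D`: the least `k` such that `D` admits an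
acyclic coloring with `k` colors. -/
noncomputable def dichromaticNumber (D : Digraph' V) : ℕ :=
  sInf {k : ℕ | ∃ c : V → Fin k, D.IsAcyclicColoring c}

/-- `D.IsDipath u l v`: the list `u :: l ++ [v]` is a directed path in `D`
from `u` to `v`, with (pairwise distinct) internal vertices `l`. -/
def IsDipath (D : Digraph' V) (u : V) (l : List V) (v : V) : Prop :=
  (u :: l ++ [v]).Chain' D.Adj ∧ (u :: l ++ [v]).Nodup

/-- `D.ContainsSubdivision F`: some subdigraph of `D` is a subdivision of `F`.
Concretely, there is an injective map `β` of the vertices of `F` into `D`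
(the branch vertices), and for every arc `(a,b)` of `F` a directed path in
`D` from `β a` to `β b`, such that the internal vertices of these paths avoid
all branch vertices and the paths of distinct arcs are internally disjoint. -/
def ContainsSubdivision {α : Type} (D : Digraph' V) (F : Digraph' α) : Prop :=
  ∃ (β : α → V) (p : ∀ a b, F.Adj a b → List V),
    Function.Injective β ∧
    (∀ a b (h : F.Adj a b), D.IsDipath (β a) (p a b h) (β b)) ∧
    (∀ a b (h : F.Adj a b) (x : V), x ∈ p a b h → x ∉ Set.range β) ∧
    (∀ a b (h : F.Adj a b) (a' b' : α) (h' : F.Adj a' b'),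
      (a, b) ≠ (a', b') → ∀ x, x ∈ p a b h → x ∉ p a' b' h')

/-- `MaderBound F k`: every (finite, loopless) digraph with dichromatic number
at least `k` contains a subdivision of `F`. -/
def MaderBound {α : Type} (F : Digraph' α) (k : ℕ) : Prop :=
  ∀ (n : ℕ) (D : Digraph' (Fin n)), D.Loopless →
    k ≤ D.dichromaticNumber → D.ContainsSubdivision F

/-- The dichromatic Mader number of `F`: the smallest integer `k ≥ 1` such that
every digraph with dichromatic number at least `k` contains a subdivision of `F`. -/
noncomputable def mader {α : Type} (F : Digraph' α) : ℕ :=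
  sInf {k : ℕ | 1 ≤ k ∧ MaderBound F k}

/-- A digraph is strongly connected if every vertex can reach every other
vertex by a directed path. -/
def StronglyConnected (D : Digraph' V) : Prop :=
  ∀ x y : V, Relation.ReflTransGen D.Adj x y

/-- The subdigraph of `D` induced by a set `S` of vertices. -/
def induce (D : Digraph' V) (S : Set V) : Digraph' S :=
  ⟨fun a b => D.Adj a.1 b.1⟩

end Digraph'

/-- `D` is an orientation of the undirected simple graph `G`: the arcs of `D`
are obtained by choosing exactly one direction for each edge of `G`. -/
def IsOrientationOf {γ : Type} (D : Digraph' γ) (G : SimpleGraph γ) : Prop :=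
  (∀ a b, D.Adj a b → G.Adj a b) ∧
  (∀ a b, G.Adj a b → ((D.Adj a b ∨ D.Adj b a) ∧ ¬ (D.Adj a b ∧ D.Adj b a)))


namespace K4S
open Relation
variable {V : Type}

theorem tg_mono {P Q : V → V → Prop} (h : ∀ a b, P a b → Q a b) {x y : V}
    (hxy : TransGen P x y) : TransGen Q x y := by
  induction hxy with
  | single h1 => exact TransGen.single (h _ _ h1)
  | tail _ h1 ih => exact TransGen.tail ih (h _ _ h1)

/-- walk from `s` to `v` all of whose vertices after `s` avoid `T` -/
def InW (R : V → V → Prop) (T : Set V) (s v : V) : Prop :=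
  TransGen (fun a b => R a b ∧ b ∉ T) s v
/-- walk from `v` to `t` all of whose vertices before `t` avoid `T` -/
def OutW (R : V → V → Prop) (T : Set V) (v t : V) : Prop :=
  TransGen (fun a b => R a b ∧ a ∉ T) v t
/-- `T` is the vertex set of a directed cycle -/
def IsCyc (R : V → V → Prop) (T : Set V) : Prop :=
  ∃ x l, (x :: l).Nodup ∧ List.IsChain R (x :: l ++ [x]) ∧ T = {z | z ∈ x :: l}
/-- a directed cycle with a vertex off the cycle with three mixed attachments -/
def X (R : V → V → Prop) : Prop :=
  ∃ T v s t w, IsCyc R T ∧ v ∉ T ∧ s ∈ T ∧ t ∈ T ∧ w ∈ T ∧ s ≠ t ∧ s ≠ w ∧ t ≠ w ∧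
    InW R T s v ∧ OutW R T v t ∧ (InW R T w v ∨ OutW R T v w)

theorem cyc_rot {R : V → V → Prop} {T : Set V} (h : IsCyc R T) {v : V} (hv : v ∈ T) :
    ∃ l, (v :: l).Nodup ∧ List.IsChain R (v :: l ++ [v]) ∧ T = {z | z ∈ v :: l} := by
  obtain ⟨x, l, hn, hc, rfl⟩ := h
  rcases List.mem_cons.1 hv with rfl | hv
  · exact ⟨l, hn, hc, rfl⟩
  · obtain ⟨l1, l2, rfl⟩ := List.append_of_mem hv
    refine ⟨l2 ++ x :: l1, ?_, ?_, ?_⟩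
    · refine (List.Perm.nodup_iff ?_).1 hn
      have := List.perm_append_comm (l₁ := x :: l1) (l₂ := v :: l2)
      simpa using this
    · have h1 : List.IsChain R ((x :: l1) ++ v :: (l2 ++ [x])) := by simpa using hc
      rw [List.isChain_split] at h1
      have h2 : List.IsChain R ((v :: l2) ++ x :: (l1 ++ [v])) := by
        rw [List.isChain_split]; exact ⟨by simpa using h1.2, by simpa using h1.1⟩
      simpa using h2
    · ext z; simp; tauto

theorem chain_dicho {R R' : V → V → Prop} (L : List V) (h : List.IsChain R' L) :
    List.IsChain R L ∨ ∃ l1 a b l2, L = l1 ++ a :: b :: l2 ∧ R' a b ∧ ¬ R a b := by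
  induction L with
  | nil => left; simp
  | cons x L ih =>
    cases L with
    | nil => left; simp
    | cons y L =>
      rw [List.isChain_cons_cons] at h
      by_cases hxy : R x y
      · rcases ih h.2 with h' | ⟨l1, a, b, l2, he, h'⟩
        · left; rw [List.isChain_cons_cons]; exact ⟨hxy, h'⟩
        · right; exact ⟨x :: l1, a, b, l2, by simp [he], h'⟩
      · right; exact ⟨[], x, y, L, rfl, h.1, hxy⟩

theorem cyc_dicho {R R' : V → V → Prop} {T : Set V} (h : IsCyc R' T)
    (h2 : ∃ s t, s ∈ T ∧ t ∈ T ∧ s ≠ t) :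
    IsCyc R T ∨ ∃ v y m, (v :: y :: m).Nodup ∧ List.IsChain R' (v :: y :: m ++ [v]) ∧
      T = {z | z ∈ v :: y :: m} ∧ ¬ R v y := by
  obtain ⟨x, l, hn, hc, hT⟩ := h
  rcases chain_dicho (R := R) _ hc with h' | ⟨l1, a, b, l2, he, h1, h3⟩
  · exact Or.inl ⟨x, l, hn, h', hT⟩
  right
  have haT : a ∈ T := by
    rw [hT]
    have h0 : x :: l = l1 ++ a :: (b :: l2).dropLast := by
      have := congrArg List.dropLast he
      rw [show x :: l ++ [x] = (x :: l) ++ [x] from rfl, List.dropLast_concat] at this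
      rw [this]; simp
    rw [h0]; simp
  cases l1 with
  | nil =>
    cases l with
    | nil => obtain ⟨s, t, hs, ht, hst⟩ := h2; subst hT; simp_all
    | cons y l =>
      simp at he
      obtain ⟨rfl, rfl, he⟩ := he
      exact ⟨x, y, l, hn, hc, hT, h3⟩
  | cons x' l1 =>
    simp at he
    obtain ⟨rfl, he⟩ := he
    rcases List.eq_nil_or_concat l2 with rfl | ⟨l2', z, rfl⟩
    · have he' : l ++ [x] = (l1 ++ [a]) ++ [b] := by simpa using he
      obtain ⟨rfl, hb⟩ := List.append_inj' he' rfl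
      simp at hb; subst hb
      refine ⟨a, x, l1, ?_, ?_, ?_, h3⟩
      · refine (List.Perm.nodup_iff ?_).1 hn
        have := List.perm_append_comm (l₁ := x :: l1) (l₂ := [a])
        simpa using this
      · have h1' : List.IsChain R' ((x :: l1) ++ a :: [x]) := by simpa using hc
        rw [List.isChain_split] at h1'
        rw [List.cons_append, List.cons_append, List.isChain_cons_cons]
        exact ⟨h1, by simpa using h1'.1⟩
      · rw [hT]; ext z; simp; tauto
    · have he' : l ++ [x] = (l1 ++ a :: b :: l2') ++ [z] := by simpa using he
      obtain ⟨rfl, hb⟩ := List.append_inj' he' rfl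
      refine ⟨a, b, l2' ++ x :: l1, ?_, ?_, ?_, h3⟩
      · refine (List.Perm.nodup_iff ?_).1 hn
        have := List.perm_append_comm (l₁ := x :: l1) (l₂ := a :: b :: l2')
        simpa using this
      · have h1' : List.IsChain R' ((x :: l1) ++ a :: (b :: l2' ++ [x])) := by simpa using hc
        rw [List.isChain_split] at h1'
        have h2' : List.IsChain R' ((a :: b :: l2') ++ x :: (l1 ++ [a])) := by
          rw [List.isChain_split]; exact ⟨by simpa using h1'.2, by simpa using h1'.1⟩
        simpa using h2'
      · rw [hT]; ext z; simp; tauto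

theorem exists_path {G : V → V → Prop} {a b : V} (h : ReflTransGen G a b) (hab : a ≠ b) :
    ∃ l, List.IsChain G (a :: l ++ [b]) ∧ (a :: l ++ [b]).Nodup := by
  classical
  induction h using ReflTransGen.head_induction_on with
  | refl => exact absurd rfl hab
  | head h1 h2 ih =>
    rename_i a c
    by_cases hcb : c = b
    · subst hcb; exact ⟨[], by simpa using h1, by simpa using hab⟩
    obtain ⟨l, hc, hn⟩ := ih hcb
    by_cases ha : a ∈ c :: l
    · obtain ⟨l1, l2, he⟩ := List.append_of_mem ha
      refine ⟨l2, ?_, ?_⟩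
      · rw [he, List.append_assoc, List.cons_append, List.isChain_split] at hc
        exact hc.2
      · rw [he, List.append_assoc] at hn
        exact (List.nodup_append.1 hn).2.1
    · refine ⟨c :: l, ?_, ?_⟩
      · rw [List.cons_append, List.cons_append, List.isChain_cons_cons]
        exact ⟨h1, hc⟩
      · rw [List.cons_append, List.nodup_cons]
        refine ⟨?_, hn⟩
        rw [List.mem_append]; simp only [List.mem_singleton]; tauto

theorem chain_tail_prop {R : V → V → Prop} {P : V → Prop} {l : List V} :
    ∀ {a : V}, List.IsChain (fun x y => R x y ∧ P y) (a :: l) → ∀ z ∈ l, P z := by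
  induction l with
  | nil => simp
  | cons b l ih =>
    intro a h z hz
    rw [List.isChain_cons_cons] at h
    rcases List.mem_cons.1 hz with rfl | hz
    · exact h.1.2
    · exact ih h.2 z hz

/-- detour from `a` to `b` outside `S` -/
def Ear (R : V → V → Prop) (S : Set V) (a b : V) : Prop :=
  ∃ z, TransGen (fun i j => R i j ∧ j ∉ S) a z ∧ R z b

theorem cyc_sub {R : V → V → Prop} {T S : Set V} (h : IsCyc R T)
    (hS : ∀ a b, R a b → a ∈ S ∧ b ∈ S) : T ⊆ S := by
  intro v hv
  obtain ⟨l, -, hc, -⟩ := cyc_rot h hv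
  cases l with
  | nil => simp at hc; exact (hS _ _ hc).1
  | cons y l => simp [List.isChain_cons_cons] at hc; exact (hS _ _ hc.1).1

theorem lift_X {R R' : V → V → Prop} {S : Set V}
    (hS : ∀ a b, R' a b → a ∈ S ∧ b ∈ S)
    (hE : ∀ a b, R' a b → R a b ∨ Ear R S a b)
    (hstar : ∀ v y a b, R' v y → ¬ R v y → R' a b → ¬ R a b → a = v ∨ (a = y ∧ b = v))
    (hX : X R') : X R := by
  obtain ⟨T, u, s, t, w, hcyc, hu, hs, ht, hw, hst, hsw, htw, hin, hout, hthird⟩ := hX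
  have hTS : T ⊆ S := cyc_sub hcyc hS
  rcases cyc_dicho (R := R) hcyc ⟨s, t, hs, ht, hst⟩ with hcyc' | ⟨v, y, m, hn, hc, hT, hvy⟩
  · have key1 : ∀ s, InW R' T s u → InW R T s u := by
      intro s h
      refine TransGen.trans_induction_on (motive := fun {a b} _ => InW R T a b) h ?_ ?_
      · rintro a b ⟨h1, h2⟩
        rcases hE _ _ h1 with h3 | ⟨z, hz, hzb⟩
        · exact TransGen.single ⟨h3, h2⟩
        · exact TransGen.tail (tg_mono (fun i j hij => ⟨hij.1, fun h => hij.2 (hTS h)⟩) hz) ⟨hzb, h2⟩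
      · intro a b c _ _ h1 h2; exact TransGen.trans h1 h2
    have key2 : ∀ s, OutW R' T u s → OutW R T u s := by
      intro s h
      refine TransGen.trans_induction_on (motive := fun {a b} _ => OutW R T a b) h ?_ ?_
      · rintro a b ⟨h1, h2⟩
        rcases hE _ _ h1 with h3 | ⟨z, hz, hzb⟩
        · exact TransGen.single ⟨h3, h2⟩
        · have : OutW R T a z ∧ z ∉ S := by
            clear hzb
            induction hz with
            | single h => exact ⟨TransGen.single ⟨h.1, h2⟩, h.2⟩
            | tail _ h ih => exact ⟨TransGen.tail ih.1 ⟨h.1, fun h' => ih.2 (hTS h')⟩, h.2⟩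
          exact TransGen.tail this.1 ⟨hzb, fun h' => this.2 (hTS h')⟩
      · intro a b c _ _ h1 h2; exact TransGen.trans h1 h2
    exact ⟨T, u, s, t, w, hcyc', hu, hs, ht, hw, hst, hsw, htw, key1 _ hin, key2 _ hout,
      hthird.imp (key1 _) (key2 _)⟩
  · have hvT : v ∈ T := by rw [hT]; simp
    have hyT : y ∈ T := by rw [hT]; simp
    have hm : m ≠ [] := by
      rintro rfl
      subst hT
      simp at hs ht hw
      grind
    have hc2 : R' v y ∧ List.IsChain R' (y :: m ++ [v]) := by
      rw [List.cons_append, List.cons_append, List.isChain_cons_cons] at hc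
      exact hc
    have hrest : List.IsChain R (y :: m ++ [v]) := by
      rcases chain_dicho (R := R) _ hc2.2 with h' | ⟨l1, a, b, l2, he, h1, h3⟩
      · exact h'
      exfalso
      have hnd : (y :: m ++ [v]).Nodup := by
        refine (List.Perm.nodup_iff ?_).1 hn
        have := List.perm_append_comm (l₁ := [v]) (l₂ := y :: m)
        simpa using this
      rcases hstar v y a b hc2.1 hvy h1 h3 with rfl | ⟨rfl, rfl⟩
      · have hl : (b :: l2).getLast? = some a := by
          have h0 := congrArg List.getLast? he
          rw [List.getLast?_concat, List.getLast?_append_cons, List.getLast?_cons_cons] at h0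
          exact h0.symm
        have : a ∈ b :: l2 := List.mem_of_getLast? hl
        rw [he] at hnd
        exact (List.nodup_cons.1 (List.nodup_append.1 hnd).2.1).1 this
      · cases l1 with
        | nil =>
          cases m with
          | nil => exact hm rfl
          | cons z m => simp at he; rw [he.1] at hn; simp at hn
        | cons z l1 =>
          simp at he
          rw [List.cons_append, List.nodup_cons, he.2] at hnd
          simp at hnd
    have hear : Ear R S v y := (hE _ _ hc2.1).resolve_left hvy
    obtain ⟨p, hp1, hp2, hp3⟩ : ∃ p, List.IsChain R (v :: p ++ [y]) ∧ p.Nodup ∧ ∀ z ∈ p, z ∉ S := by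
      obtain ⟨z, hz, hzy⟩ := hear
      have hzS : z ∉ S := by cases hz with
        | single h => exact h.2
        | tail _ h => exact h.2
      obtain ⟨l, hl1, hl2⟩ := exists_path hz.to_reflTransGen (fun h => hzS (h ▸ hTS hvT))
      refine ⟨l ++ [z], ?_, ?_, ?_⟩
      · have : List.IsChain R ((v :: l) ++ z :: [y]) := by
          rw [List.isChain_split]
          exact ⟨hl1.imp (fun _ _ h => h.1), by simpa using hzy⟩
        simpa using this
      · rw [List.cons_append, List.nodup_cons] at hl2; exact hl2.2
      · exact chain_tail_prop (P := fun j => j ∉ S) hl1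
    have hym : ∀ z ∈ v :: y :: m, z ∈ S := fun z hz => hTS (by rw [hT]; exact hz)
    set T' : Set V := {z | z ∈ v :: (p ++ y :: m)} with hT'
    have hTT' : ∀ z ∈ S, z ∉ T → z ∉ T' := by
      intro z hz hzT hzT'
      rw [hT] at hzT
      simp only [hT', Set.mem_ofPred_eq, List.mem_cons, List.mem_append] at hzT' hzT
      have := hp3 z
      tauto
    have hsub : T ⊆ T' := by
      intro z hz; rw [hT] at hz
      simp only [hT', Set.mem_ofPred_eq, List.mem_cons, List.mem_append] at hz ⊢
      tauto
    have hstep : ∀ a b, R' a b → a ∉ T → R a b := by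
      intro a b hab ha
      by_contra hcon
      rcases hstar v y a b hc2.1 hvy hab hcon with rfl | ⟨rfl, rfl⟩
      · exact ha hvT
      · exact ha hyT
    have hcyc' : IsCyc R T' := by
      refine ⟨v, p ++ y :: m, ?_, ?_, rfl⟩
      · have hn' := hn
        rw [List.nodup_cons] at hn
        rw [List.nodup_cons, List.nodup_append]
        refine ⟨?_, hp2, hn.2, ?_⟩
        · rw [List.mem_append]; rintro (h | h)
          · exact hp3 _ h (hTS hvT)
          · exact hn.1 h
        · intro a ha b hb hab
          subst hab
          exact hp3 _ ha (hym a (List.mem_cons_of_mem _ hb))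
      · have : List.IsChain R ((v :: p) ++ y :: (m ++ [v])) := by
          rw [List.isChain_split]; exact ⟨hp1, hrest⟩
        simpa using this
    have key1 : ∀ s u, s ∈ T → InW R' T s u →
        ∃ s' ∈ T', (s' = s ∨ (s = v ∧ s' ∉ S)) ∧ InW R T' s' u ∧ u ∉ T := by
      intro s u hs h
      induction h with
      | single h =>
        rename_i b
        have hbT' := hTT' _ (hS _ _ h.1).2 h.2
        by_cases hsb : R s b
        · exact ⟨s, hsub hs, Or.inl rfl, TransGen.single ⟨hsb, hbT'⟩, h.2⟩
        rcases hstar v y s b hc2.1 hvy h.1 hsb with rfl | ⟨rfl, rfl⟩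
        · obtain ⟨z, hz, hzb⟩ := (hE _ _ h.1).resolve_left hsb
          have : ∃ s' ∈ T', (s' = s ∨ s' ∉ S) ∧
              ReflTransGen (fun a b => R a b ∧ b ∉ T') s' z := by
            have hz' := hz.to_reflTransGen
            clear hzb hz
            induction hz' with
            | refl => exact ⟨s, hsub hs, Or.inl rfl, ReflTransGen.refl⟩
            | tail _ h ih =>
              rename_i z1 z2 _
              by_cases hz2 : z2 ∈ T'
              · exact ⟨z2, hz2, Or.inr h.2, ReflTransGen.refl⟩
              · obtain ⟨s', h1, h2, h3⟩ := ih
                exact ⟨s', h1, h2, h3.tail ⟨h.1, hz2⟩⟩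
          obtain ⟨s', h1, h2, h3⟩ := this
          exact ⟨s', h1, h2.imp id (fun h => ⟨rfl, h⟩), TransGen.tail' h3 ⟨hzb, hbT'⟩, h.2⟩
        · exact absurd hvT h.2
      | tail _ h ih =>
        obtain ⟨s', h1, h2, h3, h4⟩ := ih
        exact ⟨s', h1, h2, TransGen.tail h3 ⟨hstep _ _ h.1 h4, hTT' _ (hS _ _ h.1).2 h.2⟩, h.2⟩
    have key2 : ∀ t, OutW R' T u t → OutW R T' u t := by
      intro t h
      exact tg_mono (fun a b hab => ⟨hstep _ _ hab.1 hab.2, hTT' _ (hS _ _ hab.1).1 hab.2⟩) h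
    have huS : u ∈ S := by
      rcases TransGen.head'_iff.1 hout with ⟨c, h, _⟩
      exact (hS _ _ h.1).1
    obtain ⟨s', hs', hs2, hs3, -⟩ := key1 s u hs hin
    have hst2 : s' ≠ t := by
      rcases hs2 with rfl | ⟨_, h⟩
      · exact hst
      · rintro rfl; exact h (hTS ht)
    rcases hthird with h3 | h3
    · obtain ⟨w', hw', hw2, hw3, -⟩ := key1 w u hw h3
      have hwt2 : t ≠ w' := by
        rcases hw2 with rfl | ⟨_, h⟩
        · exact htw
        · rintro rfl; exact h (hTS ht)
      have hsw2 : s' ≠ w' := by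
        rcases hs2 with rfl | ⟨h1, h⟩
        · rcases hw2 with rfl | ⟨_, h⟩
          · exact hsw
          · rintro rfl; exact h (hTS hs)
        · rcases hw2 with rfl | ⟨h2, _⟩
          · rintro rfl; exact h (hTS hw)
          · exact absurd (h1.trans h2.symm) hsw
      exact ⟨T', u, s', t, w', hcyc', hTT' _ huS hu, hs', hsub ht, hw', hst2, hsw2, hwt2, hs3,
        key2 _ hout, Or.inl hw3⟩
    · have hsw3 : s' ≠ w := by
        rcases hs2 with rfl | ⟨_, h⟩
        · exact hsw
        · rintro rfl; exact h (hTS hw)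
      exact ⟨T', u, s', t, w, hcyc', hTT' _ huS hu, hs', hsub ht, hsub hw, hst2, hsw3, htw, hs3,
        key2 _ hout, Or.inr (key2 _ h3)⟩

end K4S

namespace K4S
open Relation
variable {V : Type}

theorem comb {M M2 : V → V → Prop} {A : Set V} {v : V} (hvA : v ∉ A)
    (hBA : ∀ a b, M a b → b ∈ A → a ∈ A ∨ a = v)
    (hA : ∀ z, ¬ TransGen (fun a b => M a b ∧ (a ∈ A ∨ a = v) ∧ (b ∈ A ∨ b = v)) z z)
    (hB : ∀ z, ¬ TransGen M2 z z)
    (hM2 : ∀ a b, M a b → a ∉ A → b ∉ A → M2 a b)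
    (hear : ∀ a b, TransGen (fun i j => M i j ∧ j ∈ A) v a → M a b → b ∉ A → b ≠ v → M2 v b) :
    ∀ z, ¬ TransGen M z z := by
  have c1 : ∀ u, TransGen M v u →
      (u ∈ A → TransGen (fun a b => M a b ∧ (a ∈ A ∨ a = v) ∧ (b ∈ A ∨ b = v)) v u ∧
        TransGen (fun i j => M i j ∧ j ∈ A) v u) ∧ (u ∉ A → u ≠ v ∧ TransGen M2 v u) := by
    intro u h
    induction h with
    | single h =>
      rename_i b
      refine ⟨fun hb => ⟨TransGen.single ⟨h, Or.inr rfl, Or.inl hb⟩, TransGen.single ⟨h, hb⟩⟩,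
        fun hb => ?_⟩
      have := hM2 _ _ h hvA hb
      exact ⟨fun hbv => hB v (TransGen.single (hbv ▸ this)), TransGen.single this⟩
    | tail _ h ih =>
      rename_i u w _
      by_cases hu : u ∈ A
      · obtain ⟨h1, h2⟩ := ih.1 hu
        refine ⟨fun hw => ⟨h1.tail ⟨h, Or.inl hu, Or.inl hw⟩, h2.tail ⟨h, hw⟩⟩, fun hw => ?_⟩
        have hwv : w ≠ v := by
          rintro rfl
          exact hA _ (h1.tail ⟨h, Or.inl hu, Or.inr rfl⟩)
        exact ⟨hwv, TransGen.single (hear _ _ h2 h hw hwv)⟩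
      · obtain ⟨h1, h2⟩ := ih.2 hu
        refine ⟨fun hw => ?_, fun hw => ?_⟩
        · rcases hBA _ _ h hw with h3 | h3
          · exact absurd h3 hu
          · exact absurd h3 h1
        · have h3 := h2.tail (hM2 _ _ h hu hw)
          exact ⟨fun hwv => hB v (by rw [hwv] at h3; exact h3), h3⟩
  have c2 : ¬ TransGen M v v := fun h => ((c1 v h).2 hvA).1 rfl
  intro z hz
  have c3 : ∀ u, TransGen M z u → (ReflTransGen M z v ∧ ReflTransGen M v u) ∨
      (z ≠ v ∧ u ≠ v ∧
        (z ∈ A → u ∈ A → TransGen (fun a b => M a b ∧ (a ∈ A ∨ a = v) ∧ (b ∈ A ∨ b = v)) z u) ∧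
        (z ∉ A → u ∉ A ∧ TransGen M2 z u)) := by
    intro u h
    induction h with
    | single h =>
      rename_i b
      by_cases hzv : z = v
      · subst hzv; exact Or.inl ⟨.refl, .single h⟩
      by_cases hbv : b = v
      · subst hbv; exact Or.inl ⟨.single h, .refl⟩
      refine Or.inr ⟨hzv, hbv, fun h1 h2 => .single ⟨h, Or.inl h1, Or.inl h2⟩, fun h1 => ?_⟩
      have : b ∉ A := fun hb => (hBA _ _ h hb).elim h1 hzv
      exact ⟨this, .single (hM2 _ _ h h1 this)⟩
    | tail h0 h ih =>
      rename_i u w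
      rcases ih with ⟨h1, h2⟩ | ⟨hzv, huv, h1, h2⟩
      · exact Or.inl ⟨h1, h2.tail h⟩
      by_cases hwv : w = v
      · subst hwv; exact Or.inl ⟨(h0.tail h).to_reflTransGen, .refl⟩
      refine Or.inr ⟨hzv, hwv, fun hz hw => ?_, fun hz => ?_⟩
      · have hu : u ∈ A := (hBA _ _ h hw).resolve_right huv
        exact (h1 hz hu).tail ⟨h, Or.inl hu, Or.inl hw⟩
      · obtain ⟨h3, h4⟩ := h2 hz
        have : w ∉ A := fun hb => (hBA _ _ h hb).elim h3 huv
        exact ⟨this, h4.tail (hM2 _ _ h h3 this)⟩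
  rcases c3 z hz with ⟨h1, h2⟩ | ⟨_, _, h1, h2⟩
  · exact c2 (TransGen.trans_left (TransGen.trans_right h2 hz) h1)
  · by_cases hzA : z ∈ A
    · exact hA _ (h1 hzA hzA)
    · exact hB _ (h2 hzA).2

/-- acyclic coloring with three colors -/
def Good (R : V → V → Prop) (c : V → Fin 3) : Prop :=
  ∀ z, ¬ TransGen (fun a b => R a b ∧ c a = c b) z z

theorem Good.perm {R : V → V → Prop} {c : V → Fin 3} (h : Good R c) (π : Equiv.Perm (Fin 3)) :
    Good R (fun v => π (c v)) := by
  intro z hz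
  exact h z (tg_mono (fun a b hab => ⟨hab.1, π.injective hab.2⟩) hz)

theorem X_mono {R R' : V → V → Prop} (h : ∀ a b, R' a b → R a b) (hX : X R') : X R := by
  refine lift_X (S := Set.univ) (fun _ _ _ => ⟨trivial, trivial⟩) (fun a b hab => Or.inl (h a b hab))
    ?_ hX
  intro v y a b h1 h2
  exact absurd (h _ _ h1) h2

/-- `R` is a minimal uncolorable loopless digraph on `S` -/
structure Crit (R : V → V → Prop) (S : Finset V) : Prop where
  supp : ∀ a b, R a b → a ∈ S ∧ b ∈ S
  loopless : ∀ a, ¬ R a a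
  noX : ¬ X R
  bad : ∀ c, ¬ Good R c
  min : ∀ (R' : V → V → Prop) (S' : Finset V), S'.card < S.card →
    (∀ a b, R' a b → a ∈ S' ∧ b ∈ S') → (∀ a, ¬ R' a a) → ¬ X R' → ∃ c, Good R' c

open Classical in
theorem Crit.card {R : V → V → Prop} {S : Finset V} (h : Crit R S) : 4 ≤ S.card := by
  by_contra hlt
  have hle : S.card ≤ 3 := by omega
  have : ∃ f : V → Fin 3, Set.InjOn f S := by
    have h3 : Fintype.card S ≤ Fintype.card (Fin 3) := by simpa using hle
    obtain ⟨e⟩ := Function.Embedding.nonempty_of_card_le h3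
    refine ⟨fun v => if hv : v ∈ S then e ⟨v, hv⟩ else 0, ?_⟩
    intro a ha b hb hab
    have ha' : a ∈ S := ha
    have hb' : b ∈ S := hb
    simp only [ha', hb', dif_pos] at hab
    simpa using e.injective hab
  obtain ⟨f, hf⟩ := this
  refine h.bad f ?_
  intro z hz
  obtain ⟨b, hb, -⟩ := TransGen.head'_iff.1 hz
  have := hf (h.supp _ _ hb.1).1 (h.supp _ _ hb.1).2 hb.2
  exact h.loopless z (this ▸ hb.1)

open Classical in
theorem Crit.two {R : V → V → Prop} {S : Finset V} (h : Crit R S) (v : V) (hv : v ∈ S) (A : Finset V)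
    (hA : A ⊆ S) (hvA : v ∉ A) (hne : A.Nonempty) (b : V) (hb : b ∈ S) (hbA : b ∉ A) (hbv : b ≠ v) :
    ∃ x y, R x y ∧ x ∉ A ∧ x ≠ v ∧ y ∈ A := by
  by_contra hcon
  push Not at hcon
  have hBA : ∀ a b, R a b → b ∈ A → a ∈ A ∨ a = v := by
    intro a b hab hb
    by_contra hc
    push Not at hc
    exact hcon a b hab hc.1 hc.2 hb
  -- first side
  obtain ⟨c1, hc1⟩ : ∃ c, Good (fun x y => R x y ∧ (x ∈ A ∨ x = v) ∧ (y ∈ A ∨ y = v)) c := by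
    refine h.min _ (insert v A) ?_ ?_ ?_ ?_
    · refine Finset.card_lt_card ?_
      refine ⟨Finset.insert_subset hv hA, fun hs => ?_⟩
      have := hs hb
      simp [hbv, hbA] at this
    · rintro x y ⟨-, h1, h2⟩
      simp only [Finset.mem_insert]; tauto
    · rintro x ⟨h1, -⟩; exact h.loopless x h1
    · exact fun hX => h.noX (X_mono (fun _ _ hab => hab.1) hX)
  set S' := S \ A with hS'
  obtain ⟨c2, hc2⟩ : ∃ c, Good (fun x y => x ∈ S' ∧ y ∈ S' ∧
      (R x y ∨ (x = v ∧ y ≠ v ∧ Ear R (S' : Set V) x y))) c := by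
    refine h.min _ S' ?_ ?_ ?_ ?_
    · refine Finset.card_lt_card ?_
      refine ⟨Finset.sdiff_subset, fun hs => ?_⟩
      obtain ⟨a, ha⟩ := hne
      have := hs (hA ha)
      simp [hS', ha] at this
    · rintro x y ⟨h1, h2, -⟩; exact ⟨h1, h2⟩
    · rintro x ⟨_, _, h1 | ⟨h1, h2, _⟩⟩
      · exact h.loopless x h1
      · exact h2 h1
    · refine fun hX => h.noX (lift_X (S := (S' : Set V)) ?_ ?_ ?_ hX)
      · rintro x y ⟨h1, h2, -⟩; exact ⟨h1, h2⟩
      · rintro x y ⟨_, _, h1 | ⟨_, _, h1⟩⟩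
        · exact Or.inl h1
        · exact Or.inr h1
      · rintro p q x y ⟨_, _, h1 | ⟨h1, _⟩⟩ h2 ⟨_, _, h3 | ⟨h3, _⟩⟩ h4
        · exact absurd h1 h2
        · exact absurd h1 h2
        · exact absurd h3 h4
        · exact Or.inl (h3.trans h1.symm)
  have hc2' := hc2.perm (Equiv.swap (c2 v) (c1 v))
  set c2' : V → Fin 3 := fun u => Equiv.swap (c2 v) (c1 v) (c2 u) with hc2'def
  have hcv : c2' v = c1 v := by simp [hc2'def]
  refine h.bad (fun u => if u ∈ A then c1 u else c2' u) ?_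
  have e1 : ∀ u, (u ∈ A ∨ u = v) → (if u ∈ A then c1 u else c2' u) = c1 u := by
    rintro u (hu | rfl)
    · simp [hu]
    · simp [hvA, hcv]
  have e2 : ∀ u, u ∉ A → (if u ∈ A then c1 u else c2' u) = c2' u := by
    intro u hu; simp [hu]
  refine comb (A := (A : Set V)) (v := v) (M2 := fun a b => (a ∈ S' ∧ b ∈ S' ∧
      (R a b ∨ (a = v ∧ b ≠ v ∧ Ear R (S' : Set V) a b))) ∧ c2' a = c2' b) (by simpa using hvA)
      ?_ ?_ hc2' ?_ ?_
  · rintro a b ⟨hab, -⟩ hb; exact hBA a b hab hb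
  · intro z hz
    refine hc1 z (tg_mono ?_ hz)
    rintro a b ⟨⟨h1, h2⟩, h3, h4⟩
    refine ⟨⟨h1, h3, h4⟩, ?_⟩
    have h2' : (if a ∈ A then c1 a else c2' a) = (if b ∈ A then c1 b else c2' b) := h2
    rwa [e1 _ h3, e1 _ h4] at h2'
  · rintro a b ⟨h1, h2⟩ ha hb
    have h2' : (if a ∈ A then c1 a else c2' a) = (if b ∈ A then c1 b else c2' b) := h2
    rw [e2 _ ha, e2 _ hb] at h2'
    obtain ⟨h3, h4⟩ := h.supp _ _ h1
    exact ⟨⟨Finset.mem_sdiff.2 ⟨h3, ha⟩, Finset.mem_sdiff.2 ⟨h4, hb⟩, Or.inl h1⟩, h2'⟩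
  · rintro a b hva ⟨h1, h2⟩ hb hbv
    have hcol : ∀ a, TransGen (fun i j => (R i j ∧ (if i ∈ A then c1 i else c2' i) =
        (if j ∈ A then c1 j else c2' j)) ∧ j ∈ (A : Set V)) v a →
        (if v ∈ A then c1 v else c2' v) = (if a ∈ A then c1 a else c2' a) := by
      intro a ha
      induction ha with
      | single h => exact h.1.2
      | tail _ h ih => exact ih.trans h.1.2
    have h3 : (if v ∈ A then c1 v else c2' v) = (if b ∈ A then c1 b else c2' b) :=
      (hcol a hva).trans h2
    rw [e2 _ hvA, e2 _ hb] at h3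
    refine ⟨⟨Finset.mem_sdiff.2 ⟨hv, hvA⟩, Finset.mem_sdiff.2 ⟨(h.supp _ _ h1).2, hb⟩,
      Or.inr ⟨rfl, hbv, a, tg_mono ?_ hva, h1⟩⟩, h3⟩
    rintro i j ⟨⟨h5, _⟩, h6⟩
    refine ⟨h5, fun h7 => ?_⟩
    exact (Finset.mem_sdiff.1 (Finset.mem_coe.1 h7)).2 h6

open Classical in
theorem Crit.reach {R : V → V → Prop} {S : Finset V} (h : Crit R S) {v a b : V} (hv : v ∈ S)
    (ha : a ∈ S) (hb : b ∈ S) (hav : a ≠ v) (hbv : b ≠ v) :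
    ReflTransGen (fun x y => R x y ∧ y ≠ v) a b := by
  by_contra hcon
  obtain ⟨x, y, hxy, h1, h2, h3⟩ := h.two v hv
    (S.filter (fun u => u ≠ v ∧ ¬ ReflTransGen (fun x y => R x y ∧ y ≠ v) a u))
    (Finset.filter_subset _ _) (by simp) ⟨b, by simp [hb, hbv, hcon]⟩ a ha
    (by simp [ReflTransGen.refl]) hav
  simp only [Finset.mem_filter, not_and, not_not] at h1 h3
  exact h3.2.2 ((h1 (h.supp _ _ hxy).1 h2).tail ⟨hxy, h3.2.1⟩)

end K4S

namespace K4S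
open Relation
variable {V : Type}

theorem Crit.ear {R : V → V → Prop} {S : Finset V} (h : Crit R S) {x y z : V} (hx : x ∈ S) (hy : y ∈ S)
    (hz : z ∈ S) (hxy : x ≠ y) {W : Finset V} (hxW : x ∈ W) (hyW : y ∈ W) (hzW : z ∉ W)
    (h1 : ∀ a b, R a b → a ∈ W → b ∉ W → a = x ∨ a = y)
    (h2 : ∀ a b, R a b → a ∉ W → b ∈ W → b = x ∨ b = y) : Ear R (W : Set V) x y := by
  have hzx : z ≠ x := by rintro rfl; exact hzW hxW
  have hzy : z ≠ y := by rintro rfl; exact hzW hyW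
  have p1 : ∀ u, ReflTransGen (fun a b => R a b ∧ b ≠ y) x u → u ≠ y ∧
      (u ∉ W → TransGen (fun i j => R i j ∧ j ∉ (W : Set V)) x u) := by
    intro u hu
    induction hu with
    | refl => exact ⟨hxy, fun h => absurd hxW h⟩
    | tail _ hs ih =>
      rename_i u w _
      refine ⟨hs.2, fun hw => ?_⟩
      by_cases hu : u ∈ W
      · rcases h1 _ _ hs.1 hu hw with rfl | rfl
        · exact .single ⟨hs.1, by simpa using hw⟩
        · exact absurd rfl ih.1
      · exact (ih.2 hu).tail ⟨hs.1, by simpa using hw⟩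
  have p2 : ∀ u, ReflTransGen (fun a b => R a b ∧ b ≠ x) z u →
      (u ∉ W ∧ ReflTransGen (fun i j => R i j ∧ j ∉ (W : Set V)) z u) ∨
      ∃ z', ReflTransGen (fun i j => R i j ∧ j ∉ (W : Set V)) z z' ∧ R z' y := by
    intro u hu
    induction hu with
    | refl => exact Or.inl ⟨hzW, .refl⟩
    | tail _ hs ih =>
      rename_i u w _
      rcases ih with ⟨hu, hr⟩ | ih
      · by_cases hw : w ∈ W
        · rcases h2 _ _ hs.1 hu hw with rfl | rfl
          · exact absurd rfl hs.2
          · exact Or.inr ⟨u, hr, hs.1⟩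
        · exact Or.inl ⟨hw, hr.tail ⟨hs.1, by simpa using hw⟩⟩
      · exact Or.inr ih
  have q1 := (p1 z (h.reach hy hx hz hxy hzy)).2 hzW
  rcases p2 y (h.reach hx hz hy hzx hxy.symm) with ⟨h3, _⟩ | ⟨z', h3, h4⟩
  · exact absurd hyW h3
  · exact ⟨z', TransGen.trans_left q1 h3, h4⟩

theorem Crit.side {R : V → V → Prop} {S : Finset V} (h : Crit R S) {x y z : V} (hx : x ∈ S) (hy : y ∈ S)
    (hz : z ∈ S) (hxy : x ≠ y) {W : Finset V} (hWS : W ⊆ S) (hxW : x ∈ W) (hyW : y ∈ W) (hzW : z ∉ W)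
    (h1 : ∀ a b, R a b → a ∈ W → b ∉ W → a = x ∨ a = y)
    (h2 : ∀ a b, R a b → a ∉ W → b ∈ W → b = x ∨ b = y) :
    ∃ c, Good (fun a b => R a b ∧ a ∈ W ∧ b ∈ W) c ∧ c x ≠ c y := by
  obtain ⟨c, hc⟩ : ∃ c, Good (fun a b => a ∈ W ∧ b ∈ W ∧
      (R a b ∨ (a = x ∧ b = y) ∨ (a = y ∧ b = x))) c := by
    refine h.min _ W ?_ ?_ ?_ ?_
    · exact Finset.card_lt_card ⟨hWS, fun hs => hzW (hs hz)⟩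
    · rintro a b ⟨ha, hb, _⟩; exact ⟨ha, hb⟩
    · rintro a ⟨_, _, h3 | ⟨h3, h4⟩ | ⟨h3, h4⟩⟩
      · exact h.loopless a h3
      · exact hxy (h3.symm.trans h4)
      · exact hxy (h4.symm.trans h3)
    · refine fun hX => h.noX (lift_X (S := (W : Set V)) ?_ ?_ ?_ hX)
      · rintro a b ⟨ha, hb, _⟩; exact ⟨ha, hb⟩
      · rintro a b ⟨_, _, h3 | ⟨rfl, rfl⟩ | ⟨rfl, rfl⟩⟩
        · exact Or.inl h3
        · exact Or.inr (h.ear hx hy hz hxy hxW hyW hzW h1 h2)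
        · exact Or.inr (h.ear hy hx hz hxy.symm hyW hxW hzW
            (fun a b p q r => (h1 a b p q r).symm) (fun a b p q r => (h2 a b p q r).symm))
      · rintro p q a b ⟨_, _, h3⟩ h4 ⟨_, _, h5⟩ h6
        grind
  refine ⟨c, ?_, ?_⟩
  · intro z hz
    refine hc z (tg_mono ?_ hz)
    rintro a b ⟨⟨h3, h4, h5⟩, h6⟩
    exact ⟨⟨h4, h5, Or.inl h3⟩, h6⟩
  · intro hcxy
    refine hc x (TransGen.tail (TransGen.single (b := y) ?_) ?_)
    · exact ⟨⟨hxW, hyW, by simp⟩, hcxy⟩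
    · exact ⟨⟨hyW, hxW, by simp⟩, hcxy.symm⟩

theorem perm3 : ∀ a b a' b' : Fin 3, a ≠ b → a' ≠ b' → ∃ π : Equiv.Perm (Fin 3), π a = a' ∧ π b = b' := by
  decide

open Classical in
theorem Crit.three {R : V → V → Prop} {S : Finset V} (h : Crit R S) {x y b : V} (hx : x ∈ S) (hy : y ∈ S)
    (hxy : x ≠ y) (A : Finset V) (hA : A ⊆ S) (hxA : x ∉ A) (hyA : y ∉ A) (hne : A.Nonempty)
    (hb : b ∈ S) (hbA : b ∉ A) (hbx : b ≠ x) (hby : b ≠ y) :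
    ∃ p q, (R p q ∨ R q p) ∧ p ∈ A ∧ q ∉ A ∧ q ≠ x ∧ q ≠ y := by
  by_contra hcon
  push Not at hcon
  have h1 : ∀ a b, R a b → a ∈ A → b ∉ A → b = x ∨ b = y := by
    intro a b hab ha hb
    by_contra hc; push Not at hc
    exact hc.2 (hcon a b (Or.inl hab) ha hb hc.1)
  have h2 : ∀ a b, R a b → a ∉ A → b ∈ A → a = x ∨ a = y := by
    intro a b hab ha hb
    by_contra hc; push Not at hc
    exact hc.2 (hcon b a (Or.inr hab) hb ha hc.1)
  obtain ⟨a0, ha0⟩ := hne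
  obtain ⟨c1, hc1, hc1n⟩ := h.side (W := insert x (insert y A)) hx hy hb hxy
    (Finset.insert_subset hx (Finset.insert_subset hy hA)) (by simp) (by simp)
    (by simp [hbx, hby, hbA])
    (by intro a b hab ha hb
        simp only [Finset.mem_insert, not_or] at ha hb
        have := h1 a b hab; tauto)
    (by intro a b hab ha hb
        simp only [Finset.mem_insert, not_or] at ha hb
        have := h2 a b hab; tauto)
  obtain ⟨c2, hc2, hc2n⟩ := h.side (W := S \ A) hx hy (hA ha0) hxy Finset.sdiff_subset
    (by simp [hx, hxA]) (by simp [hy, hyA]) (by simp [ha0])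
    (by intro a b hab ha hb
        simp only [Finset.mem_sdiff, not_and, not_not] at ha hb
        exact h2 a b hab ha.2 (hb (h.supp _ _ hab).2))
    (by intro a b hab ha hb
        simp only [Finset.mem_sdiff, not_and, not_not] at ha hb
        exact h1 a b hab (ha (h.supp _ _ hab).1) hb.2)
  obtain ⟨π, hπx, hπy⟩ := perm3 _ _ _ _ hc2n hc1n
  obtain ⟨c2', hc2', hcx, hcy⟩ : ∃ c2', Good (fun a b => R a b ∧ a ∈ S \ A ∧ b ∈ S \ A) c2' ∧
      c2' x = c1 x ∧ c2' y = c1 y := ⟨_, hc2.perm π, hπx, hπy⟩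
  obtain ⟨c, hcdef⟩ : ∃ c : V → Fin 3, c = fun u => if u ∈ A then c1 u else c2' u := ⟨_, rfl⟩
  have e1 : ∀ u, (u ∈ A ∨ u = x ∨ u = y) → c u = c1 u := by
    rintro u (hu | rfl | rfl)
    · simp [hcdef, hu]
    · simp [hcdef, hxA, hcx]
    · simp [hcdef, hyA, hcy]
  have e2 : ∀ u, u ∉ A → c u = c2' u := by
    intro u hu; simp [hcdef, hu]
  refine h.bad c ?_
  intro z hz
  have hz' : ∀ w, TransGen (fun a b => R a b ∧ c a = c b) z w →
      TransGen (fun a b => R a b ∧ c a = c z ∧ c b = c z) z w ∧ c w = c z := by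
    intro w hw
    induction hw with
    | single h => exact ⟨.single ⟨h.1, rfl, h.2.symm⟩, h.2.symm⟩
    | tail _ h ih => exact ⟨ih.1.tail ⟨h.1, ih.2, h.2.symm.trans ih.2⟩, h.2.symm.trans ih.2⟩
  have hzz := (hz' z hz).1
  obtain ⟨v, hv, hvi⟩ : ∃ v, (v = x ∨ v = y) ∧ ∀ u, (u = x ∨ u = y) → c u = c z → u = v := by
    have hne : c x ≠ c y := by rw [e1 x (by simp), e1 y (by simp)]; exact hc1n
    by_cases hxi : c x = c z
    · exact ⟨x, by simp, by rintro u (rfl | rfl) hu; rfl; exact absurd (hxi.trans hu.symm) hne⟩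
    · exact ⟨y, by simp, by rintro u (rfl | rfl) hu; exact absurd hu hxi; rfl⟩
  have hvA : v ∉ A := by rcases hv with rfl | rfl <;> assumption
  refine comb (A := (A : Set V)) (v := v) (M := fun a b => R a b ∧ c a = c z ∧ c b = c z)
    (M2 := fun a b => (R a b ∧ a ∈ S \ A ∧ b ∈ S \ A) ∧ c2' a = c2' b) (by simpa using hvA)
    ?_ ?_ hc2' ?_ ?_ z hzz
  · rintro a b ⟨hab, ha, _⟩ hb
    by_cases haA : a ∈ A
    · exact Or.inl haA
    · exact Or.inr (hvi _ (h2 a b hab haA hb) ha)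
  · intro w hw
    refine hc1 w (tg_mono ?_ hw)
    rintro a b ⟨⟨h3, h4, h5⟩, h6, h7⟩
    simp only [Finset.mem_coe] at h6 h7
    have ha : a ∈ A ∨ a = x ∨ a = y := by rcases h6 with h6 | rfl; exact Or.inl h6; exact Or.inr hv
    have hb : b ∈ A ∨ b = x ∨ b = y := by rcases h7 with h7 | rfl; exact Or.inl h7; exact Or.inr hv
    refine ⟨⟨h3, ?_, ?_⟩, ?_⟩
    · rcases ha with h | h | h <;> simp [h]
    · rcases hb with h | h | h <;> simp [h]
    · rw [← e1 _ ha, ← e1 _ hb, h4, h5]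
  · rintro a b ⟨h3, h4, h5⟩ ha hb
    simp only [Finset.mem_coe] at ha hb
    have := h.supp _ _ h3
    refine ⟨⟨h3, by simp [this, ha], by simp [this, hb]⟩, ?_⟩
    rw [← e2 _ ha, ← e2 _ hb, h4, h5]
  · rintro a b hva ⟨h3, h4, h5⟩ hb hbv
    have ha : a ∈ A := by
      cases hva with
      | single h => exact h.2
      | tail _ h => exact h.2
    exact absurd (hvi _ (h1 a b h3 ha hb) h5) hbv

/-- last vertex of `T` on a walk -/
theorem last_in {G : V → V → Prop} {T : Set V} {a z : V} (ha : a ∈ T) (h : ReflTransGen G a z)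
    (hz : z ∉ T) {c : V} (hac : a ≠ c) : 
    (∀ x y, G x y → y ≠ c) → ∃ s ∈ T, s ≠ c ∧ InW G T s z := by
  intro hc
  have : ∀ z, ReflTransGen G a z → z ≠ c ∧ (z ∉ T → ∃ s ∈ T, s ≠ c ∧ InW G T s z) := by
    intro z h
    induction h with
    | refl => exact ⟨hac, fun h => absurd ha h⟩
    | tail _ h ih =>
      rename_i u w _
      refine ⟨hc _ _ h, fun hw => ?_⟩
      by_cases hu : u ∈ T
      · exact ⟨u, hu, ih.1, .single ⟨h, hw⟩⟩
      · obtain ⟨s, h1, h2, h3⟩ := ih.2 hu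
        exact ⟨s, h1, h2, h3.tail ⟨h, hw⟩⟩
  exact (this z h).2 hz

theorem first_in {G : V → V → Prop} {T : Set V} {a z : V} (ha : a ∈ T) (h : ReflTransGen G z a)
    (hz : z ∉ T) {c : V} (hc : ∀ x y, G x y → y ≠ c) : ∃ s ∈ T, s ≠ c ∧ OutW G T z s := by
  induction h using ReflTransGen.head_induction_on with
  | refl => exact absurd ha hz
  | head h1 _ ih =>
    rename_i z w _
    by_cases hw : w ∈ T
    · exact ⟨w, hw, hc _ _ h1, .single ⟨h1, hz⟩⟩
    · obtain ⟨s, h2, h3, h4⟩ := ih hw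
      exact ⟨s, h2, h3, TransGen.head ⟨h1, hz⟩ h4⟩

theorem two_in {R : V → V → Prop} {S : Finset V} (h : Crit R S) {T : Set V} (hT : IsCyc R T)
    {p q : V} (hp : p ∈ T) (hq : q ∈ T) (hpq : p ≠ q)
    {z : V} (hz : z ∈ S) (hzT : z ∉ T) (c : V) (hc : c ∈ T) :
    ∃ s ∈ T, s ≠ c ∧ InW R T s z := by
  have hTS : T ⊆ (S : Set V) := cyc_sub hT h.supp
  obtain ⟨a, ha, hac⟩ : ∃ a ∈ T, a ≠ c := by
    by_cases hpc : p = c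
    · exact ⟨q, hq, fun h => hpq (hpc.trans h.symm)⟩
    · exact ⟨p, hp, hpc⟩
  obtain ⟨s, h1, h2, h3⟩ := last_in (c := c) ha (h.reach (hTS hc) (hTS ha) hz hac
    (by rintro rfl; exact hzT hc)) hzT hac (fun _ _ h => h.2)
  exact ⟨s, h1, h2, tg_mono (fun _ _ h => ⟨h.1.1, h.2⟩) h3⟩

theorem two_out {R : V → V → Prop} {S : Finset V} (h : Crit R S) {T : Set V} (hT : IsCyc R T)
    {p q : V} (hp : p ∈ T) (hq : q ∈ T) (hpq : p ≠ q)
    {z : V} (hz : z ∈ S) (hzT : z ∉ T) (c : V) (hc : c ∈ T) :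
    ∃ s ∈ T, s ≠ c ∧ OutW R T z s := by
  have hTS : T ⊆ (S : Set V) := cyc_sub hT h.supp
  obtain ⟨a, ha, hac⟩ : ∃ a ∈ T, a ≠ c := by
    by_cases hpc : p = c
    · exact ⟨q, hq, fun h => hpq (hpc.trans h.symm)⟩
    · exact ⟨p, hp, hpc⟩
  obtain ⟨s, h1, h2, h3⟩ := first_in (c := c) ha (h.reach (hTS hc) hz (hTS ha)
    (by rintro rfl; exact hzT hc) hac) hzT (fun _ _ h => h.2)
  exact ⟨s, h1, h2, tg_mono (fun _ _ h => ⟨h.1.1, h.2⟩) h3⟩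

theorem in_iff_out {R : V → V → Prop} {S : Finset V} (h : Crit R S) {T : Set V} (hT : IsCyc R T)
    {p q : V} (hp : p ∈ T) (hq : q ∈ T) (hpq : p ≠ q)
    {z : V} (hz : z ∈ S) (hzT : z ∉ T) {s : V} (hs : s ∈ T) :
    InW R T s z ↔ OutW R T z s := by
  constructor
  · intro hin
    by_contra hout
    obtain ⟨t1, h1, -, h1o⟩ := two_out h hT hp hq hpq hz hzT s hs
    obtain ⟨t2, h2, h21, h2o⟩ := two_out h hT hp hq hpq hz hzT t1 h1
    exact h.noX ⟨T, z, s, t1, t2, hT, hzT, hs, h1, h2, by rintro rfl; exact hout h1o,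
      by rintro rfl; exact hout h2o, h21.symm, hin, h1o, Or.inr h2o⟩
  · intro hout
    by_contra hin
    obtain ⟨t1, h1, -, h1o⟩ := two_in h hT hp hq hpq hz hzT s hs
    obtain ⟨t2, h2, h21, h2o⟩ := two_in h hT hp hq hpq hz hzT t1 h1
    exact h.noX ⟨T, z, t1, s, t2, hT, hzT, h1, hs, h2, by rintro rfl; exact hin h1o,
      h21.symm, by rintro rfl; exact hin h2o, h1o, hout, Or.inl h2o⟩

open Classical in
theorem hamilton {R : V → V → Prop} {S : Finset V} (h : Crit R S) {T : Set V} (hT : IsCyc R T)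
    {p q r : V} (hp : p ∈ T) (hq : q ∈ T) (hr : r ∈ T) (hpq : p ≠ q) (hpr : p ≠ r) (hqr : q ≠ r) :
    ∀ z ∈ S, z ∈ T := by
  by_contra hcon
  push Not at hcon
  obtain ⟨z, hz, hzT⟩ := hcon
  have hTS : T ⊆ (S : Set V) := cyc_sub hT h.supp
  have hio : ∀ {z : V}, z ∈ S → z ∉ T → ∀ {s : V}, s ∈ T → (InW R T s z ↔ OutW R T z s) :=
    fun hz hzT s hs => in_iff_out h hT hp hq hpq hz hzT hs
  obtain ⟨a, ha, -, hai⟩ := two_in h hT hp hq hpq hz hzT p hp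
  obtain ⟨b, hb, hba, hbi⟩ := two_in h hT hp hq hpq hz hzT a ha
  have hz3 : ∀ s ∈ T, InW R T s z → s = a ∨ s = b := by
    intro s hs hsi
    by_contra hne
    push Not at hne
    exact h.noX ⟨T, z, s, a, b, hT, hzT, hs, ha, hb, hne.1, hne.2, hba.symm, hsi,
      (hio hz hzT ha).1 hai, Or.inl hbi⟩
  obtain ⟨c, hc, hca, hcb⟩ : ∃ c ∈ T, c ≠ a ∧ c ≠ b := by
    by_contra hcon
    push Not at hcon
    have h0 : ∀ u ∈ T, u = a ∨ u = b := fun u hu => or_iff_not_imp_left.2 (hcon u hu)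
    have h1 := h0 p hp
    have h2 := h0 q hq
    have h3 := h0 r hr
    clear hcon h0 hio hz3 h hT
    rcases h1 with h1 | h1 <;> rcases h2 with h2 | h2 <;> rcases h3 with h3 | h3 <;> simp_all
  obtain ⟨x, y, hxy, hx, hy1, hy2, hy3⟩ := h.three (hTS ha) (hTS hb) hba.symm
    (S.filter (fun u => u ∉ T ∧ ∀ s ∈ T, InW R T s u → s = a ∨ s = b))
    (Finset.filter_subset _ _) (by simp [ha]) (by simp [hb]) ⟨z, by simp [hz, hzT]; exact hz3⟩
    (hTS hc) (by simp [hc]) hca hcb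
  simp only [Finset.mem_filter] at hx hy1
  obtain ⟨hxS, hxT, hx3⟩ := hx
  have hyS : y ∈ S := by
    rcases hxy with h' | h'
    · exact (h.supp _ _ h').2
    · exact (h.supp _ _ h').1
  by_cases hyT : y ∈ T
  · have : y = a ∨ y = b := by
      rcases hxy with h' | h'
      · exact hx3 y hyT ((hio hxS hxT hyT).2 (.single ⟨h', hxT⟩))
      · exact hx3 y hyT (.single ⟨h', hxT⟩)
    tauto
  · refine hy1 ⟨hyS, hyT, fun s hs hsy => ?_⟩
    rcases hxy with h' | h'
    · refine hx3 s hs ((hio hxS hxT hs).2 ?_)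
      exact TransGen.head ⟨h', hxT⟩ ((hio hyS hyT hs).1 hsy)
    · exact hx3 s hs (hsy.tail ⟨h', hxT⟩)

open Classical in
theorem Crit.false {R : V → V → Prop} {S : Finset V} (h : Crit R S) : False := by
  have hcard := h.card
  obtain ⟨u, hu, v', hv', u2, hu2, huv', huu2, hvu2⟩ := Finset.two_lt_card.1 (by omega : 2 < S.card)
  -- an out-neighbour of u
  obtain ⟨w, huw⟩ : ∃ w, R u w := by
    have := h.reach hv' hu hu2 huv' hvu2.symm
    rcases ReflTransGen.cases_head this with h1 | ⟨w, h1, _⟩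
    · exact absurd h1 huu2
    · exact ⟨w, h1.1⟩
  have hwS := (h.supp _ _ huw).2
  have huw' : u ≠ w := by rintro rfl; exact h.loopless _ huw
  obtain ⟨v, hvu, hvw⟩ : ∃ v, R v u ∧ v ≠ w := by
    obtain ⟨b, hb, hbn⟩ : ∃ b ∈ S, b ∉ ({u, w} : Finset V) := by
      by_contra hcon
      push Not at hcon
      have := Finset.card_le_card (s := S) (t := {u, w}) hcon
      have := Finset.card_le_two (a := u) (b := w)
      omega
    simp only [Finset.mem_insert, Finset.mem_singleton, not_or] at hbn
    obtain ⟨x, y, hxy, _, hx, hy⟩ := h.two w hwS {u} (by simpa using hu) (by simpa using huw'.symm)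
      (by simp) b hb (by simpa using hbn.1) hbn.2
    simp at hy
    subst hy
    exact ⟨x, hxy, hx⟩
  have hvS := (h.supp _ _ hvu).1
  have huv : u ≠ v := by rintro rfl; exact h.loopless _ hvu
  obtain ⟨m, hm1, hm2⟩ := exists_path (h.reach hu hwS hvS huw'.symm huv.symm) hvw.symm
  have hum : u ∉ m ++ [v] := fun hmem => chain_tail_prop (P := fun j => j ≠ u) hm1 u hmem rfl
  have hch : List.IsChain R (w :: m ++ [v]) := hm1.imp (fun _ _ h => h.1)
  have hcyc : IsCyc R {z | z ∈ u :: (w :: m ++ [v])} := by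
    refine ⟨u, w :: m ++ [v], ?_, ?_, rfl⟩
    · rw [List.nodup_cons]
      refine ⟨?_, hm2⟩
      rw [List.cons_append, List.mem_cons]; tauto
    · have : List.IsChain R ((u :: w :: m) ++ v :: [u]) := by
        rw [List.isChain_split]
        refine ⟨?_, by simpa using hvu⟩
        rw [List.cons_append, List.cons_append, List.isChain_cons_cons]
        exact ⟨huw, hch⟩
      simpa using this
  have hham := hamilton h hcyc (p := u) (q := w) (r := v) (by simp) (by simp) (by simp) huw' huv
    hvw.symm
  -- a further vertex
  obtain ⟨b, hb, hbn⟩ : ∃ b ∈ S, b ∉ ({u, w, v} : Finset V) := by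
    by_contra hcon
    push Not at hcon
    have := Finset.card_le_card (s := S) (t := {u, w, v}) hcon
    have := Finset.card_le_three (a := u) (b := w) (c := v)
    omega
  simp only [Finset.mem_insert, Finset.mem_singleton, not_or] at hbn
  obtain ⟨x, y, hxy, hx, hy1, hy2, hy3⟩ := h.three hwS hvS hvw.symm {u} (by simpa using hu)
    (by simpa using huw'.symm) (by simpa using huv.symm) (by simp) hb (by simpa using hbn.1)
    hbn.2.1 hbn.2.2
  simp only [Finset.mem_singleton] at hx hy1
  subst hx
  have hyS : y ∈ S := by
    rcases hxy with h' | h'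
    · exact (h.supp _ _ h').2
    · exact (h.supp _ _ h').1
  have hym : y ∈ m := by
    have := hham y hyS
    simpa [hy1, hy2, hy3] using this
  obtain ⟨m1, m2, rfl⟩ := List.append_of_mem hym
  have hch' : List.IsChain R ((w :: m1) ++ y :: (m2 ++ [v])) := by simpa using hch
  rw [List.isChain_split] at hch'
  have hnd : (x :: (w :: m1 ++ y :: (m2 ++ [v]))).Nodup := by
    rw [List.nodup_cons]
    refine ⟨?_, by simpa using hm2⟩
    simp at hum ⊢
    tauto
  rcases hxy with hxy | hyx
  · have hcyc2 : IsCyc R {z | z ∈ x :: (y :: m2 ++ [v])} := by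
      refine ⟨x, y :: m2 ++ [v], ?_, ?_, rfl⟩
      · refine List.Nodup.sublist ?_ hnd
        simp
      · have : List.IsChain R ((x :: y :: m2) ++ v :: [x]) := by
          rw [List.isChain_split]
          refine ⟨?_, by simpa using hvu⟩
          rw [List.cons_append, List.cons_append, List.isChain_cons_cons]
          exact ⟨hxy, hch'.2⟩
        simpa using this
    have := hamilton h hcyc2 (p := x) (q := y) (r := v) (by simp) (by simp) (by simp)
      (Ne.symm hy1) huv hy3 w hwS
    simp at this hnd
    grind
  · have hcyc2 : IsCyc R {z | z ∈ x :: (w :: m1 ++ [y])} := by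
      refine ⟨x, w :: m1 ++ [y], ?_, ?_, rfl⟩
      · refine List.Nodup.sublist ?_ hnd
        simp
      · have : List.IsChain R ((x :: w :: m1) ++ y :: [x]) := by
          rw [List.isChain_split]
          refine ⟨?_, by simpa using hyx⟩
          rw [List.cons_append, List.cons_append, List.isChain_cons_cons]
          exact ⟨huw, hch'.1⟩
        simpa using this
    have := hamilton h hcyc2 (p := x) (q := y) (r := w) (by simp) (by simp) (by simp)
      (Ne.symm hy1) huw' hy2 v hvS
    simp at this hnd
    grind

theorem colorable : ∀ (n : ℕ) (S : Finset V) (R : V → V → Prop), S.card = n →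
    (∀ a b, R a b → a ∈ S ∧ b ∈ S) → (∀ a, ¬ R a a) → ¬ X R → ∃ c, Good R c := by
  intro n
  induction n using Nat.strong_induction_on with
  | _ n ih =>
    intro S R hS h1 h2 h3
    by_contra hcon
    push Not at hcon
    refine Crit.false (R := R) (S := S) ⟨h1, h2, h3, hcon, ?_⟩
    intro R' S' hlt h1' h2' h3'
    exact ih S'.card (hS ▸ hlt) S' R' rfl h1' h2' h3'

end K4S

namespace K4S
open Relation
variable {V : Type}

/-- a subdivision of the strong tournament on four vertices, in list form -/
def Std (R : V → V → Prop) : Prop :=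
  ∃ (a b c d : V) (l1 l2 l3 l4 l5 l6 : List V),
    ([a, b, c, d] ++ l1 ++ l2 ++ l3 ++ l4 ++ l5 ++ l6).Nodup ∧
    List.IsChain R (a :: l1 ++ [b]) ∧ List.IsChain R (b :: l2 ++ [c]) ∧
    List.IsChain R (c :: l3 ++ [d]) ∧ List.IsChain R (d :: l4 ++ [a]) ∧
    List.IsChain R (a :: l5 ++ [c]) ∧ List.IsChain R (b :: l6 ++ [d])

theorem chain_init_prop {R : V → V → Prop} {P : V → Prop} {l : List V} {b : V} :
    ∀ {a : V}, List.IsChain (fun x y => R x y ∧ P x) (a :: l ++ [b]) → ∀ z ∈ a :: l, P z := by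
  induction l with
  | nil => intro a h z hz; simp at h hz; subst hz; exact h.2
  | cons c l ih =>
    intro a h z hz
    rw [List.cons_append, List.cons_append, List.isChain_cons_cons] at h
    rcases List.mem_cons.1 hz with rfl | hz
    · exact h.1.2
    · exact ih h.2 z hz

theorem chain_rtg {R : V → V → Prop} {P : V → Prop} {l : List V} {b : V} :
    ∀ {a : V}, List.IsChain R (a :: l ++ [b]) → (∀ z ∈ a :: l, P z) →
      ReflTransGen (fun x y => R x y ∧ P x) a b := by
  induction l with
  | nil => intro a h hz; simp at h; exact .single ⟨h, hz a (by simp)⟩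
  | cons c l ih =>
    intro a h hz
    rw [List.cons_append, List.cons_append, List.isChain_cons_cons] at h
    exact ReflTransGen.head ⟨h.1, hz a (by simp)⟩
      (ih h.2 (fun z h' => hz z (List.mem_cons_of_mem _ h')))

theorem last_path {R : V → V → Prop} {T N : Set V} {x w : V} (hx : x ∈ N) (hw : w ∉ N)
    (h : ReflTransGen (fun a b => R a b ∧ a ∉ T) x w) :
    ∃ u r, u ∈ N ∧ List.IsChain R (u :: r ++ [w]) ∧ (u :: r ++ [w]).Nodup ∧ (∀ z ∈ r, z ∉ N) ∧
      (∀ z ∈ r, z ∉ T) := by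
  have key : ∀ z, ReflTransGen (fun a b => R a b ∧ a ∉ T) x z →
      ∃ u ∈ N, ReflTransGen (fun a b => (R a b ∧ a ∉ T) ∧ b ∉ N) u z := by
    intro z h
    induction h with
    | refl => exact ⟨x, hx, .refl⟩
    | tail _ h ih =>
      rename_i y z _
      by_cases hz : z ∈ N
      · exact ⟨z, hz, .refl⟩
      · obtain ⟨u, h1, h2⟩ := ih
        exact ⟨u, h1, h2.tail ⟨h, hz⟩⟩
  obtain ⟨u, hu, hr⟩ := key w h
  obtain ⟨r, h1, h2⟩ := exists_path hr (by rintro rfl; exact hw hu)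
  refine ⟨u, r, hu, h1.imp (fun _ _ h => h.1.1), h2, fun z hz => ?_, fun z hz => ?_⟩
  · exact chain_tail_prop (P := fun z => z ∉ N) h1 z (by simp [hz])
  · exact chain_init_prop (P := fun z => z ∉ T) (h1.imp (fun _ _ h => h.1)) z (by simp [hz])

theorem tripod {R : V → V → Prop} {T : Set V} {v s t w : V} (hv : v ∉ T) (hs : s ∈ T) (ht : t ∈ T)
    (hw : w ∈ T) (h1 : InW R T s v) (h2 : OutW R T v t) (h3 : OutW R T v w) :
    ∃ u p q r, List.IsChain R (s :: p ++ [u]) ∧ List.IsChain R (u :: q ++ [t]) ∧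
      List.IsChain R (u :: r ++ [w]) ∧ (p ++ u :: q ++ r).Nodup ∧
      ∀ z ∈ p ++ u :: q ++ r, z ∉ T := by
  obtain ⟨p, hp1, hp2⟩ := exists_path h1.to_reflTransGen (by rintro rfl; exact hv hs)
  have hpT := chain_tail_prop (P := fun z => z ∉ T) hp1
  have hpR : List.IsChain R (s :: (p ++ [v])) := hp1.imp (fun _ _ h => h.1)
  obtain ⟨u0, q, hu0, hq1, hq2, hq3, hq4⟩ := last_path (N := {z | z ∈ p ++ [v]}) (by simp)
    (fun h => hpT t h ht) h2.to_reflTransGen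
  have hu0T := hpT u0 hu0
  have hrt : ReflTransGen (fun a b => R a b ∧ a ∉ T) u0 v ∧ ∃ p1, List.IsChain R (s :: p1 ++ [u0]) ∧
      p1 ++ [u0] <+: p ++ [v] := by
    have hu0' : u0 ∈ p ++ [v] := hu0
    rcases List.mem_append.1 hu0' with h | h
    · obtain ⟨p1, p2, rfl⟩ := List.append_of_mem h
      have hc : List.IsChain R ((s :: p1) ++ u0 :: (p2 ++ [v])) := by simpa using hpR
      rw [List.isChain_split] at hc
      refine ⟨chain_rtg (P := fun z => z ∉ T) hc.2 ?_, p1, hc.1, ⟨p2 ++ [v], by simp⟩⟩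
      intro z hz
      refine hpT z ?_
      simp at hz ⊢; tauto
    · simp at h; subst h
      exact ⟨.refl, p, hpR, List.prefix_rfl⟩
  obtain ⟨hrt, p1, hp1c, hp1p⟩ := hrt
  have hp1n : (p1 ++ [u0]).Nodup := by
    rw [List.cons_append, List.nodup_cons] at hp2
    exact hp2.2.sublist hp1p.sublist
  have hPn : (p1 ++ u0 :: q).Nodup := by
    have : p1 ++ u0 :: q = (p1 ++ [u0]) ++ q := by simp
    rw [this, List.nodup_append]
    refine ⟨hp1n, ?_, ?_⟩
    · rw [List.cons_append, List.nodup_cons] at hq2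
      exact (List.nodup_append.1 hq2.2).1
    · rintro a ha b hb rfl
      exact hq3 a hb (hp1p.subset ha)
  have hPT : ∀ z ∈ p1 ++ u0 :: q, z ∉ T := by
    intro z hz
    have : p1 ++ u0 :: q = (p1 ++ [u0]) ++ q := by simp
    rw [this] at hz
    rcases List.mem_append.1 hz with h | h
    · exact hpT z (hp1p.subset h)
    · exact hq4 z h
  have hPc : List.IsChain R ((s :: p1) ++ u0 :: (q ++ [t])) := by
    rw [List.isChain_split]; exact ⟨hp1c, hq1⟩
  obtain ⟨u, r, hu, hr1, hr2, hr3, hr4⟩ := last_path (N := {z | z ∈ p1 ++ u0 :: q})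
    (x := u0) (by simp) (fun h => hPT w h hw) (hrt.trans h3.to_reflTransGen)
  obtain ⟨P1, P2, he⟩ := List.append_of_mem (show u ∈ p1 ++ u0 :: q from hu)
  have hPc' : List.IsChain R ((s :: P1) ++ u :: (P2 ++ [t])) := by
    have : (s :: P1) ++ u :: (P2 ++ [t]) = s :: (P1 ++ u :: P2) ++ [t] := by simp
    rw [this, ← he]; simpa using hPc
  rw [List.isChain_split] at hPc'
  refine ⟨u, P1, P2, r, hPc'.1, hPc'.2, hr1, ?_, ?_⟩
  · rw [← he, List.nodup_append]
    refine ⟨hPn, ?_, ?_⟩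
    · rw [List.cons_append, List.nodup_cons] at hr2
      exact (List.nodup_append.1 hr2.2).1
    · rintro a ha b hb rfl
      exact hr3 a hb ha
  · rw [← he]
    intro z hz
    rcases List.mem_append.1 hz with h | h
    · exact hPT z h
    · exact hr4 z h

theorem std_aux {R : V → V → Prop} {u s t w : V} {l1 l2 l3 p q r : List V}
    (hc : List.IsChain R (s :: (l1 ++ t :: l2 ++ w :: l3) ++ [s]))
    (hn : (s :: (l1 ++ t :: l2 ++ w :: l3)).Nodup)
    (hp : List.IsChain R (s :: p ++ [u])) (hq : List.IsChain R (u :: q ++ [t]))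
    (hr : List.IsChain R (u :: r ++ [w])) (hn2 : (p ++ u :: q ++ r).Nodup)
    (hd : ∀ z ∈ p ++ u :: q ++ r, z ∉ s :: (l1 ++ t :: l2 ++ w :: l3)) : Std R := by
  classical
  have h1 : List.IsChain R ((s :: l1) ++ t :: (l2 ++ w :: l3 ++ [s])) := by simpa using hc
  rw [List.isChain_split] at h1
  have h2 : List.IsChain R ((t :: l2) ++ w :: (l3 ++ [s])) := by simpa using h1.2
  rw [List.isChain_split] at h2
  refine ⟨s, u, t, w, p, q, l2, l3, l1, r, ?_, hp, hq, h2.1, h2.2, h1.1, hr⟩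
  have h3 : ((s :: (l1 ++ t :: l2 ++ w :: l3)) ++ (p ++ u :: q ++ r)).Nodup := by
    rw [List.nodup_append]
    refine ⟨hn, hn2, ?_⟩
    rintro a ha b hb rfl
    exact hd a hb ha
  refine (List.Perm.nodup_iff ?_).1 h3
  rw [List.perm_iff_count]
  intro x
  simp only [List.count_append, List.count_cons, List.count_nil]
  omega

theorem std_out {R : V → V → Prop} {T : Set V} {v s t w : V} (hT : IsCyc R T)
    (hv : v ∉ T) (hs : s ∈ T) (ht : t ∈ T)
    (hw : w ∈ T) (hst : s ≠ t) (hsw : s ≠ w) (htw : t ≠ w)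
    (h1 : InW R T s v) (h2 : OutW R T v t) (h3 : OutW R T v w) : Std R := by
  obtain ⟨l, hn, hc, rfl⟩ := cyc_rot hT hs
  have htl : t ∈ l := (List.mem_cons.1 ht).resolve_left hst.symm
  have hwl : w ∈ l := (List.mem_cons.1 hw).resolve_left hsw.symm
  obtain ⟨l1, l2, rfl⟩ := List.append_of_mem htl
  rcases List.mem_append.1 hwl with h | h
  · obtain ⟨l3, l4, rfl⟩ := List.append_of_mem h
    obtain ⟨u, p, q, r, hp, hq, hr, hn2, hd⟩ := tripod hv hs hw ht h1 h3 h2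
    exact std_aux hc hn hp hq hr hn2 hd
  · obtain ⟨l3, l4, rfl⟩ := List.append_of_mem ((List.mem_cons.1 h).resolve_left htw.symm)
    obtain ⟨u, p, q, r, hp, hq, hr, hn2, hd⟩ := tripod hv hs ht hw h1 h2 h3
    have e : l1 ++ t :: (l3 ++ w :: l4) = l1 ++ t :: l3 ++ w :: l4 := by simp
    rw [e] at hc hn hd
    exact std_aux hc hn hp hq hr hn2 hd

theorem chain_rev {R : V → V → Prop} {a b : V} {l : List V}
    (h : List.IsChain (fun x y => R y x) (a :: l ++ [b])) :
    List.IsChain R (b :: l.reverse ++ [a]) := by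
  have := List.isChain_reverse.2 h
  simpa using this

theorem std_rev {R : V → V → Prop} (h : Std (fun x y => R y x)) : Std R := by
  classical
  obtain ⟨a, b, c, d, l1, l2, l3, l4, l5, l6, hn, h1, h2, h3, h4, h5, h6⟩ := h
  refine ⟨d, c, b, a, l3.reverse, l2.reverse, l1.reverse, l4.reverse, l6.reverse, l5.reverse, ?_,
    chain_rev h3, chain_rev h2, chain_rev h1, chain_rev h4, chain_rev h6, chain_rev h5⟩
  refine (List.Perm.nodup_iff ?_).1 hn
  rw [List.perm_iff_count]
  intro x
  simp only [List.count_append, List.count_cons, List.count_nil, List.count_reverse]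
  omega

theorem X_std {R : V → V → Prop} (h : X R) : Std R := by
  obtain ⟨T, v, s, t, w, hT, hv, hs, ht, hw, hst, hsw, htw, h1, h2, h3 | h3⟩ := h
  · refine std_rev (std_out (T := T) (v := v) (s := t) (t := s) (w := w) ?_ hv ht hs hw hst.symm htw
      hsw (TransGen.swap _ _ h2) (TransGen.swap _ _ h1) (TransGen.swap _ _ h3))
    obtain ⟨x, l, hn, hc, rfl⟩ := hT
    refine ⟨x, l.reverse, ?_, chain_rev hc, ?_⟩
    · simpa using hn
    · ext z; simp
  · exact std_out hT hv hs ht hw hst hsw htw h1 h2 h3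

end K4S

namespace K4S
open Relation
variable {V : Type}

/-- the standard strong tournament on four vertices -/
def stdB : Fin 4 → Fin 4 → Bool :=
  ![![false, true, true, false], ![false, false, true, true],
    ![false, false, false, true], ![true, false, false, false]]

theorem stdB_cases : ∀ i j, stdB i j = true → (i = 0 ∧ j = 1) ∨ (i = 1 ∧ j = 2) ∨ (i = 2 ∧ j = 3) ∨
    (i = 3 ∧ j = 0) ∨ (i = 0 ∧ j = 2) ∨ (i = 1 ∧ j = 3) := by decide

theorem std_sub {D : Digraph' V} (h : Std D.Adj) :
    ∃ (g : Fin 4 → V) (L : Fin 4 → Fin 4 → List V), Function.Injective g ∧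
      (∀ i j, stdB i j = true → D.IsDipath (g i) (L i j) (g j)) ∧
      (∀ i j, stdB i j = true → ∀ x ∈ L i j, x ∉ Set.range g) ∧
      (∀ i j i' j', stdB i j = true → stdB i' j' = true → (i, j) ≠ (i', j') →
        ∀ x ∈ L i j, x ∉ L i' j') := by
  classical
  obtain ⟨a, b, c, d, l1, l2, l3, l4, l5, l6, hn, h1, h2, h3, h4, h5, h6⟩ := h
  have hcount := List.nodup_iff_count_le_one.1 hn
  simp only [List.count_append, List.count_cons, List.count_nil, beq_iff_eq] at hcount
  refine ⟨![a, b, c, d], ![![[], l1, l5, []], ![[], [], l2, l6], ![[], [], [], l3],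
    ![l4, [], [], []]], ?_, ?_, ?_, ?_⟩
  · have : (List.ofFn ![a, b, c, d]).Nodup := by
      refine hn.sublist ?_
      simp
    exact List.nodup_ofFn.1 this
  · have key : ∀ (x y : V) (l : List V), (x :: l ++ [y]).Nodup → List.IsChain D.Adj (x :: l ++ [y]) →
        D.IsDipath x l y := fun x y l h1 h2 => ⟨h2, h1⟩
    intro i j hij
    rcases stdB_cases i j hij with ⟨rfl, rfl⟩ | ⟨rfl, rfl⟩ | ⟨rfl, rfl⟩ | ⟨rfl, rfl⟩ | ⟨rfl, rfl⟩ |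
      ⟨rfl, rfl⟩
    all_goals
      refine key _ _ _ ?_ (by assumption)
      rw [List.nodup_iff_count_le_one]
      intro x
      have := hcount x
      simp [List.count_append, List.count_cons]
      omega
  · intro i j hij x hx
    have hx' := List.count_pos_iff.2 hx
    rintro ⟨k, hk⟩
    have := hcount x
    rcases stdB_cases i j hij with ⟨rfl, rfl⟩ | ⟨rfl, rfl⟩ | ⟨rfl, rfl⟩ | ⟨rfl, rfl⟩ | ⟨rfl, rfl⟩ |
      ⟨rfl, rfl⟩ <;> fin_cases k <;> simp at hx' hk <;> simp [hk] at this <;>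
      have hx'' := List.count_pos_iff.2 hx' <;> omega
  · intro i j i' j' hij hij' hne x hx hx2
    have hx' := List.count_pos_iff.2 hx
    have hx2' := List.count_pos_iff.2 hx2
    have := hcount x
    clear hx hx2 hcount hn h1 h2 h3 h4 h5 h6
    rcases stdB_cases i j hij with ⟨rfl, rfl⟩ | ⟨rfl, rfl⟩ | ⟨rfl, rfl⟩ | ⟨rfl, rfl⟩ | ⟨rfl, rfl⟩ |
      ⟨rfl, rfl⟩ <;> rcases stdB_cases i' j' hij' with ⟨rfl, rfl⟩ | ⟨rfl, rfl⟩ | ⟨rfl, rfl⟩ |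
      ⟨rfl, rfl⟩ | ⟨rfl, rfl⟩ | ⟨rfl, rfl⟩ <;> first
      | exact absurd rfl hne
      | (simp only [Matrix.cons_val] at hx' hx2'; omega)

theorem tour_dec : ∀ x01 x02 x03 x12 x13 x23 : Bool,
    let A : Fin 4 → Fin 4 → Bool := ![![false, x01, x02, x03], ![!x01, false, x12, x13],
      ![!x02, !x12, false, x23], ![!x03, !x13, !x23, false]]
    (∀ i, ∃ j, A i j = true) → (∀ i, ∃ j, A j i = true) →
    ∃ a b, A a b = true ∧ ∃ c, A b c = true ∧ A a c = true ∧ ∃ d, A c d = true ∧ A d a = true ∧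
      A b d = true := by decide +kernel

theorem tour_iso (K : Digraph' (Fin 4))
    (hK : IsOrientationOf K (⊤ : SimpleGraph (Fin 4)))
    (hstrong : K.StronglyConnected) :
    ∃ e : Fin 4 ≃ Fin 4, ∀ i j, K.Adj (e i) (e j) → stdB i j = true := by
  classical
  have hloop : ∀ i, ¬ K.Adj i i := fun i h => by simpa using hK.1 i i h
  have hor : ∀ i j, i ≠ j → ((K.Adj i j ∨ K.Adj j i) ∧ ¬ (K.Adj i j ∧ K.Adj j i)) :=
    fun i j h => hK.2 i j (by simpa using h)
  have hrev : ∀ i j, i ≠ j → (decide (K.Adj j i) = !decide (K.Adj i j)) := by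
    intro i j h
    have := hor i j h
    by_cases h1 : K.Adj i j <;> by_cases h2 : K.Adj j i <;> simp_all
  have hA : ∀ i j, (![![false, decide (K.Adj 0 1), decide (K.Adj 0 2), decide (K.Adj 0 3)],
      ![!decide (K.Adj 0 1), false, decide (K.Adj 1 2), decide (K.Adj 1 3)],
      ![!decide (K.Adj 0 2), !decide (K.Adj 1 2), false, decide (K.Adj 2 3)],
      ![!decide (K.Adj 0 3), !decide (K.Adj 1 3), !decide (K.Adj 2 3), false]] :
        Fin 4 → Fin 4 → Bool) i j = decide (K.Adj i j) := by
    intro i j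
    rw [← hrev 0 1 (by decide), ← hrev 0 2 (by decide), ← hrev 0 3 (by decide),
      ← hrev 1 2 (by decide), ← hrev 1 3 (by decide), ← hrev 2 3 (by decide)]
    fin_cases i <;> fin_cases j <;> simp [hloop]
  have := tour_dec (decide (K.Adj 0 1)) (decide (K.Adj 0 2)) (decide (K.Adj 0 3))
    (decide (K.Adj 1 2)) (decide (K.Adj 1 3)) (decide (K.Adj 2 3))
  simp only [hA, decide_eq_true_eq] at this
  have hs : ∀ i : Fin 4, i ≠ i + 1 := by decide
  obtain ⟨a, b, hab, c, hbc, hac, d, hcd, hda, hbd⟩ := this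
    (by intro i
        rcases ReflTransGen.cases_head (hstrong i (i + 1)) with h | ⟨j, h, _⟩
        · exact absurd h (hs i)
        · exact ⟨j, h⟩)
    (by intro i
        rcases ReflTransGen.cases_tail (hstrong (i + 1) i) with h | ⟨j, _, h⟩
        · exact absurd h (hs i)
        · exact ⟨j, h⟩)
  have hne : ∀ i j, K.Adj i j → i ≠ j := by rintro i j h rfl; exact hloop i h
  have hanti : ∀ i j, K.Adj i j → ¬ K.Adj j i := fun i j h h' => (hor i j (hne i j h)).2 ⟨h, h'⟩
  have hinj : Function.Injective ![a, b, c, d] := by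
    have : (List.ofFn ![a, b, c, d]).Nodup := by
      simp [hne _ _ hab, hne _ _ hac, hne _ _ hbc, hne _ _ hcd, hne _ _ hbd, (hne _ _ hda).symm]
    exact List.nodup_ofFn.1 this
  refine ⟨Equiv.ofBijective _ (Finite.injective_iff_bijective.1 hinj), ?_⟩
  intro i j
  simp only [Equiv.ofBijective_apply]
  fin_cases i <;> fin_cases j <;> simp [stdB, *]

theorem contains_of_std {D : Digraph' V} (h : Std D.Adj) (K : Digraph' (Fin 4))
    (hK : IsOrientationOf K (⊤ : SimpleGraph (Fin 4)))
    (hstrong : K.StronglyConnected) : D.ContainsSubdivision K := by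
  obtain ⟨e, he⟩ := tour_iso K hK hstrong
  obtain ⟨g, L, h1, h2, h3, h4⟩ := std_sub h
  have he' : ∀ x y, K.Adj x y → stdB (e.symm x) (e.symm y) = true := by
    intro x y hxy; apply he; simpa using hxy
  refine ⟨g ∘ e.symm, fun x y _ => L (e.symm x) (e.symm y), h1.comp e.symm.injective, ?_, ?_, ?_⟩
  · intro x y hxy; exact h2 _ _ (he' x y hxy)
  · intro x y hxy z hz hr
    refine h3 _ _ (he' x y hxy) z hz ?_
    obtain ⟨k, hk⟩ := hr
    exact ⟨e.symm k, hk⟩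
  · intro x y hxy x' y' hxy' hne z hz
    refine h4 _ _ _ _ (he' x y hxy) (he' x' y' hxy') ?_ z hz
    intro heq
    apply hne
    simpa using heq

theorem bound (K : Digraph' (Fin 4))
    (hK : IsOrientationOf K (⊤ : SimpleGraph (Fin 4)))
    (hstrong : K.StronglyConnected) : Digraph'.MaderBound K 4 := by
  intro n D hD h4
  by_contra hcon
  obtain ⟨c, hc⟩ := colorable _ (Finset.univ : Finset (Fin n)) D.Adj rfl (by simp) hD
    (fun hX => hcon (contains_of_std (X_std hX) K hK hstrong))
  have : D.dichromaticNumber ≤ 3 := by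
    refine Nat.sInf_le ⟨c, ?_⟩
    intro i v hv
    refine hc v (tg_mono ?_ hv)
    rintro a b ⟨ha, hb, hab⟩
    exact ⟨hab, ha.trans hb.symm⟩
  omega

theorem lower (K : Digraph' (Fin 4)) (k : ℕ) (h : Digraph'.MaderBound K k) : 4 ≤ k := by
  by_contra hk
  have hdi : 3 ≤ (⟨fun a b => a ≠ b⟩ : Digraph' (Fin 3)).dichromaticNumber := by
    refine le_csInf ⟨3, id, ?_⟩ ?_
    · intro i v hv
      rcases TransGen.head'_iff.1 hv with ⟨w, ⟨h1, h2, h3⟩, _⟩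
      exact h3 (h1.trans h2.symm)
    · rintro m ⟨c, hc⟩
      by_contra hm
      obtain ⟨x, y, hxy, hcxy⟩ := Fintype.exists_ne_map_eq_of_card_lt c (by simpa using hm)
      refine hc (c x) x (TransGen.tail (TransGen.single (b := y) ?_) ?_)
      · exact ⟨rfl, hcxy.symm, hxy⟩
      · exact ⟨hcxy.symm, rfl, hxy.symm⟩
  obtain ⟨β, _, hβ, _⟩ := h 3 ⟨fun a b => a ≠ b⟩ (fun v h => h rfl) (by omega)
  have := Fintype.card_le_of_injective β hβ
  simp at this

end K4S

/-- Every digraph with dichromatic number at least `4`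
contains a subdivision of `K⃗₄ˢ`, the (unique) strongly connected tournament
on `4` vertices; consequently `mader(K⃗₄ˢ) = 4`. -/
theorem mader_K4strong (K : Digraph' (Fin 4))
    (hK : IsOrientationOf K (⊤ : SimpleGraph (Fin 4)))
    (hstrong : K.StronglyConnected) :
    Digraph'.MaderBound K 4 ∧ Digraph'.mader K = 4 := by
  have hb := K4S.bound K hK hstrong
  refine ⟨hb, le_antisymm (Nat.sInf_le ⟨by norm_num, hb⟩) ?_⟩
  exact le_csInf ⟨4, by norm_num, hb⟩ (fun k hk => K4S.lower K k hk.2)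
end

section
/- Every digraph D with dichromatic number χ⃗(D) ≥ 4 contains a subdivision of W₄⁺, the tournament obtained from the directed triangle C⃗₃ by adding a dominating source; consequently mader_χ⃗(W₄⁺) = 4. By arc-reversal symmetry the same holds for W₄⁻, the tournament obtained from C⃗₃ by adding a dominating sink. -/
/-- `W₄⁺`: the directed triangle `0 → 1 → 2 → 0` together with a dominating
source `3`. -/
def W4plus : Digraph' (Fin 4) :=
  ⟨fun a b => ((a : ℕ), (b : ℕ)) ∈ ([(0,1),(1,2),(2,0),(3,0),(3,1),(3,2)] : List (ℕ × ℕ))⟩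

/-- `W₄⁻`: the reverse of `W₄⁺`, i.e. the directed triangle with a dominating sink. -/
def W4minus : Digraph' (Fin 4) := ⟨fun a b => W4plus.Adj b a⟩

namespace W4proof

open Relation

/-- A directed cycle of length at least three, as a list of vertices. -/
def Cyc {V : Type} (r : V → V → Prop) (l : List V) : Prop :=
  l.Nodup ∧ 3 ≤ l.length ∧ l.IsChain r ∧ ∀ a ∈ l.getLast?, ∀ b ∈ l.head?, r a b

/-- Reachability avoiding a finite set. -/
def Av {V : Type} (r : V → V → Prop) (S : Finset V) : V → V → Prop := fun a b => r a b ∧ b ∉ S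

/-- No vertex sends a three-fan to a long cycle (separator form). -/
def NoFan {V : Type} (r : V → V → Prop) : Prop :=
  ∀ l, Cyc r l → ∀ v, v ∉ l → ∃ S : Finset V, S.card ≤ 2 ∧ v ∉ S ∧
    ∀ x ∈ l, x ∉ S → ¬ ReflTransGen (Av r S) v x

theorem Cyc.rot {V : Type} {r : V → V → Prop} {l₁ l₂ : List V} (h : Cyc r (l₁ ++ l₂)) :
    Cyc r (l₂ ++ l₁) := by
  obtain ⟨h1, h2, h3, h4⟩ := h
  rcases l₁.eq_nil_or_concat with rfl | ⟨k₁, x, rfl⟩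
  · simpa using ⟨h1, by simpa using h2, h3, h4⟩
  rcases l₂ with _ | ⟨y, k₂⟩
  · simpa using ⟨by simpa using h1, by simpa using h2, by simpa using h3, by simpa using h4⟩
  refine ⟨(List.perm_append_comm.nodup_iff).1 h1, by simp at h2 ⊢; omega, ?_, ?_⟩
  · rw [List.isChain_append] at h3 ⊢
    refine ⟨h3.2.1, h3.1, ?_⟩
    intro a ha b hb
    apply h4
    · rw [List.getLast?_append]; simp [Option.mem_def.1 ha]
    · rw [List.head?_append, Option.mem_def.1 hb]; rfl
  · intro a ha b hb
    rw [List.isChain_append] at h3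
    apply h3.2.2
    · rw [List.getLast?_append] at ha; simpa using ha
    · simpa using hb

theorem Cyc.rot_to {V : Type} {r : V → V → Prop} {l : List V} (h : Cyc r l) {s : V} (hs : s ∈ l) :
    ∃ m, Cyc r (s :: m) ∧ ∀ x, x ∈ s :: m ↔ x ∈ l := by
  obtain ⟨l₁, l₂, rfl⟩ := List.append_of_mem hs
  refine ⟨l₂ ++ l₁, h.rot, ?_⟩
  intro x; simp; tauto

theorem fan {V : Type} [Fintype V] [DecidableEq V] (r : V → V → Prop) (C : Finset V) (v : V)
    (hv : v ∉ C) (hl : ∀ x, ¬ r x x)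
    (H : ∀ S : Finset V, S.card ≤ 2 → v ∉ S → ∃ x ∈ C, x ∉ S ∧ ReflTransGen (Av r S) v x) :
    ∃ (q : Fin 3 → List V) (e : Fin 3 → V), (∀ i, e i ∈ C) ∧ Function.Injective e ∧
      (∀ i, (v :: q i ++ [e i]).IsChain r) ∧ (∀ i, (q i).Nodup) ∧
      (∀ i, ∀ x ∈ q i, x ∉ C ∧ x ≠ v) ∧ (∀ i j, i ≠ j → ∀ x ∈ q i, x ∉ q j) := by
  classical
  let ι := {u : V // u ∉ C ∧ u ≠ v} ⊕ Fin 3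
  let t : ι → Finset V := fun i => match i with
    | Sum.inl u => Finset.univ.filter (fun y => y ≠ v ∧ (y = u.1 ∨ r u.1 y))
    | Sum.inr _ => Finset.univ.filter (fun y => y ≠ v ∧ r v y)
  have hall : ∀ s : Finset ι, s.card ≤ (s.biUnion t).card := by
    intro s
    let X : Finset V := Finset.univ.filter (fun u => ∃ h : u ∉ C ∧ u ≠ v, (Sum.inl ⟨u, h⟩ : ι) ∈ s)
    have hXs : s.toLeft.card = X.card := by
      apply Finset.card_bij (fun u _ => u.1)
      · intro u hu; simp [X]; exact ⟨u.2, by simpa using hu⟩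
      · intro a _ b _ h; exact Subtype.ext h
      · intro b hb
        simp [X] at hb
        obtain ⟨h, h'⟩ := hb
        exact ⟨⟨b, h⟩, by simpa using h', rfl⟩
    have hcard : s.card = X.card + s.toRight.card := by
      rw [← hXs, Finset.card_toLeft_add_card_toRight]
    have hXN : X ⊆ s.biUnion t := by
      intro u hu
      simp [X] at hu
      obtain ⟨h, h'⟩ := hu
      rw [Finset.mem_biUnion]
      exact ⟨_, h', by simp [t]; exact h.2⟩
    by_cases h0 : s.toRight = ∅
    · rw [hcard, h0]; simpa using Finset.card_le_card hXN
    have h3 : s.toRight.card ≤ 3 := by simpa using Finset.card_le_univ s.toRight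
    obtain ⟨i, hi⟩ := Finset.nonempty_iff_ne_empty.2 h0
    have hi' : (Sum.inr i : ι) ∈ s := by simpa using hi
    by_contra hcon
    let S := s.biUnion t \ X
    have hS : S.card ≤ 2 := by
      have := Finset.card_sdiff_add_card_eq_card hXN
      simp only [S]; omega
    have hvS : v ∉ S := by
      simp only [S, Finset.mem_sdiff, Finset.mem_biUnion]
      rintro ⟨⟨j, hj, hj'⟩, -⟩
      rcases j with j | j <;> simp [t] at hj'
    obtain ⟨x, hxC, hxS, hreach⟩ := H S hS hvS
    have key : ∀ y, ReflTransGen (Av r S) v y → y = v ∨ y ∈ X := by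
      intro y hy
      induction hy with
      | refl => left; rfl
      | @tail b c _ hab ih =>
        obtain ⟨hbc, hcS⟩ := hab
        by_cases hcv : c = v
        · exact Or.inl hcv
        right
        by_contra hcX
        apply hcS
        simp only [S, Finset.mem_sdiff, Finset.mem_biUnion]
        refine ⟨?_, hcX⟩
        rcases ih with hb | hb
        · rw [hb] at hbc
          exact ⟨_, hi', by simp [t]; exact ⟨hcv, hbc⟩⟩
        · simp [X] at hb
          obtain ⟨h, h'⟩ := hb
          exact ⟨_, h', by simp [t]; exact ⟨hcv, Or.inr hbc⟩⟩
    rcases key x hreach with rfl | hx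
    · exact hv hxC
    · simp [X] at hx
      exact hx.1.1 hxC
  obtain ⟨f, hf, hft⟩ := (Finset.all_card_le_biUnion_card_iff_exists_injective t).1 hall
  let F : V → V := fun u => if h : u ∉ C ∧ u ≠ v then f (Sum.inl ⟨u, h⟩) else u
  let o : Fin 3 → ℕ → V := fun i n => F^[n] (f (Sum.inr i))
  have ho0 : ∀ i, o i 0 = f (Sum.inr i) := fun i => rfl
  have hos : ∀ i n, o i (n+1) = F (o i n) := fun i n => by
    simp only [o, Function.iterate_succ_apply']
  have hov : ∀ i n, o i n ≠ v := by
    intro i n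
    induction n with
    | zero => rw [ho0]; have := hft (Sum.inr i); simp [t] at this; exact this.1
    | succ n ih =>
      rw [hos]
      by_cases h : o i n ∉ C ∧ o i n ≠ v
      · simp only [F, h, dif_pos, not_false_eq_true, ne_eq, and_self]
        have := hft (Sum.inl ⟨_, h⟩); simp [t] at this; exact this.1
      · simp only [F, h, dif_neg, not_false_eq_true]; exact ih
  have hos' : ∀ i n, (h : o i n ∉ C) → o i (n+1) = f (Sum.inl ⟨o i n, h, hov i n⟩) := by
    intro i n h
    rw [hos]
    have : o i n ∉ C ∧ o i n ≠ v := ⟨h, hov i n⟩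
    simp only [F, this, dif_pos, not_false_eq_true, ne_eq, and_self]
  have hinj : ∀ n m i j, (∀ k < n, o i k ∉ C) → (∀ k < m, o j k ∉ C) → o i n = o j m →
      i = j ∧ n = m := by
    intro n
    induction n with
    | zero =>
      intro m i j _ h2 h
      cases m with
      | zero => rw [ho0, ho0] at h; exact ⟨Sum.inr.inj (hf h), rfl⟩
      | succ m => rw [ho0, hos' j m (h2 m (by omega))] at h; have := hf h; simp at this
    | succ n ih =>
      intro m i j h1 h2 h
      cases m with
      | zero => rw [ho0, hos' i n (h1 n (by omega))] at h; have := hf h; simp at this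
      | succ m =>
        rw [hos' i n (h1 n (by omega)), hos' j m (h2 m (by omega))] at h
        have := congrArg Subtype.val (Sum.inl.inj (hf h))
        have := ih m i j (fun k hk => h1 k (by omega)) (fun k hk => h2 k (by omega)) this
        exact ⟨this.1, by omega⟩
  have hterm : ∀ i, ∃ n, o i n ∈ C := by
    intro i
    by_contra hcon
    push Not at hcon
    have : Function.Injective (o i) := fun a b hab =>
      (hinj a b i i (fun k _ => hcon k) (fun k _ => hcon k) hab).2
    exact not_injective_infinite_finite _ this
  let N : Fin 3 → ℕ := fun i => Nat.find (hterm i)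
  have hN : ∀ i, o i (N i) ∈ C := fun i => Nat.find_spec (hterm i)
  have hN' : ∀ i, ∀ k < N i, o i k ∉ C := fun i k hk => Nat.find_min (hterm i) hk
  refine ⟨fun i => (List.range (N i)).map (o i), fun i => o i (N i), hN, ?_, ?_, ?_, ?_, ?_⟩
  · intro i j hij
    exact (hinj _ _ i j (hN' i) (hN' j) hij).1
  · intro i
    have : v :: (List.range (N i)).map (o i) ++ [o i (N i)] =
        v :: (List.range (N i + 1)).map (o i) := by
      simp [List.range_succ]
    rw [this, List.isChain_cons]
    constructor
    · intro y hy
      rw [List.range_succ_eq_map] at hy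
      simp at hy
      subst hy
      have := hft (Sum.inr i); simp [t] at this
      exact this.2
    · rw [List.isChain_map, List.isChain_range]
      intro m hm
      have hm' : m < N i := by omega
      have h := hos' i m (hN' i m hm')
      have h2 := hft (Sum.inl ⟨o i m, hN' i m hm', hov i m⟩)
      rw [← h] at h2
      simp [t] at h2
      rcases h2.2 with h2 | h2
      · have := (hinj (m+1) m i i (fun k hk => hN' i k (by omega)) (fun k hk => hN' i k (by omega)) h2).2
        omega
      · exact h2
  · intro i
    refine List.Nodup.map_on ?_ List.nodup_range
    intro a ha b hb hab
    simp at ha hb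
    exact (hinj _ _ i i (fun k hk => hN' i k (by omega)) (fun k hk => hN' i k (by omega)) hab).2
  · intro i x hx
    simp at hx
    obtain ⟨k, hk, rfl⟩ := hx
    exact ⟨hN' i k hk, hov i k⟩
  · intro i j hij x hx hx'
    simp at hx hx'
    obtain ⟨k, hk, rfl⟩ := hx
    obtain ⟨k', hk', h⟩ := hx'
    exact hij (hinj _ _ j i (fun k hk => hN' j k (by omega)) (fun k hk => hN' i k (by omega)) h).1.symm

set_option maxHeartbeats 1000000 in
theorem subdiv {V : Type} (D : Digraph' V) (c0 c1 c2 v : V) (l0 l1 l2 q0 q1 q2 : List V)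
    (h01 : (c0 :: l0 ++ [c1]).IsChain D.Adj) (h12 : (c1 :: l1 ++ [c2]).IsChain D.Adj)
    (h20 : (c2 :: l2 ++ [c0]).IsChain D.Adj)
    (g0 : (v :: q0 ++ [c0]).IsChain D.Adj) (g1 : (v :: q1 ++ [c1]).IsChain D.Adj)
    (g2 : (v :: q2 ++ [c2]).IsChain D.Adj)
    (hnd : (c0 :: c1 :: c2 :: v :: (l0 ++ (l1 ++ (l2 ++ (q0 ++ (q1 ++ q2)))))).Nodup) :
    D.ContainsSubdivision W4plus := by
  simp only [List.nodup_cons, List.nodup_append, List.mem_cons, List.mem_append, not_or] at hnd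
  refine ⟨![c0, c1, c2, v], fun a b _ => (![![[], l0, [], []], ![[], [], l1, []],
    ![l2, [], [], []], ![q0, q1, q2, []]] : Fin 4 → Fin 4 → List V) a b, ?_, ?_, ?_, ?_⟩
  · intro a b hab
    fin_cases a <;> fin_cases b <;> simp at hab ⊢ <;> grind
  · intro a b h
    fin_cases a <;> fin_cases b <;> simp [W4plus] at h ⊢ <;>
      simp only [Digraph'.IsDipath, List.Chain'] <;> refine ⟨by assumption, ?_⟩ <;>
      simp only [List.nodup_cons, List.nodup_append, List.mem_cons, List.mem_append, List.cons_append] <;>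
      grind
  · intro a b h x hx
    simp only [Set.mem_range, not_exists]
    intro i
    fin_cases a <;> fin_cases b <;> simp [W4plus] at h hx ⊢ <;> fin_cases i <;> simp <;> grind
  · intro a b h a' b' h' hne x hx
    clear h01 h12 h20 g0 g1 g2
    obtain ⟨-, -, -, -, -, ⟨-, ⟨-, ⟨-, ⟨-, -, d1⟩, d2⟩, d3⟩, d4⟩, d5⟩ := hnd
    replace d1 := fun h h' => d1 x h x h' rfl
    replace d2 := fun h h' => d2 x h x h' rfl
    replace d3 := fun h h' => d3 x h x h' rfl
    replace d4 := fun h h' => d4 x h x h' rfl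
    replace d5 := fun h h' => d5 x h x h' rfl
    fin_cases a <;> fin_cases b <;> simp [W4plus] at h hx <;>
    fin_cases a' <;> fin_cases b' <;> simp [W4plus] at h' hne ⊢ <;> tauto

theorem noFan_of_noSub {V : Type} [Fintype V] (D : Digraph' V) (hl : D.Loopless)
    (h : ¬ D.ContainsSubdivision W4plus) : NoFan D.Adj := by
  classical
  intro l hc v hv
  by_contra hcon
  push Not at hcon
  obtain ⟨q, e, he, heinj, hch, hqn, hqC, hqd⟩ := fan D.Adj l.toFinset v (by simpa using hv) hl (by
    intro S h1 h2
    obtain ⟨x, hx⟩ := hcon S h1 h2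
    exact ⟨x, by simpa using hx⟩)
  simp only [List.mem_toFinset] at he hqC
  obtain ⟨m, hm, hml⟩ := hc.rot_to (he 0)
  have e01 : e 0 ≠ e 1 := fun h => by simpa using heinj h
  have e02 : e 0 ≠ e 2 := fun h => by simpa using heinj h
  have e12 : e 1 ≠ e 2 := fun h => by simpa using heinj h
  have hm1 : e 1 ∈ m := by
    have := (hml (e 1)).2 (he 1)
    simpa [e01.symm] using this
  have hm2 : e 2 ∈ m := by
    have := (hml (e 2)).2 (he 2)
    simpa [e02.symm] using this
  apply h
  have d01 := hqd 0 1 (by decide)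
  have d02 := hqd 0 2 (by decide)
  have d12 := hqd 1 2 (by decide)
  have k0 := hqC 0
  have k1 := hqC 1
  have k2 := hqC 2
  have n0 := hqn 0
  have n1 := hqn 1
  have n2 := hqn 2
  obtain ⟨hnd, -, hcm, hlast⟩ := hm
  have hcm' : (e 0 :: m ++ [e 0]).IsChain D.Adj := by
    rw [List.isChain_append]
    refine ⟨hcm, by simp, ?_⟩
    intro a ha b hb
    apply hlast a ha
    simpa using hb
  obtain ⟨m1, m2, rfl⟩ := List.append_of_mem hm1
  rw [List.mem_append] at hm2
  simp only [List.nodup_cons, List.nodup_append, List.mem_cons, List.mem_append, not_or] at hnd hml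
  rcases hm2 with hm2 | hm2
  · obtain ⟨m3, m4, rfl⟩ := List.append_of_mem hm2
    have a1 : e 0 :: (m3 ++ e 2 :: m4 ++ e 1 :: m2) ++ [e 0] = (e 0 :: m3) ++ e 2 :: (m4 ++ e 1 :: (m2 ++ [e 0])) := by simp
    rw [a1, List.isChain_split] at hcm'
    obtain ⟨hA, hB⟩ := hcm'
    have a2 : e 2 :: (m4 ++ e 1 :: (m2 ++ [e 0])) = (e 2 :: m4) ++ e 1 :: (m2 ++ [e 0]) := by simp
    rw [a2, List.isChain_split] at hB
    refine subdiv D (e 0) (e 2) (e 1) v m3 m4 m2 (q 0) (q 2) (q 1) hA hB.1 hB.2 (hch 0) (hch 2) (hch 1) ?_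
    simp only [List.nodup_cons, List.nodup_append, List.mem_cons, List.mem_append, not_or] at hnd hml ⊢
    clear hcm hA hB hlast hcon a1 a2 hch h hc
    grind
  · rw [List.mem_cons] at hm2
    obtain ⟨m3, m4, rfl⟩ := List.append_of_mem (hm2.resolve_left e12.symm)
    have a1 : e 0 :: (m1 ++ e 1 :: (m3 ++ e 2 :: m4)) ++ [e 0] = (e 0 :: m1) ++ e 1 :: (m3 ++ e 2 :: (m4 ++ [e 0])) := by simp
    rw [a1, List.isChain_split] at hcm'
    obtain ⟨hA, hB⟩ := hcm'
    have a2 : e 1 :: (m3 ++ e 2 :: (m4 ++ [e 0])) = (e 1 :: m3) ++ e 2 :: (m4 ++ [e 0]) := by simp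
    rw [a2, List.isChain_split] at hB
    refine subdiv D (e 0) (e 1) (e 2) v m1 m3 m4 (q 0) (q 1) (q 2) hA hB.1 hB.2 (hch 0) (hch 1) (hch 2) ?_
    simp only [List.nodup_cons, List.nodup_append, List.mem_cons, List.mem_append, not_or] at hnd hml ⊢
    clear hcm hA hB hlast hcon a1 a2 hch h hc
    grind

end W4proof

namespace W4proof

open Relation

/-- A simple directed path given by its vertex list. -/
structure Pth {V : Type} (r : V → V → Prop) (a : V) (l : List V) (b : V) : Prop where
  nd : l.Nodup
  ch : l.IsChain r
  hd : l.head? = some a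
  la : l.getLast? = some b

theorem Pth.ne_nil {V : Type} {r : V → V → Prop} {a b : V} {l : List V} (h : Pth r a l b) :
    l ≠ [] := by
  rintro rfl; have := h.hd; simp at this

theorem Pth.pos {V : Type} {r : V → V → Prop} {a b : V} {l : List V} (h : Pth r a l b) :
    0 < l.length := List.length_pos_iff.2 h.ne_nil

theorem Pth.head_mem {V : Type} {r : V → V → Prop} {a b : V} {l : List V} (h : Pth r a l b) :
    a ∈ l := List.mem_of_mem_head? h.hd

theorem Pth.last_mem {V : Type} {r : V → V → Prop} {a b : V} {l : List V} (h : Pth r a l b) :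
    b ∈ l := List.mem_of_mem_getLast? h.la

theorem Pth.single {V : Type} (r : V → V → Prop) (a : V) : Pth r a [a] a :=
  ⟨by simp, by simp, by simp, by simp⟩

theorem Pth.mono {V : Type} {r r' : V → V → Prop} {a b : V} {l : List V} (h : Pth r a l b)
    (hr : ∀ x y, r x y → r' x y) : Pth r' a l b :=
  ⟨h.nd, h.ch.imp (fun x y => hr x y), h.hd, h.la⟩

theorem Pth.append {V : Type} {r : V → V → Prop} {a b c d : V} {l m : List V} (h : Pth r a l b)
    (h' : Pth r c m d) (hbc : r b c) (hd : ∀ x ∈ l, x ∉ m) : Pth r a (l ++ m) d := by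
  refine ⟨?_, ?_, ?_, ?_⟩
  · rw [List.nodup_append]
    refine ⟨h.nd, h'.nd, ?_⟩
    rintro x hx y hy rfl; exact hd x hx hy
  · rw [List.isChain_append]
    refine ⟨h.ch, h'.ch, ?_⟩
    intro x hx y hy
    rw [h.la] at hx; rw [h'.hd] at hy
    simp at hx hy; subst hx; subst hy; exact hbc
  · rw [List.head?_append, h.hd]; rfl
  · rw [List.getLast?_append, h'.la]; rfl

theorem Pth.cons {V : Type} {r : V → V → Prop} {a b c : V} {l : List V} (h : Pth r a l b)
    (hca : r c a) (hc : c ∉ l) : Pth r c (c :: l) b := by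
  have := (Pth.single r c).append h hca (by simpa using hc)
  simpa using this

theorem Pth.cyc {V : Type} {r : V → V → Prop} {a b : V} {l : List V} (h : Pth r a l b)
    (hba : r b a) (hl : 3 ≤ l.length) : Cyc r l := by
  refine ⟨h.nd, hl, h.ch, ?_⟩
  intro x hx y hy
  rw [h.la] at hx; rw [h.hd] at hy
  simp at hx hy; subst hx; subst hy; exact hba

theorem Pth.rev {V : Type} {r : V → V → Prop} {a b : V} {l : List V} (h : Pth r a l b) :
    Pth (fun x y => r y x) b l.reverse a := by
  refine ⟨by simpa using h.nd, ?_, by simpa using h.la, by simpa using h.hd⟩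
  rw [List.isChain_reverse]; exact h.ch

theorem Pth.get_zero {V : Type} {r : V → V → Prop} {a b : V} {l : List V} (h : Pth r a l b) :
    l[0]? = some a := by
  rw [← List.head?_eq_getElem?]; exact h.hd

theorem Pth.get_last {V : Type} {r : V → V → Prop} {a b : V} {l : List V} (h : Pth r a l b) :
    l[l.length - 1]? = some b := by
  rw [← List.getLast?_eq_getElem?]; exact h.la

theorem Pth.take {V : Type} {r : V → V → Prop} {a b x : V} {l : List V} (h : Pth r a l b)
    {i : ℕ} (hi : l[i]? = some x) : Pth r a (l.take (i+1)) x := by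
  refine ⟨h.nd.sublist (List.take_sublist _ _), h.ch.take _, ?_, ?_⟩
  · rw [List.head?_take]; simp [h.hd]
  · rw [List.getLast?_take]; simp [hi]

theorem Pth.drop {V : Type} {r : V → V → Prop} {a b x : V} {l : List V} (h : Pth r a l b)
    {i : ℕ} (hi : l[i]? = some x) : Pth r x (l.drop i) b := by
  have hlt : i < l.length := by
    by_contra hc
    rw [List.getElem?_eq_none (by omega)] at hi; simp at hi
  refine ⟨h.nd.sublist (List.drop_sublist _ _), h.ch.drop _, ?_, ?_⟩
  · rw [List.head?_drop]; exact hi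
  · rw [List.getLast?_drop]; simp [h.la]; omega

theorem Pth.step {V : Type} {r : V → V → Prop} {a b x y : V} {l : List V} (h : Pth r a l b)
    {i : ℕ} (hi : l[i]? = some x) (hj : l[i+1]? = some y) : r x y := by
  have := List.isChain_iff_getElem.1 h.ch
  rw [List.getElem?_eq_some_iff] at hi hj
  obtain ⟨h1, rfl⟩ := hi
  obtain ⟨h2, rfl⟩ := hj
  exact this i h2

theorem Pth.inj {V : Type} {r : V → V → Prop} {a b x : V} {l : List V} (h : Pth r a l b)
    {i j : ℕ} (hi : l[i]? = some x) (hj : l[j]? = some x) : i = j := by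
  rw [List.getElem?_eq_some_iff] at hi hj
  obtain ⟨h1, h1'⟩ := hi
  obtain ⟨h2, h2'⟩ := hj
  exact (h.nd.getElem_inj_iff).1 (h1'.trans h2'.symm)

theorem Pth.all {V : Type} {r : V → V → Prop} {P : V → Prop} {a b : V} {l : List V}
    (h : Pth r a l b) (ha : P a) (hr : ∀ x y, r x y → P y) : ∀ x ∈ l, P x := by
  intro x hx
  rw [List.mem_iff_getElem?] at hx
  obtain ⟨i, hi⟩ := hx
  rcases i with _ | i
  · rw [h.get_zero] at hi; simp at hi; exact hi ▸ ha
  · have hlt : i + 1 < l.length := by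
      by_contra hc
      rw [List.getElem?_eq_none (by omega)] at hi; simp at hi
    exact hr _ _ (h.step (i := i) (x := l[i]) (by simp) hi)

theorem Pth.exists {V : Type} {r : V → V → Prop} {a b : V} (h : ReflTransGen r a b) :
    ∃ l, Pth r a l b := by
  classical
  induction h using ReflTransGen.head_induction_on with
  | refl => exact ⟨[b], Pth.single r b⟩
  | @head x y hxy _ ih =>
    obtain ⟨l, hl⟩ := ih
    by_cases hx : x ∈ l
    · rw [List.mem_iff_getElem?] at hx
      obtain ⟨i, hi⟩ := hx
      exact ⟨_, hl.drop hi⟩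
    · exact ⟨_, hl.cons hxy hx⟩

theorem Pth.reach {V : Type} {r : V → V → Prop} {a b : V} {l : List V} (h : Pth r a l b) :
    ∀ x ∈ l, ReflTransGen r a x ∧ ReflTransGen r x b := by
  have key : ∀ n (a b : V) (l : List V), l.length = n → Pth r a l b → ReflTransGen r a b := by
    intro n
    induction n with
    | zero => intro a b l hl h; exact absurd hl (by have := h.pos; omega)
    | succ n ih =>
      intro a b l hl h
      rcases l with _ | ⟨x, _ | ⟨y, m⟩⟩
      · simp at hl
      · have h1 := h.hd; have h2 := h.la; simp at h1 h2; subst h1; subst h2; exact .refl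
      · have h1 := h.hd; simp at h1; subst h1
        have hd := h.drop (i := 1) (x := y) (by simp)
        refine ReflTransGen.head (h.step (i := 0) (by simp) (by simp)) (ih y b (y :: m) (by simpa using hl) hd)
  intro x hx
  rw [List.mem_iff_getElem?] at hx
  obtain ⟨i, hi⟩ := hx
  exact ⟨key _ _ _ _ rfl (h.take hi), key _ _ _ _ rfl (h.drop hi)⟩

/-- A long cycle gives reachability between its members. -/
theorem Pth.of_lt {V : Type} {x : V} {l : List V} {i : ℕ} (hi : l[i]? = some x) : i < l.length := by
  by_contra hc
  rw [List.getElem?_eq_none (by omega)] at hi; simp at hi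

/-- A walk from `A` to outside `A` has a last exit. -/
theorem last_exit {V : Type} {r : V → V → Prop} {A : V → Prop} {x y : V} (h : ReflTransGen r x y)
    (hx : A x) (hy : ¬ A y) :
    ∃ a b, A a ∧ ¬ A b ∧ r a b ∧ ReflTransGen (fun u v => r u v ∧ ¬ A u ∧ ¬ A v) b y := by
  have key : A x ∧ (∃ a b, A a ∧ ¬ A b ∧ r a b ∧ ReflTransGen (fun u v => r u v ∧ ¬ A u ∧ ¬ A v) b y)
      ∨ ¬ A x ∧ ((∃ a b, A a ∧ ¬ A b ∧ r a b ∧ ReflTransGen (fun u v => r u v ∧ ¬ A u ∧ ¬ A v) b y) ∨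
        ReflTransGen (fun u v => r u v ∧ ¬ A u ∧ ¬ A v) x y) := by
    clear hx
    induction h using ReflTransGen.head_induction_on with
    | refl => exact .inr ⟨hy, .inr .refl⟩
    | @head u v huv _ ih =>
      by_cases hu : A u
      · refine .inl ⟨hu, ?_⟩
        rcases ih with ⟨_, h⟩ | ⟨hv, h | h⟩
        · exact h
        · exact h
        · exact ⟨u, v, hu, hv, huv, h⟩
      · refine .inr ⟨hu, ?_⟩
        rcases ih with ⟨_, h⟩ | ⟨hv, h | h⟩
        · exact .inl h
        · exact .inl h
        · exact .inr (.head ⟨huv, hu, hv⟩ h)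
  rcases key with ⟨_, h⟩ | ⟨h, _⟩
  · exact h
  · exact absurd hx h

theorem rtg_mono {V : Type} {r r' : V → V → Prop} {x y : V} (h : ReflTransGen r x y)
    (hr : ∀ a b, r a b → r' a b) : ReflTransGen r' x y := by
  induction h with
  | refl => exact .refl
  | @tail b c _ hbc ih => exact .tail ih (hr _ _ hbc)

theorem tg_mono {V : Type} {r r' : V → V → Prop} {x y : V} (h : TransGen r x y)
    (hr : ∀ a b, r a b → r' a b) : TransGen r' x y := by
  induction h with
  | @single b hb => exact .single (hr _ _ hb)
  | @tail b c _ hbc ih => exact .tail ih (hr _ _ hbc)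

theorem rtg_flip {V : Type} {r r' : V → V → Prop} {x y : V} (h : ReflTransGen r x y)
    (hr : ∀ a b, r a b → r' b a) : ReflTransGen r' y x := by
  induction h with
  | refl => exact .refl
  | @tail b c _ hbc ih => exact .head (hr _ _ hbc) ih

theorem tg_flip {V : Type} {r r' : V → V → Prop} {x y : V} (h : TransGen r x y)
    (hr : ∀ a b, r a b → r' b a) : TransGen r' y x := by
  induction h with
  | @single b hb => exact .single (hr _ _ hb)
  | @tail b c _ hbc ih => exact .head (hr _ _ hbc) ih

/-- A walk into `A` from outside has a first entry. -/
theorem first_entry {V : Type} {r : V → V → Prop} {A : V → Prop} {x y : V} (h : ReflTransGen r x y)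
    (hx : ¬ A x) (hy : A y) :
    ∃ a b, A a ∧ ¬ A b ∧ r b a ∧ ReflTransGen (fun u v => r u v ∧ ¬ A u ∧ ¬ A v) x b := by
  obtain ⟨a, b, ha, hb, hab, h⟩ := last_exit (A := A) (rtg_flip (r' := fun a b => r b a) h (fun _ _ h => h)) hy hx
  exact ⟨a, b, ha, hb, hab, rtg_flip h (fun a b h => ⟨h.1, h.2.2, h.2.1⟩)⟩

theorem rtg_inv {V : Type} {r : V → V → Prop} {P : V → Prop} {x y : V} (h : ReflTransGen r x y)
    (hx : P x) (hr : ∀ a b, P a → r a b → P b) : P y := by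
  induction h with
  | refl => exact hx
  | @tail b c _ hbc ih => exact hr _ _ ih hbc

theorem rtg_inv_head {V : Type} {r : V → V → Prop} {P : V → Prop} {x y : V} (h : ReflTransGen r x y)
    (hy : P y) (hr : ∀ a b, P b → r a b → P a) : P x :=
  rtg_inv (rtg_flip (r' := fun a b => r b a) h (fun _ _ h => h)) hy (fun a b ha hab => hr b a ha hab)


/-- Monochromatic arcs. -/
def Mn {V : Type} (r : V → V → Prop) (c : V → Fin 3) : V → V → Prop := fun x y => r x y ∧ c x = c y

/-- `c` is an acyclic colouring of `r`. -/
def Good {V : Type} (r : V → V → Prop) (c : V → Fin 3) : Prop := ∀ v, ¬ TransGen (Mn r c) v v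

/-- Acyclically 3-colourable. -/
def Col3 {V : Type} (r : V → V → Prop) : Prop := ∃ c, Good r c

/-- Vertex deletion (arcs only). -/
def del {V : Type} (r : V → V → Prop) (Q : V → Prop) : V → V → Prop := fun x y => r x y ∧ ¬ Q x ∧ ¬ Q y

theorem Good.mono {V : Type} {r r' : V → V → Prop} {c c' : V → Fin 3} (h : Good r c)
    (hr : ∀ x y, r' x y → c' x = c' y → r x y ∧ c x = c y) : Good r' c' := by
  intro v hv
  exact h v (tg_mono hv (fun x y hxy => hr x y hxy.1 hxy.2))

theorem Good.flip {V : Type} {r : V → V → Prop} {c : V → Fin 3} (h : Good r c) :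
    Good (fun x y => r y x) c := by
  intro v hv
  exact h v (tg_flip hv (fun a b h => ⟨h.1, h.2.symm⟩))

theorem good_of_set {V : Type} {r : V → V → Prop} {c : V → Fin 3} (Q : V → Prop)
    (h : Good (del r Q) c) (hQ : ∀ x, Q x → ¬ TransGen (Mn r c) x x) : Good r c := by
  intro v hv
  have key : ∀ y, TransGen (Mn r c) y v → TransGen (Mn (del r Q) c) y v ∨
      ∃ x, Q x ∧ ReflTransGen (Mn r c) y x ∧ ReflTransGen (Mn r c) x v := by
    intro y hy
    induction hy using TransGen.head_induction_on with
    | @single a ha =>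
      by_cases h1 : Q a
      · exact .inr ⟨a, h1, .refl, .single ha⟩
      by_cases h2 : Q v
      · exact .inr ⟨v, h2, .single ha, .refl⟩
      exact .inl (.single ⟨⟨ha.1, h1, h2⟩, ha.2⟩)
    | @head a b hab hbv ih =>
      by_cases h1 : Q a
      · exact .inr ⟨a, h1, .refl, .head hab hbv.to_reflTransGen⟩
      rcases ih with ih | ⟨x, hx, h3, h4⟩
      · by_cases h2 : Q b
        · exact .inr ⟨b, h2, .single hab, hbv.to_reflTransGen⟩
        · exact .inl (.head ⟨⟨hab.1, h1, h2⟩, hab.2⟩ ih)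
      · exact .inr ⟨x, hx, .head hab h3, h4⟩
  rcases key v hv with h1 | ⟨x, hx, h1, h2⟩
  · exact h v h1
  · exact hQ x hx (TransGen.trans_right h2 (TransGen.trans_left hv h1))

theorem no_out {V : Type} {r : V → V → Prop} {x : V} (h : ∀ y, ¬ r x y) : ¬ TransGen r x x := by
  intro hx
  obtain ⟨y, hy, _⟩ := TransGen.head'_iff.1 hx
  exact h y hy

theorem no_in {V : Type} {r : V → V → Prop} {x : V} (h : ∀ y, ¬ r y x) : ¬ TransGen r x x := by
  intro hx
  obtain ⟨y, _, hy⟩ := TransGen.tail'_iff.1 hx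
  exact h y hy

theorem good_cut {V : Type} {r : V → V → Prop} {c : V → Fin 3} (T : V → Prop)
    (hT : ∀ x y, T x → r x y → T y) (h1 : Good (del r T) c) (h2 : Good (del r (fun x => ¬ T x)) c) :
    Good r c := by
  refine good_of_set T h1 ?_
  intro x hx hxx
  refine h2 x ?_
  have : ∀ y, TransGen (Mn r c) x y → T y ∧ TransGen (Mn (del r (fun x => ¬ T x)) c) x y := by
    intro y hy
    induction hy with
    | @single b hb =>
      have := hT _ _ hx hb.1
      exact ⟨this, .single ⟨⟨hb.1, by simpa using hx, by simpa using this⟩, hb.2⟩⟩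
    | @tail a b _ hab ih =>
      have := hT _ _ ih.1 hab.1
      exact ⟨this, .tail ih.2 ⟨⟨hab.1, by simpa using ih.1, by simpa using this⟩, hab.2⟩⟩
  exact (this x hxx).2

theorem same_color {V : Type} {r : V → V → Prop} {s t : V} (h : Col3 r)
    (hst : ¬ ReflTransGen r t s) : ∃ c, Good r c ∧ c s = c t := by
  classical
  obtain ⟨c, hc⟩ := h
  let T : V → Prop := fun x => ReflTransGen r t x
  let c' : V → Fin 3 := fun x => if T x then Equiv.swap (c t) (c s) (c x) else c x
  refine ⟨c', good_cut T (fun x y hx hxy => ReflTransGen.tail hx hxy) ?_ ?_, ?_⟩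
  · refine hc.mono ?_
    rintro x y ⟨h1, h2, h3⟩ h4
    simp only [c', h2, h3, if_false] at h4
    exact ⟨h1, h4⟩
  · refine hc.mono ?_
    rintro x y ⟨h1, h2, h3⟩ h4
    simp only [not_not] at h2 h3
    simp only [c', h2, h3, if_true] at h4
    exact ⟨h1, (Equiv.injective _) h4⟩
  · have h1 : T t := ReflTransGen.refl
    have h2 : ¬ T s := hst
    simp [c', h1, h2]

theorem third (a b : Fin 3) : ∃ c : Fin 3, c ≠ a ∧ c ≠ b := by
  revert a b; decide

theorem NoFan.mono {V : Type} {r r' : V → V → Prop} (h : NoFan r) (hr : ∀ x y, r' x y → r x y) :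
    NoFan r' := by
  intro l hl v hv
  have : Cyc r l := ⟨hl.1, hl.2.1, hl.2.2.1.imp (fun x y => hr x y), fun a ha b hb => hr _ _ (hl.2.2.2 a ha b hb)⟩
  obtain ⟨S, h1, h2, h3⟩ := h l this v hv
  refine ⟨S, h1, h2, fun x hx hxS hreach => h3 x hx hxS ?_⟩
  exact rtg_mono hreach (fun a b hab => ⟨hr _ _ hab.1, hab.2⟩)

/-- The induction hypothesis in usable form. -/
def IHV (V : Type) : Prop :=
  ∀ (E : V → V → Prop) (w : V), (∀ x y, E x y → x ≠ w ∧ y ≠ w) → (∀ x, ¬ E x x) → NoFan E → Col3 E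

theorem ihv {V : Type} [Fintype V]
    (ih : ∀ (W : Type) [Fintype W], Fintype.card W < Fintype.card V → ∀ r : W → W → Prop,
      (∀ x, ¬ r x x) → NoFan r → Col3 r) : IHV V := by
  classical
  intro E w hE hl hN
  let W := {x : V // x ≠ w}
  let E' : W → W → Prop := fun a b => E a.1 b.1
  have hcard : Fintype.card W < Fintype.card V :=
    Fintype.card_subtype_lt (x := w) (by simp)
  obtain ⟨c, hc⟩ := ih W hcard E' (fun x => hl _) (by
    intro l hl v hv
    have hcyc : Cyc E (l.map Subtype.val) := by
      refine ⟨hl.1.map Subtype.val_injective, by simpa using hl.2.1, ?_, ?_⟩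
      · rw [List.isChain_map]; exact hl.2.2.1
      · intro a ha b hb
        simp only [List.getLast?_map, List.head?_map, Option.mem_def, Option.map_eq_some_iff] at ha hb
        obtain ⟨a', ha', rfl⟩ := ha
        obtain ⟨b', hb', rfl⟩ := hb
        exact hl.2.2.2 a' ha' b' hb'
    obtain ⟨S, h1, h2, h3⟩ := hN _ hcyc v.1 (by
      intro hm; rw [List.mem_map] at hm; obtain ⟨a, ha, hav⟩ := hm
      exact hv (Subtype.ext hav ▸ ha))
    refine ⟨S.subtype (fun x => x ≠ w), ?_, fun h => h2 (Finset.mem_subtype.1 h), ?_⟩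
    · rw [Finset.card_subtype]; exact (Finset.card_filter_le _ _).trans h1
    · intro x hx hxS hreach
      refine h3 x.1 (List.mem_map_of_mem hx) (fun h => hxS (Finset.mem_subtype.2 h)) ?_
      clear hx hxS
      induction hreach with
      | refl => exact .refl
      | @tail a b _ hab ih => exact .tail ih ⟨hab.1, fun h => hab.2 (Finset.mem_subtype.2 h)⟩)
  refine ⟨fun x => if h : x ≠ w then c ⟨x, h⟩ else 0, ?_⟩
  intro v hv
  have hvw : v ≠ w := by
    obtain ⟨y, hy, _⟩ := TransGen.head'_iff.1 hv
    exact (hE _ _ hy.1).1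
  have key : ∀ y, TransGen (Mn E (fun x => if h : x ≠ w then c ⟨x, h⟩ else 0)) v y →
      ∃ hy : y ≠ w, TransGen (Mn E' c) ⟨v, hvw⟩ ⟨y, hy⟩ := by
    intro y hy
    induction hy with
    | @single b hb =>
      have hbw := (hE _ _ hb.1).2
      refine ⟨hbw, .single ⟨hb.1, ?_⟩⟩
      have := hb.2
      simpa [hvw, hbw] using this
    | @tail a b _ hab ih =>
      obtain ⟨ha, ih⟩ := ih
      have hbw := (hE _ _ hab.1).2
      refine ⟨hbw, .tail ih ⟨hab.1, ?_⟩⟩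
      have := hab.2
      simpa [ha, hbw] using this
  obtain ⟨_, h⟩ := key v hv
  exact hc _ h

end W4proof

namespace W4proof

open Relation

theorem lowdeg_out {V : Type} {r : V → V → Prop} (ih : IHV V) (hl : ∀ x, ¬ r x x) (hN : NoFan r)
    (x u w : V) (h : ∀ y, r x y → y = u ∨ y = w) : Col3 r := by
  classical
  obtain ⟨c, hc⟩ := ih (del r (fun y => y = x)) x (fun a b h => h.2) (fun a h => hl a h.1)
    (hN.mono (fun a b h => h.1))
  obtain ⟨k, hk1, hk2⟩ := third (c u) (c w)
  refine ⟨Function.update c x k, good_of_set (fun y => y = x) ?_ ?_⟩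
  · refine hc.mono ?_
    intro a b hab hcab
    refine ⟨hab, ?_⟩
    simpa [Function.update_of_ne hab.2.1, Function.update_of_ne hab.2.2] using hcab
  · rintro y rfl
    refine no_out ?_
    rintro z ⟨hz, hcz⟩
    have hne : z ≠ y := by rintro rfl; exact hl _ hz
    rw [Function.update_self, Function.update_of_ne hne] at hcz
    rcases h z hz with rfl | rfl
    · exact hk1 hcz
    · exact hk2 hcz

theorem lowdeg_in {V : Type} {r : V → V → Prop} (ih : IHV V) (hl : ∀ x, ¬ r x x) (hN : NoFan r)
    (x u w : V) (h : ∀ y, r y x → y = u ∨ y = w) : Col3 r := by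
  classical
  obtain ⟨c, hc⟩ := ih (del r (fun y => y = x)) x (fun a b h => h.2) (fun a h => hl a h.1)
    (hN.mono (fun a b h => h.1))
  obtain ⟨k, hk1, hk2⟩ := third (c u) (c w)
  refine ⟨Function.update c x k, good_of_set (fun y => y = x) ?_ ?_⟩
  · refine hc.mono ?_
    intro a b hab hcab
    refine ⟨hab, ?_⟩
    simpa [Function.update_of_ne hab.2.1, Function.update_of_ne hab.2.2] using hcab
  · rintro y rfl
    refine no_in ?_
    rintro z ⟨hz, hcz⟩
    have hne : z ≠ y := by rintro rfl; exact hl _ hz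
    rw [Function.update_self, Function.update_of_ne hne] at hcz
    rcases h z hz with rfl | rfl
    · exact hk1 hcz.symm
    · exact hk2 hcz.symm

/-- Contracting `R` onto its unique out-neighbour `s`. -/
def Ctr {V : Type} (r : V → V → Prop) (R : V → Prop) (s : V) : V → V → Prop := fun x y =>
  ¬ R x ∧ ¬ R y ∧ (r x y ∨ (y = s ∧ x ≠ s ∧ ∃ z, R z ∧ r x z ∧ ReflTransGen (fun a b => R a ∧ r a b) z s))

theorem chain_ctr {V : Type} {r E : V → V → Prop} {s : V} (hE : ∀ a b, E a b → b ≠ s → r a b) :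
    ∀ (m : List V) (x : V), (x :: m).IsChain E → (∀ y ∈ m, y ≠ s) → (x :: m).IsChain r := by
  intro m
  induction m with
  | nil => intro x _ _; simp
  | cons y m ih =>
    intro x h hm
    rw [List.isChain_cons_cons] at h ⊢
    exact ⟨hE _ _ h.1 (hm y (by simp)), ih y h.2 (fun z hz => hm z (by simp [hz]))⟩

theorem Cyc.pth {V : Type} {r : V → V → Prop} {x : V} {m : List V} (h : Cyc r (x :: m)) :
    ∃ b, Pth r x (x :: m) b ∧ r b x := by
  have : ((x :: m).getLast?).isSome := by simp
  obtain ⟨b, hb⟩ := Option.isSome_iff_exists.1 this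
  exact ⟨b, ⟨h.1, h.2.2.1, by simp, hb⟩, h.2.2.2 b hb x (by simp)⟩

theorem ctr_lift {V : Type} {r : V → V → Prop} {R : V → Prop} {s : V} (hs : ¬ R s)
    (hRs : ∀ x y, R x → r x y → R y ∨ y = s) {l : List V} (hl : Cyc (Ctr r R s) l) :
    ∃ l', Cyc r l' ∧ (∀ x ∈ l, x ∈ l') ∧ ∀ x ∈ l', x ∈ l ∨ R x := by
  have hE : ∀ a b, Ctr r R s a b → b ≠ s → r a b := by
    rintro a b ⟨_, _, h | h⟩ hb
    · exact h
    · exact absurd h.1 hb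
  by_cases hsl : s ∈ l
  · obtain ⟨m, hm, hml⟩ := hl.rot_to hsl
    obtain ⟨b, hb, hbs⟩ := hm.pth
    have hnd := hm.1
    rw [List.nodup_cons] at hnd
    have hch : (s :: m).IsChain r := chain_ctr hE m s hb.ch (by
      rintro y hy rfl; exact hnd.1 hy)
    have hP : Pth r s (s :: m) b := ⟨hb.nd, hch, hb.hd, hb.la⟩
    have hnR : ∀ x ∈ s :: m, ¬ R x := hb.all hs (fun x y h => h.2.1)
    rcases hbs with ⟨_, _, h | ⟨_, hbs, z, hz, hbz, hzs⟩⟩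
    · exact ⟨s :: m, hP.cyc h hm.2.1, fun x hx => (hml x).2 hx, fun x hx => .inl ((hml x).1 hx)⟩
    · have hzs' : z ≠ s := by rintro rfl; exact hs hz
      obtain ⟨a, d, rfl, hds, hda, hzd⟩ := first_entry (A := fun x => x = s) hzs hzs' rfl
      obtain ⟨p, hp⟩ := Pth.exists hzd
      have hpR : ∀ x ∈ p, R x := hp.all hz (by
        rintro x y ⟨⟨h1, h2⟩, h3, h4⟩
        rcases hRs x y h1 h2 with h | h
        · exact h
        · exact absurd h h4)
      have hp' : Pth r z p d := hp.mono (fun x y h => h.1.2)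
      have happ := hP.append hp' hbz (fun x hx hx' => hnR x hx (hpR x hx'))
      refine ⟨_, happ.cyc hda.2 (by have := hm.2.1; rw [List.length_append]; omega), ?_, ?_⟩
      · intro x hx; rw [List.mem_append]; exact .inl ((hml x).2 hx)
      · intro x hx; rw [List.mem_append] at hx
        rcases hx with hx | hx
        · exact .inl ((hml x).1 hx)
        · exact .inr (hpR x hx)
  · refine ⟨l, ?_, fun x hx => hx, fun x hx => .inl hx⟩
    rcases l with _ | ⟨x, m⟩
    · have := hl.2.1; simp at this
    obtain ⟨b, hb, hbs⟩ := hl.pth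
    have hch : (x :: m).IsChain r := chain_ctr hE m x hb.ch (by
      rintro y hy rfl; exact hsl (by simp [hy]))
    have hP : Pth r x (x :: m) b := ⟨hb.nd, hch, hb.hd, hb.la⟩
    exact hP.cyc (hE _ _ hbs (by rintro rfl; exact hsl (by simp))) hl.2.1

theorem ctr_noFan {V : Type} {r : V → V → Prop} (hN : NoFan r) {R : V → Prop} {s : V} (hs : ¬ R s)
    (hRs : ∀ x y, R x → r x y → R y ∨ y = s) : NoFan (Ctr r R s) := by
  classical
  intro l hl v hv
  by_cases hvR : R v
  · refine ⟨∅, by simp, by simp, ?_⟩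
    intro x hx _ hreach
    have : x = v := by
      rcases ReflTransGen.cases_head hreach with h | ⟨c, hc, _⟩
      · exact h.symm
      · exact absurd hvR hc.1.1
    exact hv (this ▸ hx)
  obtain ⟨l', hl', h1, h2⟩ := ctr_lift hs hRs hl
  obtain ⟨S, hS, hvS, hsep⟩ := hN l' hl' v (by
    intro h; rcases h2 v h with h | h
    · exact hv h
    · exact hvR h)
  by_cases hSR : ∀ x ∈ S, ¬ R x
  · refine ⟨S, hS, hvS, fun x hx hxS hreach => hsep x (h1 x hx) hxS ?_⟩
    clear hx hxS
    induction hreach with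
    | refl => exact .refl
    | @tail a b _ hab ih =>
      obtain ⟨⟨ha, hb, h | ⟨rfl, _, z, hz, haz, hzb⟩⟩, hbS⟩ := hab
      · exact ih.tail ⟨h, hbS⟩
      · refine (ih.tail ⟨haz, fun h => hSR z h hz⟩).trans (rtg_mono hzb ?_)
        rintro x y ⟨hx, hxy⟩
        refine ⟨hxy, ?_⟩
        rcases hRs x y hx hxy with h | rfl
        · exact fun hy => hSR y hy h
        · exact hbS
  push Not at hSR
  obtain ⟨q, hqS, hqR⟩ := hSR
  let S2 := S.filter (fun x => ¬ R x)
  have hS2 : S2.card ≤ 1 := by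
    have : S2 ⊆ S.erase q := by
      intro x hx
      simp only [S2, Finset.mem_filter] at hx
      rw [Finset.mem_erase]
      exact ⟨by rintro rfl; exact hx.2 hqR, hx.1⟩
    have := Finset.card_le_card this
    rw [Finset.card_erase_of_mem hqS] at this
    omega
  have hnR : ∀ S' x, ReflTransGen (Av (Ctr r R s) S') v x → ¬ R x := by
    intro S' x h
    exact rtg_inv (P := fun x => ¬ R x) h hvR (fun a b _ hab => hab.1.2.1)
  by_cases hvs : v = s
  · refine ⟨S2, by omega, fun h => hvS (Finset.mem_filter.1 h).1, fun x hx hxS hreach => hsep x (h1 x hx) ?_ ?_⟩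
    · intro h; exact hxS (Finset.mem_filter.2 ⟨h, hnR _ _ hreach⟩)
    clear hx hxS
    induction hreach with
    | refl => exact .refl
    | @tail a b _ hab ih =>
      by_cases hbs : b = s
      · rw [hbs, hvs]
      · obtain ⟨⟨ha, hb, h | h⟩, hbS⟩ := hab
        · exact ih.tail ⟨h, fun h' => hbS (Finset.mem_filter.2 ⟨h', hb⟩)⟩
        · exact absurd h.1 hbs
  · refine ⟨insert s S2, (Finset.card_insert_le _ _).trans (by omega), ?_, fun x hx hxS hreach => hsep x (h1 x hx) ?_ ?_⟩
    · rw [Finset.mem_insert]; push Not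
      exact ⟨hvs, fun h => hvS (Finset.mem_filter.1 h).1⟩
    · intro h; exact hxS (Finset.mem_insert_of_mem (Finset.mem_filter.2 ⟨h, hnR _ _ hreach⟩))
    clear hx hxS
    induction hreach with
    | refl => exact .refl
    | @tail a b _ hab ih =>
      obtain ⟨⟨ha, hb, h | h⟩, hbS⟩ := hab
      · exact ih.tail ⟨h, fun h' => hbS (Finset.mem_insert_of_mem (Finset.mem_filter.2 ⟨h', hb⟩))⟩
      · exact absurd (by rw [h.1]; exact Finset.mem_insert_self _ _) hbS

theorem sep1 {V : Type} {r : V → V → Prop} (ih : IHV V) (hl : ∀ x, ¬ r x x) (hN : NoFan r)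
    (R : V → Prop) (s w v0 : V) (hv0 : R v0) (hs : ¬ R s)
    (hRs : ∀ x y, R x → r x y → R y ∨ y = s) (hw : ¬ R w) (hws : w ≠ s) : Col3 r := by
  classical
  obtain ⟨cB, hB⟩ := ih (Ctr r R s) v0 (by
      rintro x y ⟨h1, h2, _⟩
      exact ⟨by rintro rfl; exact h1 hv0, by rintro rfl; exact h2 hv0⟩) (by
      rintro x ⟨h1, h2, h | h⟩
      · exact hl _ h
      · exact h.2.1 h.1) (ctr_noFan hN hs hRs)
  let A := del r (fun x => ¬ (R x ∨ x = s))
  obtain ⟨cA, hA⟩ := ih A w (by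
      rintro x y ⟨_, h1, h2⟩
      simp only [not_not] at h1 h2
      refine ⟨?_, ?_⟩
      · rintro rfl; tauto
      · rintro rfl; tauto) (fun x h => hl _ h.1) (hN.mono (fun x y h => h.1))
  let π := Equiv.swap (cA s) (cB s)
  let c : V → Fin 3 := fun x => if R x then π (cA x) else cB x
  have hcR : ∀ x, R x → c x = π (cA x) := fun x hx => by simp [c, hx]
  have hcB : ∀ x, ¬ R x → c x = cB x := fun x hx => by simp [c, hx]
  have hcs : c s = π (cA s) := by rw [hcB s hs]; simp [π]
  have hAarc : ∀ x y, (R x ∨ x = s) → (R y ∨ y = s) → r x y → A x y := by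
    intro x y hx hy hxy
    exact ⟨hxy, not_not.2 hx, not_not.2 hy⟩
  refine ⟨c, good_of_set (fun x => x = s) (good_cut R ?_ ?_ ?_) ?_⟩
  · rintro x y hx ⟨hxy, _, hy⟩
    exact (hRs x y hx hxy).resolve_right hy
  · refine hB.mono ?_
    rintro x y ⟨⟨hxy, _, _⟩, hx, hy⟩ hc
    rw [hcB x hx, hcB y hy] at hc
    exact ⟨⟨hx, hy, .inl hxy⟩, hc⟩
  · refine hA.mono ?_
    rintro x y ⟨⟨hxy, _, _⟩, hx, hy⟩ hc
    simp only [not_not] at hx hy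
    rw [hcR x hx, hcR y hy] at hc
    exact ⟨hAarc x y (.inl hx) (.inl hy) hxy, π.injective hc⟩
  · rintro x rfl hxx
    have key : ∀ y, ReflTransGen (Mn r c) y x → c y = c x ∧ (¬ R y → ReflTransGen (Mn (Ctr r R x) cB) y x) ∧
        (R y → ReflTransGen (Mn A cA) y x ∧ ReflTransGen (fun a b => R a ∧ r a b) y x) := by
      intro y hy
      induction hy using ReflTransGen.head_induction_on with
      | refl => exact ⟨rfl, fun _ => .refl, fun h => absurd h hs⟩
      | @head a b hab _ ih =>
        obtain ⟨ih0, ih1, ih2⟩ := ih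
        have hca : c a = c x := hab.2.trans ih0
        refine ⟨hca, ?_, ?_⟩
        · intro ha
          by_cases hax : a = x
          · rw [hax]
          by_cases hb : R b
          · refine .single ⟨⟨ha, hs, .inr ⟨rfl, hax, b, hb, hab.1, (ih2 hb).2⟩⟩, ?_⟩
            rw [← hcB a ha, ← hcB x hs]; exact hca
          · refine .head ⟨⟨ha, hb, .inl hab.1⟩, ?_⟩ (ih1 hb)
            rw [← hcB a ha, ← hcB b hb]; exact hab.2
        · intro ha
          rcases hRs a b ha hab.1 with hb | rfl
          · refine ⟨.head ⟨hAarc a b (.inl ha) (.inl hb) hab.1, ?_⟩ (ih2 hb).1, .head ⟨ha, hab.1⟩ (ih2 hb).2⟩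
            have := hab.2
            rw [hcR a ha, hcR b hb] at this
            exact π.injective this
          · refine ⟨.single ⟨hAarc a b (.inl ha) (.inr rfl) hab.1, ?_⟩, .single ⟨ha, hab.1⟩⟩
            have := hab.2
            rw [hcR a ha, hcs] at this
            exact π.injective this
    obtain ⟨y, hxy, hyx⟩ := TransGen.head'_iff.1 hxx
    obtain ⟨h0, h1, h2⟩ := key y hyx
    by_cases hy : R y
    · refine hA x (TransGen.head'_iff.2 ⟨y, ⟨hAarc x y (.inr rfl) (.inl hy) hxy.1, ?_⟩, (h2 hy).1⟩)
      have := hxy.2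
      rw [hcR y hy, hcs] at this
      exact π.injective this
    · refine hB x (TransGen.head'_iff.2 ⟨y, ⟨⟨hs, hy, .inl hxy.1⟩, ?_⟩, h1 hy⟩)
      rw [← hcB x hs, ← hcB y hy]; exact hxy.2

end W4proof

namespace W4proof

open Relation

/-- Reverse relation. -/
abbrev fl {V : Type} (r : V → V → Prop) : V → V → Prop := fun x y => r y x

open Classical in
/-- Out-neighbourhood of a set. -/
noncomputable def outN {V : Type} [Fintype V] (r : V → V → Prop) (X : Finset V) : Finset V :=
  Finset.univ.filter (fun y => y ∉ X ∧ ∃ x ∈ X, r x y)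

theorem mem_outN {V : Type} [Fintype V] {r : V → V → Prop} {X : Finset V} {y : V} :
    y ∈ outN r X ↔ y ∉ X ∧ ∃ x ∈ X, r x y := by
  simp [outN]

/-- Standing assumptions on a minimal counterexample. -/
structure Ctx {V : Type} [Fintype V] (r : V → V → Prop) : Prop where
  hl : ∀ x, ¬ r x x
  hdo : ∀ x u w, ∃ y, r x y ∧ y ≠ u ∧ y ≠ w
  hdi : ∀ x u w, ∃ y, r y x ∧ y ≠ u ∧ y ≠ w
  sep : ∀ R : Finset V, R.Nonempty → (outN r R).card ≤ 1 → ∀ x, x ∈ R ∨ x ∈ outN r R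

theorem ctx_of {V : Type} [Fintype V] {r : V → V → Prop} (ih : IHV V) (hl : ∀ x, ¬ r x x)
    (hN : NoFan r) (hC : ¬ Col3 r) : Ctx r := by
  classical
  have hdi : ∀ x u w, ∃ y, r y x ∧ y ≠ u ∧ y ≠ w := by
    intro x u w
    by_contra h; push Not at h
    exact hC (lowdeg_in ih hl hN x u w (fun y hy => by
      by_cases hyu : y = u
      · exact .inl hyu
      · exact .inr (h y hy hyu)))
  refine ⟨hl, ?_, hdi, ?_⟩
  · intro x u w
    by_contra h; push Not at h
    exact hC (lowdeg_out ih hl hN x u w (fun y hy => by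
      by_cases hyu : y = u
      · exact .inl hyu
      · exact .inr (h y hy hyu)))
  · intro R hR hc w
    by_contra hw; push Not at hw
    obtain ⟨v0, hv0⟩ := hR
    apply hC
    have : ∃ s, s ∉ R ∧ w ≠ s ∧ ∀ y ∈ outN r R, y = s := by
      by_cases he : (outN r R) = ∅
      · obtain ⟨y, hy, _⟩ := hdi w w w
        refine ⟨y, ?_, ?_, by simp [he]⟩
        · intro hyR; exact hw.2 (mem_outN.2 ⟨hw.1, y, hyR, hy⟩)
        · rintro rfl; exact hl _ hy
      · obtain ⟨s, hs⟩ := Finset.nonempty_iff_ne_empty.2 he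
        refine ⟨s, (mem_outN.1 hs).1, ?_, ?_⟩
        · rintro rfl; exact hw.2 hs
        · intro y hy; exact Finset.card_le_one.1 hc y hy s hs
    obtain ⟨s, hs, hws, hout⟩ := this
    refine sep1 ih hl hN (fun x => x ∈ R) s w v0 hv0 hs ?_ hw.1 hws
    intro x y hx hxy
    by_cases hy : y ∈ R
    · exact .inl hy
    · exact .inr (hout y (mem_outN.2 ⟨hy, x, hx, hxy⟩))

open Classical in
/-- The other side of a separation. -/
noncomputable def co {V : Type} [Fintype V] (X S : Finset V) : Finset V := Finset.univ \ (X ∪ S)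

theorem mem_co {V : Type} [Fintype V] {X S : Finset V} {y : V} : y ∈ co X S ↔ y ∉ X ∧ y ∉ S := by
  simp [co]

theorem outN_co {V : Type} [Fintype V] {r : V → V → Prop} {X S : Finset V}
    (h : outN r X ⊆ S) : outN (fl r) (co X S) ⊆ S := by
  intro y hy
  obtain ⟨h1, x, hx, hxy⟩ := mem_outN.1 hy
  rw [mem_co] at h1 hx
  by_contra hyS
  have hyX : y ∈ X := by tauto
  exact hx.2 (h (mem_outN.2 ⟨hx.1, y, hyX, hxy⟩))

theorem Ctx.flip {V : Type} [Fintype V] {r : V → V → Prop} (h : Ctx r) : Ctx (fl r) := by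
  refine ⟨h.hl, h.hdi, h.hdo, ?_⟩
  intro Q hQ hc w
  by_contra hw; push Not at hw
  obtain ⟨q, hq⟩ := hQ
  have h1 := outN_co (r := fl r) (X := Q) (S := outN (fl r) Q) (fun _ h => h)
  rcases h.sep (co Q (outN (fl r) Q)) ⟨w, mem_co.2 hw⟩ ((Finset.card_le_card h1).trans hc) q with h2 | h2
  · exact (mem_co.1 h2).1 hq
  · exact (mem_outN.1 (h1 h2)).1 hq

/-- Fragments. -/
def Frag {V : Type} [Fintype V] (r : V → V → Prop) (R : Finset V) : Prop :=
  R.Nonempty ∧ (outN r R).card ≤ 2 ∧ ∃ w, w ∉ R ∧ w ∉ outN r R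

/-- Atoms. -/
structure Atom {V : Type} [Fintype V] (r : V → V → Prop) (R : Finset V) : Prop where
  fr : Frag r R
  mo : ∀ X, Frag r X → R.card ≤ X.card
  mi : ∀ X, Frag (fl r) X → R.card ≤ X.card

theorem Frag.co {V : Type} [Fintype V] {r : V → V → Prop} {R : Finset V} (h : Frag r R) :
    Frag (fl r) (co R (outN r R)) := by
  obtain ⟨⟨v, hv⟩, h2, w, hw⟩ := h
  have h1 := outN_co (r := r) (X := R) (S := outN r R) (fun _ h => h)
  refine ⟨⟨w, mem_co.2 hw⟩, (Finset.card_le_card h1).trans h2, v, ?_, ?_⟩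
  · intro h; exact (mem_co.1 h).1 hv
  · intro h; exact (mem_outN.1 (h1 h)).1 hv

open Classical in
/-- Reachable set avoiding `S`. -/
noncomputable def Rs {V : Type} [Fintype V] (r : V → V → Prop) (S : Finset V) (v : V) : Finset V :=
  Finset.univ.filter (fun x => ReflTransGen (Av r S) v x)

theorem mem_Rs {V : Type} [Fintype V] {r : V → V → Prop} {S : Finset V} {v x : V} :
    x ∈ Rs r S v ↔ ReflTransGen (Av r S) v x := by simp [Rs]

theorem outN_Rs {V : Type} [Fintype V] {r : V → V → Prop} {S : Finset V} {v : V} :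
    outN r (Rs r S v) ⊆ S := by
  intro y hy
  obtain ⟨h1, x, hx, hxy⟩ := mem_outN.1 hy
  by_contra hyS
  rw [mem_Rs] at h1 hx
  exact h1 (hx.tail ⟨hxy, hyS⟩)

theorem Rs_notMem {V : Type} [Fintype V] {r : V → V → Prop} {S : Finset V} {v x : V} (hv : v ∉ S)
    (hx : x ∈ Rs r S v) : x ∉ S :=
  rtg_inv (P := fun x => x ∉ S) (mem_Rs.1 hx) hv (fun _ _ _ h => h.2)

theorem frag_Rs {V : Type} [Fintype V] {r : V → V → Prop} {S : Finset V} {v z : V}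
    (hS : S.card ≤ 2) (hz : z ∉ S) (h : ¬ ReflTransGen (Av r S) v z) :
    Frag r (Rs r S v) := by
  refine ⟨⟨v, mem_Rs.2 .refl⟩, (Finset.card_le_card outN_Rs).trans hS, z, ?_, ?_⟩
  · rw [mem_Rs]; exact h
  · intro h'; exact hz (outN_Rs h')

theorem frag_coRs {V : Type} [Fintype V] {r : V → V → Prop} {S : Finset V} {v z : V}
    (hS : S.card ≤ 2) (hv : v ∉ S) (hz : z ∉ S) (h : ¬ ReflTransGen (Av r S) v z) :
    Frag (fl r) (co (Rs r S v) S) := by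
  have h1 := outN_co (outN_Rs (r := r) (S := S) (v := v))
  refine ⟨⟨z, mem_co.2 ⟨by rw [mem_Rs]; exact h, hz⟩⟩, (Finset.card_le_card h1).trans hS, v, ?_, ?_⟩
  · intro h'; exact (mem_co.1 h').1 (mem_Rs.2 .refl)
  · intro h'; exact hv (h1 h')

theorem no_arc_Rs {V : Type} [Fintype V] {r : V → V → Prop} {S : Finset V} {v x y : V}
    (hx : x ∈ Rs r S v) (hy : y ∈ co (Rs r S v) S) : ¬ r x y := by
  intro hxy
  rw [mem_co] at hy
  exact hy.2 (outN_Rs (mem_outN.2 ⟨hy.1, x, hx, hxy⟩))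

theorem submod {V : Type} [Fintype V] [DecidableEq V] (r : V → V → Prop) (A B : Finset V) :
    (outN r (A ∩ B)).card + (outN r (A ∪ B)).card ≤ (outN r A).card + (outN r B).card := by
  rw [← Finset.card_union_add_card_inter, ← Finset.card_union_add_card_inter (outN r A)]
  apply Nat.add_le_add <;> apply Finset.card_le_card
  · intro y hy
    simp only [Finset.mem_union, Finset.mem_inter, mem_outN] at hy ⊢
    rcases hy with ⟨h1, x, hx, hxy⟩ | ⟨h1, x, hx, hxy⟩
    · by_cases hyA : y ∈ A
      · exact .inr ⟨fun h => h1 ⟨hyA, h⟩, x, hx.2, hxy⟩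
      · exact .inl ⟨hyA, x, hx.1, hxy⟩
    · rcases hx with hx | hx
      · exact .inl ⟨fun h => h1 (.inl h), x, hx, hxy⟩
      · exact .inr ⟨fun h => h1 (.inr h), x, hx, hxy⟩
  · intro y hy
    simp only [Finset.mem_union, Finset.mem_inter, mem_outN] at hy ⊢
    obtain ⟨⟨_, x, hx, hxy⟩, h1, _⟩ := hy
    exact ⟨⟨fun h => h1 (.inl h), x, hx.1, hxy⟩, ⟨fun h => h1 (.inr h), x, hx.2, hxy⟩⟩

theorem pair_of_card {V : Type} (S : Finset V) (h : S.card ≤ 2) (v : V) :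
    ∃ u w, ∀ y ∈ S, y = u ∨ y = w := by
  classical
  rcases S.eq_empty_or_nonempty with rfl | ⟨u, hu⟩
  · exact ⟨v, v, by simp⟩
  rcases (S.erase u).eq_empty_or_nonempty with h1 | ⟨w, hw⟩
  · refine ⟨u, u, fun y hy => .inl ?_⟩
    by_contra hne
    have : y ∈ S.erase u := Finset.mem_erase.2 ⟨hne, hy⟩
    simp [h1] at this
  · refine ⟨u, w, fun y hy => ?_⟩
    by_contra hne; push Not at hne
    have h2 : (S.erase u).card ≤ 1 := by rw [Finset.card_erase_of_mem hu]; omega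
    exact hne.2 (Finset.card_le_one.1 h2 y (Finset.mem_erase.2 ⟨hne.1, hy⟩) w hw)

theorem common {V : Type} [Fintype V] {r : V → V → Prop} (hC : Ctx r) {R X Y : Finset V}
    (hR : Atom r R) (hX : Frag r X) (hY : Frag (fl r) Y) (hd : ∀ x ∈ X, x ∉ Y)
    (hXY : ∀ x ∈ X, ∀ y ∈ Y, ¬ r x y) {v : V} (hv : v ∈ R) (hvX : v ∈ X) : R ⊆ X := by
  classical
  by_contra hRX
  obtain ⟨y0, hy0⟩ := hY.1
  have h3 : 3 ≤ (outN r (R ∩ X)).card := by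
    by_contra h
    have hF : Frag r (R ∩ X) := by
      refine ⟨⟨v, Finset.mem_inter.2 ⟨hv, hvX⟩⟩, by omega, y0, ?_, ?_⟩
      · intro h; exact hd y0 (Finset.mem_inter.1 h).2 hy0
      · intro h
        obtain ⟨_, x, hx, hxy⟩ := mem_outN.1 h
        exact hXY x (Finset.mem_inter.1 hx).2 y0 hy0 hxy
    have h1 := hR.mo _ hF
    have h2 : R ∩ X = R := Finset.eq_of_subset_of_card_le Finset.inter_subset_left h1
    exact hRX (h2 ▸ Finset.inter_subset_right)
  have h1 : (outN r (R ∪ X)).card ≤ 1 := by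
    have := submod r R X
    have h4 := hR.fr.2.1
    have h5 := hX.2.1
    omega
  have hall := hC.sep (R ∪ X) ⟨v, by simp [hv]⟩ h1
  have hYc := hR.mi Y hY
  have hsub : ∀ u ∈ R, u ≠ v → u ∈ Y := by
    intro u hu huv
    by_contra huY
    have : Y ⊆ (R.erase v).erase u ∪ outN r (R ∪ X) := by
      intro y hy
      have hyX : y ∉ X := fun h => hd y h hy
      rcases hall y with h | h
      · have hyR : y ∈ R := by
          rw [Finset.mem_union] at h; tauto
        rw [Finset.mem_union, Finset.mem_erase, Finset.mem_erase]
        refine .inl ⟨?_, ?_, hyR⟩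
        · rintro rfl; exact huY hy
        · rintro rfl; exact hyX hvX
      · exact Finset.mem_union_right _ h
    have h6 := (Finset.card_le_card this).trans (Finset.card_union_le _ _)
    rw [Finset.card_erase_of_mem (Finset.mem_erase.2 ⟨huv, hu⟩), Finset.card_erase_of_mem hv] at h6
    have h7 : 2 ≤ R.card := by
      have : ({u, v} : Finset V) ⊆ R := by
        intro x hx; simp at hx; rcases hx with rfl | rfl <;> assumption
      have := Finset.card_le_card this
      rwa [Finset.card_pair huv] at this
    omega
  obtain ⟨u, w, huw⟩ := pair_of_card (outN r R) hR.fr.2.1 v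
  obtain ⟨y, hvy, hyu, hyw⟩ := hC.hdo v u w
  by_cases hyR : y ∈ R
  · have hyv : y ≠ v := by rintro rfl; exact hC.hl _ hvy
    exact hXY v hvX y (hsub y hyR hyv) hvy
  · rcases huw y (mem_outN.2 ⟨hyR, v, hv, hvy⟩) with h | h
    · exact hyu h
    · exact hyw h

theorem exists_longest {V : Type} [Fintype V] {P : List V → Prop} (h : ∃ l, P l)
    (nd : ∀ l, P l → l.Nodup) : ∃ l, P l ∧ ∀ l', P l' → l'.length ≤ l.length := by
  classical
  have hb : ∀ l, P l → l.length ≤ Fintype.card V := fun l hl => (nd l hl).length_le_card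
  by_contra hc; push Not at hc
  have : ∀ n, ∃ l, P l ∧ n ≤ l.length := by
    intro n
    induction n with
    | zero => obtain ⟨l, hl⟩ := h; exact ⟨l, hl, by omega⟩
    | succ n ih =>
      obtain ⟨l, hl, hn⟩ := ih
      obtain ⟨l', hl', h'⟩ := hc l hl
      exact ⟨l', hl', by omega⟩
  obtain ⟨l, hl, hn⟩ := this (Fintype.card V + 1)
  have := hb l hl
  omega

theorem Pth.back {V : Type} {r : V → V → Prop} {a b y : V} {p : List V} (h : Pth r a p b)
    (hl : ∀ x, ¬ r x x) (hy : y ∈ p) (hby : r b y) :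
    ∃ j, p[j]? = some y ∧ (j + 2 = p.length ∨ (j + 3 ≤ p.length ∧ Cyc r (p.drop j))) := by
  rw [List.mem_iff_getElem?] at hy
  obtain ⟨j, hj⟩ := hy
  have hlt := Pth.of_lt hj
  have hne : j + 1 ≠ p.length := by
    intro he
    have h1 := h.get_last
    rw [show p.length - 1 = j by omega, hj] at h1
    simp at h1; subst h1; exact hl _ hby
  refine ⟨j, hj, ?_⟩
  by_cases h2 : j + 2 = p.length
  · exact .inl h2
  · exact .inr ⟨by omega, (h.drop hj).cyc hby (by rw [List.length_drop]; omega)⟩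

theorem Pth.drop_idx {V : Type} {r : V → V → Prop} {a b y : V} {p : List V} (h : Pth r a p b)
    {i j : ℕ} (hi : p[i]? = some y) (hm : y ∈ p.drop j) : j ≤ i := by
  rw [List.mem_iff_getElem?] at hm
  obtain ⟨k, hk⟩ := hm
  rw [List.getElem?_drop] at hk
  have := h.inj hi hk
  omega

theorem Pth.take_idx {V : Type} {r : V → V → Prop} {a b y : V} {p : List V} (h : Pth r a p b)
    {i j : ℕ} (hi : p[i]? = some y) (hm : y ∈ p.take j) : i < j := by
  rw [List.mem_iff_getElem?] at hm
  obtain ⟨k, hk⟩ := hm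
  rw [List.getElem?_take] at hk
  split_ifs at hk with hkj
  have := h.inj hi hk
  omega

theorem Pth.snoc {V : Type} {r : V → V → Prop} {a b c : V} {l : List V} (h : Pth r a l b)
    (hbc : r b c) (hc : c ∉ l) : Pth r a (l ++ [c]) c :=
  h.append (Pth.single r c) hbc (by rintro x hx; simp; rintro rfl; exact hc hx)

/-- A cycle has a vertex outside any set of at most two elements. -/
theorem Cyc.outside {V : Type} {r : V → V → Prop} {l : List V} (h : Cyc r l) {S : Finset V}
    (hS : S.card ≤ 2) : ∃ x ∈ l, x ∉ S := by
  classical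
  by_contra hc; push Not at hc
  have : l.toFinset ⊆ S := by intro x hx; exact hc x (by simpa using hx)
  have := Finset.card_le_card this
  rw [List.toFinset_card_of_nodup h.1] at this
  have := h.2.1
  omega

theorem exists_frag {V : Type} [Fintype V] [Nonempty V] {r : V → V → Prop} (hC : Ctx r) (hN : NoFan r) :
    ∃ R, Frag r R := by
  classical
  by_contra hno; push Not at hno
  have hspan : ∀ l, Cyc r l → ∀ v, v ∈ l := by
    intro l hl v
    by_contra hv
    obtain ⟨S, hS, hvS, hsep⟩ := hN l hl v hv
    obtain ⟨x, hx, hxS⟩ := hl.outside hS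
    exact hno _ (frag_Rs hS hxS (hsep x hx hxS))
  obtain ⟨x0⟩ := ‹Nonempty V›
  obtain ⟨p, ⟨a, b, hp⟩, hmax⟩ := exists_longest (P := fun l => ∃ a b, Pth r a l b) ⟨[x0], x0, x0, Pth.single r x0⟩
    (fun l ⟨a, b, h⟩ => h.nd)
  have hmem : ∀ y, r b y → y ∈ p := by
    intro y hy
    by_contra hyp
    have := hmax _ ⟨a, y, hp.snoc hy hyp⟩
    simp at this
  have key : ∀ y, r b y → y ≠ (p[p.length - 2]?).getD b → p[0]? = some y := by
    intro y hy hne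
    obtain ⟨j, hj, h | ⟨h1, h2⟩⟩ := hp.back hC.hl (hmem y hy) hy
    · rw [show p.length - 2 = j by omega, hj] at hne; simp at hne
    · have := hp.drop_idx hp.get_zero (hspan _ h2 a)
      rw [show j = 0 by omega] at hj; exact hj
  obtain ⟨y1, h1, h1', _⟩ := hC.hdo b ((p[p.length - 2]?).getD b) b
  obtain ⟨y2, h2, h2', h2''⟩ := hC.hdo b ((p[p.length - 2]?).getD b) y1
  have e1 := key y1 h1 h1'
  have e2 := key y2 h2 h2'
  rw [e1] at e2; simp at e2; exact h2'' e2.symm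

/-- There is an atom, either for `r` or its reverse. -/
theorem exists_atom {V : Type} [Fintype V] [Nonempty V] {r : V → V → Prop} (hC : Ctx r) (hN : NoFan r) :
    (∃ R, Atom r R) ∨ ∃ R, Atom (fl r) R := by
  classical
  obtain ⟨R0, hR0⟩ := exists_frag hC hN
  obtain ⟨R, hR, hmin⟩ := Finset.exists_min_image
    (Finset.univ.filter (fun R : Finset V => Frag r R ∨ Frag (fl r) R)) Finset.card
    ⟨R0, by simp [hR0]⟩
  simp only [Finset.mem_filter, Finset.mem_univ, true_and] at hR hmin
  rcases hR with hR | hR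
  · exact .inl ⟨R, hR, fun X hX => hmin X (.inl hX), fun X hX => hmin X (.inr hX)⟩
  · exact .inr ⟨R, hR, fun X hX => hmin X (.inr hX), fun X hX => hmin X (.inl hX)⟩

/-- Removing a single vertex leaves a strong digraph. -/
theorem Ctx.strong {V : Type} [Fintype V] {r : V → V → Prop} (hC : Ctx r) {t x y : V} (hx : x ≠ t)
    (hy : y ≠ t) : ReflTransGen (Av r {t}) x y := by
  have h1 := (Finset.card_le_card (outN_Rs (r := r) (S := {t}) (v := x)))
  rcases hC.sep (Rs r {t} x) ⟨x, mem_Rs.2 .refl⟩ (by simpa using h1) y with h | h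
  · exact mem_Rs.1 h
  · have := outN_Rs h; simp at this; exact absurd this hy

end W4proof

namespace W4proof

open Relation

theorem atom_out {V : Type} [Fintype V] {r : V → V → Prop} (hC : Ctx r) {R : Finset V}
    (hR : Atom r R) : ∃ s t, s ≠ t ∧ ∀ x, x ∈ outN r R ↔ x = s ∨ x = t := by
  classical
  have h2 : (outN r R).card = 2 := by
    by_contra h
    obtain ⟨h1, h2, w, hw1, hw2⟩ := hR.fr
    rcases hC.sep R h1 (by omega) w with h | h
    · exact hw1 h
    · exact hw2 h
  obtain ⟨s, t, hst, he⟩ := Finset.card_eq_two.1 h2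
  exact ⟨s, t, hst, fun x => by rw [he]; simp⟩

theorem F1 {V : Type} [Fintype V] {r : V → V → Prop} (hC : Ctx r) (hN : NoFan r) {R : Finset V}
    (hR : Atom r R) {l : List V} (hl : Cyc r l) {x : V} (hx : x ∈ l) (hxR : x ∈ R) :
    ∀ v ∈ R, v ∈ l := by
  intro v hv
  by_contra hvl
  obtain ⟨S, hS, hvS, hsep⟩ := hN l hl v hvl
  obtain ⟨z, hz, hzS⟩ := hl.outside hS
  have hnz := hsep z hz hzS
  have hsub := common hC hR (frag_Rs hS hzS hnz) (frag_coRs hS hvS hzS hnz)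
    (fun x hx hx' => (mem_co.1 hx').1 hx) (fun x hx y hy => no_arc_Rs hx hy) hv (mem_Rs.2 .refl)
  have := hsub hxR
  exact hsep x hx (Rs_notMem hvS this) (mem_Rs.1 this)

theorem F3 {V : Type} [Fintype V] {r : V → V → Prop} (hC : Ctx r) (hN : NoFan r) {R : Finset V}
    (hR : Atom r R) {s t : V} (hst : s ≠ t) (hs : s ∉ R) (ht : t ∉ R) :
    ∃ a ∈ R, ∀ p z, Pth r a p z → (∀ x ∈ p, x ∈ R) → r z s → 2 ≤ p.length → ∀ v ∈ R, v ∈ p := by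
  obtain ⟨q, hq⟩ := hR.fr.1
  have hqt : q ≠ t := by rintro rfl; exact ht hq
  obtain ⟨a, b, ha, hb, hba, hsb⟩ := first_entry (A := fun x => x ∈ R) (hC.strong hst hqt) hs hq
  obtain ⟨W, hW⟩ := Pth.exists hsb
  have hWR : ∀ x ∈ W, x ∉ R := hW.all (P := fun x => x ∉ R) hs (fun x y h => h.2.2)
  refine ⟨a, ha, ?_⟩
  intro p z hp hpR hzs hlen v hv
  have hW' : Pth r s W b := hW.mono (fun x y h => h.1.1)
  have hc := (hp.append hW' hzs (fun x hx hx' => hWR x hx' (hpR x hx))).cyc hba.1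
    (by rw [List.length_append]; have := hW.pos; omega)
  have := F1 hC hN hR hc (List.mem_append_left _ hp.head_mem) ha v hv
  rcases List.mem_append.1 this with h | h
  · exact h
  · exact absurd hv (hWR v h)

set_option maxHeartbeats 4000000 in
theorem pos_struct {V : Type} [Fintype V] {r : V → V → Prop} (hC : Ctx r) {R : Finset V}
    {s t : V} (hs : s ∉ R) (ht : t ∉ R) (hout : ∀ x y, x ∈ R → r x y → y ∈ R ∨ y = s ∨ y = t)
    (hF1 : ∀ l, Cyc r l → ∀ x ∈ l, x ∈ R → ∀ v ∈ R, v ∈ l) {a b : V} (ha : a ∈ R) (hb : b ∈ R)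
    (hF3 : ∀ p z, Pth r a p z → (∀ x ∈ p, x ∈ R) → r z s → 2 ≤ p.length → ∀ v ∈ R, v ∈ p)
    (hF3t : ∀ p z, Pth r b p z → (∀ x ∈ p, x ∈ R) → r z t → 2 ≤ p.length → ∀ v ∈ R, v ∈ p) :
    ∃ q q', q ≠ q' ∧ (∀ x, x ∈ R ↔ x = q ∨ x = q') ∧ r q s ∧ r q t ∧ r q q' ∧ r q' s ∧ r q' t ∧ r q' q := by
  classical
  obtain ⟨p, ⟨z, hp, hpR⟩, hmax⟩ := exists_longest
    (P := fun l => ∃ z, Pth r a l z ∧ ∀ x ∈ l, x ∈ R) ⟨[a], a, Pth.single r a, by simpa using ha⟩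
    (fun l ⟨z, h, _⟩ => h.nd)
  have hzR : z ∈ R := hpR z hp.last_mem
  have hzp : ∀ y ∈ R, r z y → y ∈ p := by
    intro y hy hzy
    by_contra hyp
    have := hmax _ ⟨y, hp.snoc hzy hyp, by
      intro x hx; rw [List.mem_append] at hx
      rcases hx with hx | hx
      · exact hpR x hx
      · simp at hx; exact hx ▸ hy⟩
    simp at this
  have hm2 : 2 ≤ p.length := by
    obtain ⟨y, hy, hys, hyt⟩ := hC.hdo a s t
    have hyR : y ∈ R := by rcases hout a y ha hy with h | h | h <;> tauto
    have hya : a ≠ y := by rintro rfl; exact hC.hl _ hy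
    have := hmax [a, y] ⟨y, by simpa using (Pth.single r a).snoc hy (by simpa using hya.symm), by
      simp [ha, hyR]⟩
    simpa using this
  have hback : ∀ j y, p[j]? = some y → r z y → j + 3 ≤ p.length → (∀ v ∈ R, v ∈ p) ∧ y = a := by
    intro j y hj hzy hjl
    have hdr := hp.drop hj
    have hc := hdr.cyc hzy (by rw [List.length_drop]; omega)
    have hall := hF1 _ hc y hdr.head_mem (hpR y (List.mem_of_getElem? hj))
    refine ⟨fun v hv => List.mem_of_mem_drop (hall v hv), ?_⟩
    have := hp.drop_idx hp.get_zero (hall a ha)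
    rw [show j = 0 by omega, hp.get_zero] at hj
    simpa using hj.symm
  have hnzs : ¬ r z s → (∀ v ∈ R, v ∈ p) ∧ (3 ≤ p.length → r z a) := by
    intro hzs
    obtain ⟨y, hy, hy1, hy2⟩ := hC.hdo z ((p[p.length - 2]?).getD z) t
    have hyR : y ∈ R := by
      rcases hout z y hzR hy with h | h | h
      · exact h
      · exact absurd (h ▸ hy) hzs
      · exact absurd h hy2
    obtain ⟨j, hj, h | ⟨h1, h2⟩⟩ := hp.back hC.hl (hzp y hyR hy) hy
    · rw [show p.length - 2 = j by omega, hj] at hy1; simp at hy1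
    · have := hback j y hj hy h1
      exact ⟨this.1, fun _ => this.2 ▸ hy⟩
  have hspan : ∀ v ∈ R, v ∈ p := by
    by_cases hzs : r z s
    · exact hF3 p z hp hpR hzs hm2
    · exact (hnzs hzs).1
  have hidx : ∀ v ∈ R, ∃ i, p[i]? = some v := fun v hv => List.mem_iff_getElem?.1 (hspan v hv)
  by_cases hn : p.length = 2
  · skip
    have haz : a ≠ z := by
      intro h
      have h1 := hp.get_zero
      have h2 := hp.get_last
      rw [← h] at h2
      have := hp.inj h1 h2
      omega
    have hR2 : ∀ x, x ∈ R ↔ x = a ∨ x = z := by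
      intro x
      constructor
      · intro hx
        obtain ⟨i, hi⟩ := hidx x hx
        have := Pth.of_lt hi
        obtain rfl | rfl : i = 0 ∨ i = 1 := by omega
        · rw [hp.get_zero] at hi; simp at hi; exact .inl hi.symm
        · have h2 := hp.get_last
          rw [hn] at h2; simp at h2
          rw [h2] at hi; simp at hi; exact .inr hi.symm
      · rintro (rfl | rfl) <;> assumption
    have hoa : ∀ y, r a y → y = z ∨ y = s ∨ y = t := by
      intro y hy
      have : y ≠ a := by rintro rfl; exact hC.hl _ hy
      rcases hout a y ha hy with h | h | h
      · rw [hR2] at h; tauto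
      · tauto
      · tauto
    have hoz : ∀ y, r z y → y = a ∨ y = s ∨ y = t := by
      intro y hy
      have : y ≠ z := by rintro rfl; exact hC.hl _ hy
      rcases hout z y hzR hy with h | h | h
      · rw [hR2] at h; tauto
      · tauto
      · tauto
    have get : ∀ x u v w, (∀ y, r x y → y = u ∨ y = v ∨ y = w) → r x w := by
      intro x u v w h
      obtain ⟨y, hy, h1, h2⟩ := hC.hdo x u v
      rcases h y hy with h | h | h
      · exact absurd h h1
      · exact absurd h h2
      · exact h ▸ hy
    refine ⟨a, z, haz, hR2, ?_, ?_, ?_, ?_, ?_, ?_⟩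
    · exact get a z t s (fun y hy => by have := hoa y hy; tauto)
    · exact get a z s t (fun y hy => by have := hoa y hy; tauto)
    · exact get a s t z (fun y hy => by have := hoa y hy; tauto)
    · exact get z a t s (fun y hy => by have := hoz y hy; tauto)
    · exact get z a s t (fun y hy => by have := hoz y hy; tauto)
    · exact get z s t a (fun y hy => by have := hoz y hy; tauto)
  exfalso
  have hn3 : 3 ≤ p.length := by omega
  have small : ∀ u v : V, ¬ ∀ x ∈ R, x ∈ [u, v] := by
    intro u v h
    have h1 : p.toFinset ⊆ [u, v].toFinset := by
      intro x hx
      rw [List.mem_toFinset] at hx ⊢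
      exact h x (hpR x hx)
    have h2 := Finset.card_le_card h1
    rw [List.toFinset_card_of_nodup hp.nd] at h2
    have h3 := List.toFinset_card_le [u, v]
    simp only [List.length_cons, List.length_nil] at h3
    omega
  have pair : ∀ x y, x ≠ y → r x y → Pth r x [x, y] y := by
    intro x y hne hxy
    simpa using (Pth.single r x).snoc hxy (by simpa using hne.symm)
  have hE : ∀ y ∈ R, r b y → ¬ r y t := by
    intro y hy hby hyt
    have hne : b ≠ y := by rintro rfl; exact hC.hl _ hby
    exact small b y (hF3t _ _ (pair b y hne hby) (by simp [hb, hy]) hyt (by simp))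
  have hEs : ∀ y ∈ R, r a y → ¬ r y s := by
    intro y hy hay hys
    have hne : a ≠ y := by rintro rfl; exact hC.hl _ hay
    exact small a y (hF3 _ _ (pair a y hne hay) (by simp [ha, hy]) hys (by simp))
  have hget : ∀ i, i < p.length → ∃ x, p[i]? = some x ∧ x ∈ R := by
    intro i hi
    exact ⟨p[i], by simp, hpR _ (by simp)⟩
  have hA : ∀ i x, 0 < i → i + 1 < p.length → p[i]? = some x → ¬ r x s := by
    intro i x h0 h1 hx hxs
    have hz := hF3 _ _ (hp.take hx) (fun y hy => hpR y (List.mem_of_mem_take hy)) hxs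
      (by rw [List.length_take]; omega) z hzR
    have := hp.take_idx hp.get_last hz
    omega
  have hB : ∀ i x j y, 0 < i → i + 1 < p.length → p[i]? = some x → p[j]? = some y → r x y →
      j = i + 1 ∨ j + 1 = i := by
    intro i x j y h0 h1 hx hy hxy
    have hji : j ≠ i := by
      rintro rfl
      rw [hx] at hy; simp at hy; subst hy; exact hC.hl _ hxy
    by_contra hc; push Not at hc
    have hjl := Pth.of_lt hy
    have hxR := hpR x (List.mem_of_getElem? hx)
    rcases Nat.lt_or_ge (i + 1) j with hj | hj
    · obtain ⟨u, hu, huR⟩ := hget (i + 1) h1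
      have hq : Pth r a (p.take (i + 1) ++ p.drop j) z := by
        refine (hp.take hx).append (hp.drop hy) hxy ?_
        intro w hw hw'
        obtain ⟨k, hk⟩ := List.mem_iff_getElem?.1 (List.mem_of_mem_take hw)
        have := hp.take_idx hk hw
        have := hp.drop_idx hk hw'
        omega
      have hqR : ∀ w ∈ p.take (i + 1) ++ p.drop j, w ∈ R := by
        intro w hw
        rcases List.mem_append.1 hw with h | h
        · exact hpR w (List.mem_of_mem_take h)
        · exact hpR w (List.mem_of_mem_drop h)
      have hlen : 3 ≤ (p.take (i + 1) ++ p.drop j).length := by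
        rw [List.length_append, List.length_take, List.length_drop]; omega
      have huq : u ∈ p.take (i + 1) ++ p.drop j := by
        by_cases hzs : r z s
        · exact hF3 _ _ hq hqR hzs (by omega) u huR
        · exact hF1 _ (hq.cyc ((hnzs hzs).2 hn3) hlen) a hq.head_mem ha u huR
      rcases List.mem_append.1 huq with h | h
      · have := hp.take_idx hu h; omega
      · have := hp.drop_idx hu h; omega
    · have hq := (hp.take hx).drop (i := j) (x := y) (by
        rw [List.getElem?_take]; rw [if_pos (by omega)]; exact hy)
      have hz := hF1 _ (hq.cyc hxy (by rw [List.length_drop, List.length_take]; omega)) x hq.last_mem hxR z hzR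
      have := hp.take_idx hp.get_last (List.mem_of_mem_drop hz)
      omega
  have hCC : ∀ i x u, i + 2 < p.length → p[i + 1]? = some x → p[i]? = some u → r x u ∧ r x t := by
    intro i x u h1 hx hu
    obtain ⟨w, hw, _⟩ := hget (i + 2) h1
    have hxR := hpR x (List.mem_of_getElem? hx)
    have hcl : ∀ y, r x y → y = u ∨ y = w ∨ y = t := by
      intro y hy
      rcases hout x y hxR hy with h | h | h
      · obtain ⟨j, hj⟩ := hidx y h
        rcases hB (i + 1) x j y (by omega) (by omega) hx hj hy with h | h
        · subst h; rw [hw] at hj; simp at hj; tauto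
        · obtain rfl : j = i := by omega
          rw [hu] at hj; simp at hj; tauto
      · subst h; exact absurd hy (hA (i + 1) x (by omega) (by omega) hx)
      · tauto
    constructor
    · obtain ⟨y, hy, h2, h3⟩ := hC.hdo x w t
      rcases hcl y hy with h | h | h
      · exact h ▸ hy
      · exact absurd h h2
      · exact absurd h h3
    · obtain ⟨y, hy, h2, h3⟩ := hC.hdo x u w
      rcases hcl y hy with h | h | h
      · exact absurd h h2
      · exact absurd h h3
      · exact h ▸ hy
  have hint : ∀ i x, 0 < i → i + 1 < p.length → p[i]? = some x → r x t := by
    intro i x h0 h1 hx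
    obtain ⟨k, rfl⟩ : ∃ k, i = k + 1 := ⟨i - 1, by omega⟩
    obtain ⟨u, hu, _⟩ := hget k (by omega)
    exact (hCC k x u (by omega) hx hu).2
  obtain ⟨k, hk⟩ := hidx b hb
  have hkl := Pth.of_lt hk
  have hk2 : ¬ k + 2 < p.length := by
    intro h
    obtain ⟨y, hy, hyR⟩ := hget (k + 1) (by omega)
    exact hE y hyR (hp.step hk hy) (hint (k + 1) y (by omega) (by omega) hy)
  obtain ⟨x1, hx1, hx1R⟩ := hget 1 (by omega)
  rcases (by omega : k + 2 = p.length ∨ k + 1 = p.length) with hk' | hk'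
  · skip
    obtain ⟨i, rfl⟩ : ∃ i, k = i + 1 := ⟨k - 1, by omega⟩
    obtain ⟨u, hu, huR⟩ := hget i (by omega)
    have hbu := (hCC i b u (by omega) hk hu).1
    have hi0 : i = 0 := by
      by_contra h0
      exact hE u huR hbu (hint i u (by omega) (by omega) hu)
    subst hi0
    rw [hp.get_zero] at hu; simp at hu; subst hu
    have hn' : p.length = 3 := by omega
    have hz2 : p[2]? = some z := by have := hp.get_last; rw [hn'] at this; exact this
    have hbz : r b z := hp.step hk hz2
    have hat := hE a ha hbu
    have hzt := hE z hzR hbz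
    have hR3 : ∀ x ∈ R, x = a ∨ x = b ∨ x = z := by
      intro x hx
      obtain ⟨i, hi⟩ := hidx x hx
      have := Pth.of_lt hi
      obtain rfl | rfl | rfl : i = 0 ∨ i = 1 ∨ i = 2 := by omega
      · rw [hp.get_zero] at hi; simp at hi; tauto
      · rw [hk] at hi; simp at hi; tauto
      · rw [hz2] at hi; simp at hi; tauto
    have haz : r a z := by
      obtain ⟨y, hy, h1, h2⟩ := hC.hdo a b s
      have : y ≠ a := by rintro rfl; exact hC.hl _ hy
      rcases hout a y ha hy with h | h | h
      · rcases hR3 y h with h | h | h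
        · exact absurd h this
        · exact absurd h h1
        · exact h ▸ hy
      · exact absurd h h2
      · subst h; exact absurd hy hat
    have hzs : r z s := by
      obtain ⟨y, hy, h1, h2⟩ := hC.hdo z a b
      have : y ≠ z := by rintro rfl; exact hC.hl _ hy
      rcases hout z y hzR hy with h | h | h
      · have := hR3 y h; tauto
      · exact h ▸ hy
      · subst h; exact absurd hy hzt
    exact hEs z hzR haz hzs
  · skip
    have hbz : b = z := by
      have := hp.get_last
      rw [show p.length - 1 = k by omega, hk] at this
      simpa using this
    subst hbz
    have hcl : ∀ y, r b y → y = a ∨ y = s ∨ y = t := by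
      intro y hy
      rcases hout b y hb hy with h | h | h
      · obtain ⟨j, hj⟩ := hidx y h
        have hjl := Pth.of_lt hj
        rcases Nat.eq_zero_or_pos j with h0 | h0
        · subst h0; rw [hp.get_zero] at hj; simp at hj; tauto
        by_cases hj1 : j + 1 = p.length
        · have : j = k := by omega
          subst this; rw [hk] at hj; simp at hj; subst hj; exact absurd hy (hC.hl _)
        · exact absurd (hint j y h0 (by omega) hj) (hE y h hy)
      · tauto
      · tauto
    have hba : r b a := by
      obtain ⟨y, hy, h1, h2⟩ := hC.hdo b s t
      rcases hcl y hy with h | h | h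
      · exact h ▸ hy
      · exact absurd h h1
      · exact absurd h h2
    have hbs : r b s := by
      obtain ⟨y, hy, h1, h2⟩ := hC.hdo b a t
      rcases hcl y hy with h | h | h
      · exact absurd h h1
      · exact h ▸ hy
      · exact absurd h h2
    have hat : r a t := by
      obtain ⟨y, hy, h1, h2⟩ := hC.hdo a x1 s
      rcases hout a y ha hy with h | h | h
      · exfalso
        obtain ⟨j, hj⟩ := hidx y h
        have hjl := Pth.of_lt hj
        have hj0 : j ≠ 0 := by
          rintro rfl; rw [hp.get_zero] at hj; simp at hj; subst hj; exact hC.hl _ hy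
        have hj1 : j ≠ 1 := by
          rintro rfl; rw [hx1] at hj; simp at hj; exact h1 hj.symm
        have hq : Pth r a (a :: p.drop j) b := (hp.drop hj).cons hy (by
          intro hm; have := hp.drop_idx hp.get_zero hm; omega)
        have hm := hF3 _ _ hq (by
          intro w hw
          rcases List.mem_cons.1 hw with rfl | hw
          · exact ha
          · exact hpR w (List.mem_of_mem_drop hw)) hbs (by
            rw [List.length_cons, List.length_drop]; omega) x1 hx1R
        rcases List.mem_cons.1 hm with h | h
        · subst h; have := hp.inj hx1 hp.get_zero; omega
        · have := hp.drop_idx hx1 h; omega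
      · exact absurd h h2
      · exact h ▸ hy
    exact hE a ha hba hat

end W4proof

namespace W4proof

open Relation

theorem two_more (a : Fin 3) : ∃ k1 k2 : Fin 3, k1 ≠ a ∧ k2 ≠ a ∧ k1 ≠ k2 := by
  revert a; decide

open Classical in
/-- Recolouring two vertices. -/
noncomputable def rec2 {V : Type} (c : V → Fin 3) (q q' : V) (k1 k2 : Fin 3) : V → Fin 3 :=
  fun x => if x = q then k1 else if x = q' then k2 else c x

theorem rec2_good {V : Type} {r : V → V → Prop} {c : V → Fin 3} {q q' : V} {k1 k2 : Fin 3}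
    (hc : Good (del r (fun x => x = q ∨ x = q')) c)
    (h1 : ¬ TransGen (Mn r (rec2 c q q' k1 k2)) q q) (h2 : ¬ TransGen (Mn r (rec2 c q q' k1 k2)) q' q') :
    Good r (rec2 c q q' k1 k2) := by
  refine good_of_set (fun x => x = q ∨ x = q') (hc.mono ?_) ?_
  · intro x y hxy hcc
    refine ⟨hxy, ?_⟩
    obtain ⟨_, hx, hy⟩ := hxy
    push Not at hx hy
    simpa [rec2, hx.1, hx.2, hy.1, hy.2] using hcc
  · rintro x (rfl | rfl) <;> assumption

theorem pos_X {V : Type} {r : V → V → Prop} {q q' s t : V} (hqq : q ≠ q')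
    (hsq : s ≠ q ∧ s ≠ q') (htq : t ≠ q ∧ t ≠ q')
    (hq : ∀ y, r q y → y = q' ∨ y = s ∨ y = t) (hq' : ∀ y, r q' y → y = q ∨ y = s ∨ y = t)
    {c : V → Fin 3} (hc : Good (del r (fun x => x = q ∨ x = q')) c) (hst : c s = c t) : Col3 r := by
  obtain ⟨k1, k2, h1, h2, h12⟩ := two_more (c s)
  refine ⟨rec2 c q q' k1 k2, rec2_good hc (no_out ?_) (no_out ?_)⟩
  · rintro y ⟨hy, hcc⟩
    rcases hq y hy with rfl | rfl | rfl
    · simp [rec2, hqq.symm, h12] at hcc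
    · simp [rec2, hsq.1, hsq.2, h1] at hcc
    · simp [rec2, htq.1, htq.2, ← hst, h1] at hcc
  · rintro y ⟨hy, hcc⟩
    rcases hq' y hy with rfl | rfl | rfl
    · simp [rec2, hqq.symm, h12.symm] at hcc
    · simp [rec2, hsq.1, hsq.2, h2, hqq.symm] at hcc
    · simp [rec2, htq.1, htq.2, ← hst, h2, hqq.symm] at hcc

theorem pos_fin2 {V : Type} {r : V → V → Prop} {q q' s t : V} (hqq : q ≠ q')
    (hsq : s ≠ q ∧ s ≠ q') (htq : t ≠ q ∧ t ≠ q')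
    (hq : ∀ y, r q y → y = q' ∨ y = s ∨ y = t) (hq' : ∀ y, r q' y → y = q ∨ y = s ∨ y = t)
    (hF : ∀ l, Cyc r l → q' ∈ l → q ∈ l) (hq's : r q' s)
    (hc : Col3 (del r (fun x => x = q ∨ x = q'))) (hn : ¬ r s q') : Col3 r := by
  obtain ⟨c, hc⟩ := hc
  by_cases hst : c s = c t
  · exact pos_X hqq hsq htq hq hq' hc hst
  obtain ⟨k, hk1, hk2⟩ := third (c s) (c t)
  have hcq : rec2 c q q' k (c s) q = k := by simp [rec2]
  have hcq' : rec2 c q q' k (c s) q' = c s := by simp [rec2, hqq.symm]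
  have hcs : rec2 c q q' k (c s) s = c s := by simp [rec2, hsq.1, hsq.2]
  have hct : rec2 c q q' k (c s) t = c t := by simp [rec2, htq.1, htq.2]
  have hqout : ∀ y, ¬ Mn r (rec2 c q q' k (c s)) q y := by
    rintro y ⟨hy, hcc⟩
    rw [hcq] at hcc
    rcases hq y hy with rfl | rfl | rfl
    · rw [hcq'] at hcc; exact hk1 hcc
    · rw [hcs] at hcc; exact hk1 hcc
    · rw [hct] at hcc; exact hk2 hcc
  refine ⟨rec2 c q q' k (c s), rec2_good hc (no_out hqout) ?_⟩
  intro hT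
  obtain ⟨y, ⟨hy, hcc⟩, hyq⟩ := TransGen.head'_iff.1 hT
  have hys : y = s := by
    rw [hcq'] at hcc
    rcases hq' y hy with rfl | rfl | rfl
    · rw [hcq] at hcc; exact absurd hcc.symm hk1
    · rfl
    · rw [hct] at hcc; exact absurd hcc hst
  subst hys
  obtain ⟨l, hl⟩ := Pth.exists hyq
  have hql : q ∉ l := by
    intro h
    rcases ReflTransGen.cases_head (hl.reach q h).2 with h | ⟨z, hz, _⟩
    · exact hqq h
    · exact hqout z hz
  have hl' : Pth r y l q' := hl.mono (fun _ _ h => h.1)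
  have hlen : 3 ≤ l.length := by
    have hpos := hl'.pos
    have h0 := hl'.get_zero
    have h1 := hl'.get_last
    by_contra hlt
    obtain h | h : l.length = 1 ∨ l.length = 2 := by omega
    · rw [h] at h1; rw [h0] at h1; simp at h1; exact hsq.2 h1
    · rw [h] at h1; exact hn (hl'.step h0 h1)
  exact hql (hF l (hl'.cyc hq's hlen) hl'.last_mem)

theorem pos_atom {V : Type} [Fintype V] {r : V → V → Prop} (ih : IHV V) (hC : Ctx r) (hN : NoFan r)
    {R : Finset V} (hR : Atom r R) : Col3 r := by
  classical
  obtain ⟨s, t, hst, hout⟩ := atom_out hC hR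
  have hs : s ∉ R := (mem_outN.1 ((hout s).2 (.inl rfl))).1
  have ht : t ∉ R := (mem_outN.1 ((hout t).2 (.inr rfl))).1
  have hout' : ∀ x y, x ∈ R → r x y → y ∈ R ∨ y = s ∨ y = t := by
    intro x y hx hxy
    by_cases hy : y ∈ R
    · exact .inl hy
    · exact .inr ((hout y).1 (mem_outN.2 ⟨hy, x, hx, hxy⟩))
  obtain ⟨a, ha, hF3⟩ := F3 hC hN hR hst hs ht
  obtain ⟨b, hb, hF3t⟩ := F3 hC hN hR hst.symm ht hs
  obtain ⟨q, q', hqq, hRq, hqs, hqt, hqq1, hq's, hq't, hq'q⟩ :=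
    pos_struct hC hs ht hout' (fun l hl x hx hxR => F1 hC hN hR hl hx hxR) ha hb hF3 hF3t
  have hqR : q ∈ R := (hRq q).2 (.inl rfl)
  have hq'R : q' ∈ R := (hRq q').2 (.inr rfl)
  have hsq : s ≠ q ∧ s ≠ q' := ⟨by rintro rfl; exact hs hqR, by rintro rfl; exact hs hq'R⟩
  have htq : t ≠ q ∧ t ≠ q' := ⟨by rintro rfl; exact ht hqR, by rintro rfl; exact ht hq'R⟩
  have hq : ∀ y, r q y → y = q' ∨ y = s ∨ y = t := by
    intro y hy
    rcases hout' q y hqR hy with h | h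
    · rcases (hRq y).1 h with rfl | h
      · exact absurd hy (hC.hl _)
      · exact .inl h
    · exact .inr h
  have hq' : ∀ y, r q' y → y = q ∨ y = s ∨ y = t := by
    intro y hy
    rcases hout' q' y hq'R hy with h | h
    · rcases (hRq y).1 h with h | rfl
      · exact .inl h
      · exact absurd hy (hC.hl _)
    · exact .inr h
  let r0 := del r (fun x => x = q ∨ x = q')
  have hcol : Col3 r0 := ih r0 q (by
    rintro x y ⟨_, h1, h2⟩
    push Not at h1 h2
    exact ⟨h1.1, h2.1⟩) (fun x h => hC.hl _ h.1) (hN.mono (fun x y h => h.1))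
  by_cases hts : ReflTransGen r0 t s
  swap
  · obtain ⟨c, hc, hcst⟩ := same_color hcol hts
    exact pos_X hqq hsq htq hq hq' hc hcst
  by_cases hst' : ReflTransGen r0 s t
  swap
  · obtain ⟨c, hc, hcst⟩ := same_color hcol hst'
    exact pos_X hqq hsq htq hq hq' hc hcst.symm
  have hF : ∀ l, Cyc r l → q' ∈ l → q ∈ l := fun l hl h => F1 hC hN hR hl h hq'R q hqR
  have hF' : ∀ l, Cyc r l → q ∈ l → q' ∈ l := fun l hl h => F1 hC hN hR hl h hqR q' hq'R
  have hcol' : Col3 (del r (fun x => x = q' ∨ x = q)) := by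
    have : (fun x => x = q' ∨ x = q) = (fun x => x = q ∨ x = q') := by funext x; exact propext or_comm
    rw [this]; exact hcol
  by_cases h1 : r s q'
  swap
  · exact pos_fin2 hqq hsq htq hq hq' hF hq's hcol h1
  by_cases h2 : r t q'
  swap
  · exact pos_fin2 hqq htq hsq (fun y h => by have := hq y h; tauto) (fun y h => by have := hq' y h; tauto)
      hF hq't hcol h2
  by_cases h3 : r s q
  swap
  · exact pos_fin2 hqq.symm hsq.symm htq.symm hq' hq hF' hqs hcol' h3
  by_cases h4 : r t q
  swap
  · exact pos_fin2 hqq.symm htq.symm hsq.symm (fun y h => by have := hq' y h; tauto)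
      (fun y h => by have := hq y h; tauto) hF' hqt hcol' h4
  exfalso
  have hcyc : Cyc r [q, s, q'] := by
    refine ⟨?_, by simp, ?_, ?_⟩
    · simp [hsq.1.symm, hqq, hsq.2]
    · simp [hqs, h1]
    · simp [hq'q]
  obtain ⟨S, hS, htS, hsep⟩ := hN _ hcyc t (by simp [htq.1, htq.2, hst.symm])
  have hqS : q ∈ S := by
    by_contra h
    exact hsep q (by simp) h (.single ⟨h4, h⟩)
  have hq'S : q' ∈ S := by
    by_contra h
    exact hsep q' (by simp) h (.single ⟨h2, h⟩)
  have hSe : ({q, q'} : Finset V) = S := by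
    apply Finset.eq_of_subset_of_card_le
    · intro x hx; simp at hx; rcases hx with rfl | rfl <;> assumption
    · rw [Finset.card_pair hqq]; exact hS
  refine hsep s (by simp) (by rw [← hSe]; simp [hsq]) (rtg_mono hts ?_)
  rintro x y ⟨hxy, _, hy⟩
  refine ⟨hxy, ?_⟩
  rw [← hSe]; simpa using hy

end W4proof

namespace W4proof

open Relation

theorem GG {V : Type} [Fintype V] {r : V → V → Prop} (hC : Ctx r) (hN : NoFan r) {Q : Finset V}
    (hQ : Atom (fl r) Q) {l : List V} (hl : Cyc r l) {v : V} (hv : v ∈ Q ∨ v ∈ outN (fl r) Q)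
    (hvl : v ∉ l) : ∃ S : Finset V, S.card ≤ 2 ∧ v ∉ S ∧
      (∀ x ∈ l, x ∉ S → ¬ ReflTransGen (Av r S) v x) ∧ ∀ x ∈ l, x ∈ Q → x ∈ S := by
  obtain ⟨S, hS, hvS, hsep⟩ := hN l hl v hvl
  refine ⟨S, hS, hvS, hsep, ?_⟩
  intro x hx hxQ
  by_contra hxS
  have hnx := hsep x hx hxS
  have hxX : x ∈ co (Rs r S v) S := mem_co.2 ⟨by rw [mem_Rs]; exact hnx, hxS⟩
  have f1 : Frag (fl r) (co (Rs r S v) S) := frag_coRs hS hvS hxS hnx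
  have f2 : Frag r (Rs r S v) := frag_Rs hS hxS hnx
  have f3 : ∀ a ∈ co (Rs r S v) S, ∀ b ∈ Rs r S v, ¬ r b a := fun a ha b hb => no_arc_Rs hb ha
  have hsub : Q ⊆ co (Rs r S v) S := common (r := fl r) (Y := Rs r S v) hC.flip hQ f1 f2
    (fun a ha hb => (mem_co.1 ha).1 hb) f3 hxQ hxX
  have hvR : v ∈ Rs r S v := mem_Rs.2 .refl
  rcases hv with hv | hv
  · exact (mem_co.1 (hsub hv)).1 hvR
  · obtain ⟨_, y, hy, hvy⟩ := mem_outN.1 hv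
    exact no_arc_Rs hvR (hsub hy) hvy

/-- Restriction to a set. -/
abbrev rest {V : Type} (r : V → V → Prop) (Q : Finset V) : V → V → Prop := fun x y => r x y ∧ x ∈ Q ∧ y ∈ Q

theorem atom_strong {V : Type} [Fintype V] {r : V → V → Prop} {Q : Finset V}
    (hQ : Atom (fl r) Q) {x y : V} (hx : x ∈ Q) (hy : y ∈ Q) : ReflTransGen (rest r Q) x y := by
  classical
  let A := Q.filter (fun x => ReflTransGen (rest r Q) x y)
  have hAQ : A ⊆ Q := Finset.filter_subset _ _
  have hin : outN (fl r) A ⊆ outN (fl r) Q := by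
    intro u hu
    obtain ⟨h1, v, hv, huv⟩ := mem_outN.1 hu
    refine mem_outN.2 ⟨?_, v, hAQ hv, huv⟩
    intro huQ
    exact h1 (Finset.mem_filter.2 ⟨huQ, .head ⟨huv, huQ, hAQ hv⟩ (Finset.mem_filter.1 hv).2⟩)
  obtain ⟨_, h2, w, hw1, hw2⟩ := hQ.fr
  have hF : Frag (fl r) A := ⟨⟨y, Finset.mem_filter.2 ⟨hy, .refl⟩⟩, (Finset.card_le_card hin).trans h2, w,
    fun h => hw1 (hAQ h), fun h => hw2 (hin h)⟩
  have := Finset.eq_of_subset_of_card_le hAQ (hQ.mo _ hF)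
  rw [← this] at hx
  exact (Finset.mem_filter.1 hx).2

set_option maxHeartbeats 1000000 in
theorem neg_atom {V : Type} [Fintype V] {r : V → V → Prop} (ih : IHV V) (hC : Ctx r) (hN : NoFan r)
    {Q : Finset V} (hQ : Atom (fl r) Q) : Col3 r := by
  classical
  obtain ⟨s, t, hst, hout⟩ := atom_out hC.flip hQ
  have hso : s ∈ outN (fl r) Q := (hout s).2 (.inl rfl)
  have hto : t ∈ outN (fl r) Q := (hout t).2 (.inr rfl)
  have hs : s ∉ Q := (mem_outN.1 hso).1
  have ht : t ∉ Q := (mem_outN.1 hto).1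
  have hin : ∀ x y, y ∈ Q → r x y → x ∈ Q ∨ x = s ∨ x = t := by
    intro x y hy hxy
    by_cases hx : x ∈ Q
    · exact .inl hx
    · exact .inr ((hout x).1 (mem_outN.2 ⟨hx, y, hy, hxy⟩))
  have N2 : ∀ l, Cyc r l → ¬ ∀ x ∈ l, x ∈ Q := by
    intro l hl hlQ
    obtain ⟨S, hS, _, _, h⟩ := GG hC hN hQ hl (.inr hso) (fun h => hs (hlQ s h))
    obtain ⟨x, hx, hxS⟩ := hl.outside hS
    exact hxS (h x hx (hlQ x hx))
  have N3 : ∀ x y, rest r Q x y → rest r Q y x := by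
    rintro x y ⟨hxy, hx, hy⟩
    refine ⟨?_, hy, hx⟩
    obtain ⟨l, hl⟩ := Pth.exists (atom_strong hQ hy hx)
    have hlQ := hl.all (P := fun x => x ∈ Q) hy (fun _ _ h => h.2.2)
    have hl' : Pth r y l x := hl.mono (fun _ _ h => h.1)
    by_contra hyx
    have hlen : 3 ≤ l.length := by
      have hpos := hl'.pos
      have h0 := hl'.get_zero
      have h1 := hl'.get_last
      by_contra hlt
      obtain h | h : l.length = 1 ∨ l.length = 2 := by omega
      · rw [h] at h1; rw [h0] at h1; simp at h1; subst h1; exact hC.hl _ hxy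
      · rw [h] at h1; exact hyx (hl'.step h0 h1)
    exact N2 l (hl'.cyc hxy hlen) hlQ
  obtain ⟨q0, hq0⟩ := hQ.fr.1
  obtain ⟨p, ⟨z, w, hp, hz⟩, hmax⟩ := exists_longest
    (P := fun l => ∃ z w, Pth (rest r Q) z l w ∧ z ∈ Q) ⟨[q0], q0, q0, Pth.single _ q0, hq0⟩
    (fun l ⟨z, w, h, _⟩ => h.nd)
  have hpQ := hp.all (P := fun x => x ∈ Q) hz (fun _ _ h => h.2.2)
  have hpr : Pth r z p w := hp.mono (fun _ _ h => h.1)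
  have hw : w ∈ Q := hpQ w hp.last_mem
  have hsp : s ∉ p := fun h => hs (hpQ s h)
  have htp : t ∉ p := fun h => ht (hpQ t h)
  have hzin : ∀ y ∈ Q, r y z → p[1]? = some y := by
    intro y hy hyz
    have hyp : y ∈ p := by
      by_contra hyp
      have := hmax _ ⟨y, w, hp.cons ⟨hyz, hy, hz⟩ hyp, hy⟩
      simp at this
    obtain ⟨j, hj⟩ := List.mem_iff_getElem?.1 hyp
    have hjl := Pth.of_lt hj
    by_cases hj2 : 2 ≤ j
    · exfalso
      refine N2 (p.take (j + 1)) ((hpr.take hj).cyc hyz (by rw [List.length_take]; omega)) ?_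
      intro x hx; exact hpQ x (List.mem_of_mem_take hx)
    · have hj0 : j ≠ 0 := by
        rintro rfl; rw [hp.get_zero] at hj; simp at hj; subst hj; exact hC.hl _ hyz
      obtain rfl : j = 1 := by omega
      exact hj
  have hwin : ∀ y ∈ Q, r y w → p[p.length - 2]? = some y := by
    intro y hy hyw
    have hwy := N3 y w ⟨hyw, hy, hw⟩
    have hyp : y ∈ p := by
      by_contra hyp
      have := hmax _ ⟨z, y, hp.snoc hwy hyp, hz⟩
      simp at this
    obtain ⟨j, hj, h | ⟨h1, h2⟩⟩ := hpr.back hC.hl hyp hwy.1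
    · rw [show p.length - 2 = j by omega]; exact hj
    · exact absurd (fun x hx => hpQ x (List.mem_of_mem_drop hx)) (N2 _ h2)
  obtain ⟨z1, hz1r, hz1s, hz1t⟩ := hC.hdi z s t
  have hz1Q : z1 ∈ Q := by rcases hin _ _ hz hz1r with h | h | h <;> tauto
  have hz1 := hzin z1 hz1Q hz1r
  have hm2 : 2 ≤ p.length := Pth.of_lt hz1
  obtain ⟨w1, hw1r, hw1s, hw1t⟩ := hC.hdi w s t
  have hw1Q : w1 ∈ Q := by rcases hin _ _ hw hw1r with h | h | h <;> tauto
  have hw1 := hwin w1 hw1Q hw1r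
  have hzcl : ∀ y, r y z → y = z1 ∨ y = s ∨ y = t := by
    intro y hy
    rcases hin _ _ hz hy with h | h
    · have := hzin y h hy; rw [hz1] at this; simp at this; exact .inl this.symm
    · exact .inr h
  have hwcl : ∀ y, r y w → y = w1 ∨ y = s ∨ y = t := by
    intro y hy
    rcases hin _ _ hw hy with h | h
    · have := hwin y h hy; rw [hw1] at this; simp at this; exact .inl this.symm
    · exact .inr h
  have get : ∀ x u v k, (∀ y, r y x → y = u ∨ y = v ∨ y = k) → r v x ∧ r k x := by
    intro x u v k h
    constructor
    · obtain ⟨y, hy, h1, h2⟩ := hC.hdi x u k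
      rcases h y hy with h | h | h
      · exact absurd h h1
      · exact h ▸ hy
      · exact absurd h h2
    · obtain ⟨y, hy, h1, h2⟩ := hC.hdi x u v
      rcases h y hy with h | h | h
      · exact absurd h h1
      · exact absurd h h2
      · exact h ▸ hy
  obtain ⟨hsz, htz⟩ := get _ _ _ _ hzcl
  obtain ⟨hsw, htw⟩ := get _ _ _ _ hwcl
  have hzt : z ≠ t := by rintro rfl; exact ht hz
  obtain ⟨x, y, hxp, hyp, hxy, hys⟩ := last_exit (A := fun x => x ∈ p) (hC.strong hzt hst) hp.head_mem hsp
  obtain ⟨W, hW0⟩ := Pth.exists hys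
  have hWp : ∀ u ∈ W, u ∉ p ∧ u ≠ t := hW0.all (P := fun u => u ∉ p ∧ u ≠ t)
    ⟨hyp, by have := hxy.2; simpa using this⟩ (fun a b h => ⟨h.2.2, by have := h.1.2; simpa using this⟩)
  have hW : Pth r y W s := hW0.mono (fun _ _ h => h.1.1)
  have hkey : ∀ L a, Pth r a L x → (∀ u ∈ L, u ∈ p) → r s a → 2 ≤ L.length →
      L.length = 2 ∧ ¬ ReflTransGen (Av r L.toFinset) t s := by
    intro L a hL hLp hsa hlen
    have happ := hL.append hW hxy.1 (fun u hu hu' => (hWp u hu').1 (hLp u hu))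
    have hcyc := happ.cyc hsa (by rw [List.length_append]; have := hW.pos; omega)
    obtain ⟨S, hS, htS, hsep, hSQ⟩ := GG hC hN hQ hcyc (.inr hto) (by
      rw [List.mem_append]; rintro (h | h)
      · exact htp (hLp t h)
      · exact (hWp t h).2 rfl)
    have hsub : L.toFinset ⊆ S := by
      intro u hu
      rw [List.mem_toFinset] at hu
      exact hSQ u (List.mem_append_left _ hu) (hpQ u (hLp u hu))
    have hcd := List.toFinset_card_of_nodup hL.nd
    have hle := Finset.card_le_card hsub
    have heq : L.toFinset = S := Finset.eq_of_subset_of_card_le hsub (by omega)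
    refine ⟨by omega, ?_⟩
    rw [heq]
    refine hsep s (List.mem_append_right _ hW.last_mem) ?_
    rw [← heq, List.mem_toFinset]
    exact fun h => hsp (hLp s h)
  obtain ⟨i, hi⟩ := List.mem_iff_getElem?.1 hxp
  have hil := Pth.of_lt hi
  have hL1 : Pth r z (p.take (i + 1)) x := hpr.take hi
  have hL2 : Pth r w (p.drop i).reverse x :=
    ((hp.drop hi).rev).mono (fun a b h => (N3 _ _ h).1)
  have hL1p : ∀ u ∈ p.take (i + 1), u ∈ p := fun u hu => List.mem_of_mem_take hu
  have hL2p : ∀ u ∈ (p.drop i).reverse, u ∈ p := fun u hu => List.mem_of_mem_drop (List.mem_reverse.1 hu)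
  have hl1 : (p.take (i + 1)).length = i + 1 := by rw [List.length_take]; omega
  have hl2 : (p.drop i).reverse.length = p.length - i := by rw [List.length_reverse, List.length_drop]
  have k1 := hkey _ _ hL1 hL1p hsz
  have k2 := hkey _ _ hL2 hL2p hsw
  rw [hl1] at k1
  rw [hl2] at k2
  have hi1 : i ≤ 1 := by
    by_contra h
    have := (k1 (by omega)).1; omega
  have him : p.length - i ≤ 2 := by
    by_contra h
    have := (k2 (by omega)).1; omega
  by_cases hm3 : p.length = 3
  · skip
    exfalso
    obtain rfl : i = 1 := by omega
    have k1' := (k1 (by omega)).2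
    have k2' := (k2 (by omega)).2
    rcases p with _ | ⟨a0, _ | ⟨a1, _ | ⟨a2, _ | ⟨_, _⟩⟩⟩⟩ <;> simp at hm3
    have e0 := hp.hd
    have e2 := hp.la
    simp at e0 e2 hi
    subst e0; subst e2; subst hi
    have hnd := hp.nd
    simp at hnd
    simp at k1' k2'
    have ht1 : t ≠ a1 := by rintro rfl; simp at htp
    have hs1 : s ≠ a1 := by rintro rfl; simp at hsp
    have hreach : ReflTransGen (Av r {a1}) t s := hC.strong ht1 hs1
    have := rtg_inv (P := fun u => ReflTransGen (Av r {a0, a1}) t u ∨ ReflTransGen (Av r {a2, a1}) t u)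
      hreach (.inl .refl) (by
        rintro a b hab ⟨hr, hb⟩
        simp at hb
        by_cases hb0 : b = a0
        · subst hb0
          exact .inr (.single ⟨htz, by simp; tauto⟩)
        by_cases hb2 : b = a2
        · subst hb2
          exact .inl (.single ⟨htw, by simp; tauto⟩)
        rcases hab with hab | hab
        · exact .inl (hab.tail ⟨hr, by simp [hb0, hb]⟩)
        · exact .inr (hab.tail ⟨hr, by simp [hb2, hb]⟩))
    rcases this with h | h
    · exact k1' h
    · exact k2' h
  have hm : p.length = 2 := by omega
  have hfin : ¬ ReflTransGen (Av r p.toFinset) t s := by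
    obtain rfl | rfl : i = 0 ∨ i = 1 := by omega
    · have := (k2 (by omega)).2
      rw [List.toFinset_reverse] at this
      exact this
    · have := (k1 (by omega)).2
      rw [List.take_of_length_le (by omega)] at this
      exact this
  rcases p with _ | ⟨a0, _ | ⟨a1, _ | ⟨_, _⟩⟩⟩ <;> simp at hm
  have e0 := hp.hd
  have e1 := hp.la
  simp at e0 e1
  subst e0; subst e1
  simp at hz1 hw1
  subst hz1; subst hw1
  have hnd := hp.nd
  simp at hnd hsp htp
  have hcol : Col3 (del r (fun x => x = a0 ∨ x = a1)) := ih _ a0 (by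
    rintro x y ⟨_, h1, h2⟩
    push Not at h1 h2
    exact ⟨h1.1, h2.1⟩) (fun x h => hC.hl _ h.1) (hN.mono (fun x y h => h.1))
  obtain ⟨c, hc, hcst⟩ := same_color (s := s) (t := t) hcol (by
    intro h
    apply hfin
    refine rtg_mono h ?_
    rintro x y ⟨hxy, _, hy⟩
    exact ⟨hxy, by simpa using hy⟩)
  have hflip : Good (del (fl r) (fun x => x = a0 ∨ x = a1)) c :=
    hc.flip.mono (fun x y h hc => ⟨⟨h.1, h.2.2, h.2.1⟩, hc⟩)
  obtain ⟨c', hc'⟩ := pos_X (r := fl r) (q := a0) (q' := a1) (s := s) (t := t) hnd hsp htp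
    (fun y hy => hzcl y hy) (fun y hy => hwcl y hy) hflip hcst
  exact ⟨c', hc'.flip⟩

theorem main {n : ℕ} : ∀ (V : Type) [Fintype V], Fintype.card V = n → ∀ r : V → V → Prop,
    (∀ x, ¬ r x x) → NoFan r → Col3 r := by
  induction n using Nat.strong_induction_on with
  | _ n IH =>
    intro V _ hn r hl hN
    have ih : IHV V := ihv (fun W _ hW r' hl' hN' => IH _ (hn ▸ hW) W rfl r' hl' hN')
    by_contra hcon
    have hC := ctx_of ih hl hN hcon
    have hne : Nonempty V := by
      by_contra he
      rw [not_nonempty_iff] at he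
      exact hcon ⟨fun _ => 0, fun v => (he.false v).elim⟩
    rcases exists_atom hC hN with ⟨R, hR⟩ | ⟨R, hR⟩
    · exact hcon (pos_atom ih hC hN hR)
    · exact hcon (neg_atom ih hC hN hR)

end W4proof

namespace W4proof

open Relation

theorem good_acyclic {V : Type} (D : Digraph' V) {c : V → Fin 3} (h : Good D.Adj c) :
    D.IsAcyclicColoring c := by
  intro i v hv
  refine h v (tg_mono hv ?_)
  rintro a b ⟨ha, hb, hab⟩
  exact ⟨hab, (show c a = i from ha).trans (show c b = i from hb).symm⟩

theorem plus_bound {V : Type} [Fintype V] (D : Digraph' V) (hl : D.Loopless)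
    (h : ¬ D.ContainsSubdivision W4plus) : Col3 D.Adj :=
  main (n := Fintype.card V) V rfl D.Adj hl (noFan_of_noSub D hl h)

theorem sub_flip {V : Type} (D : Digraph' V)
    (h : Digraph'.ContainsSubdivision (⟨fun a b => D.Adj b a⟩ : Digraph' V) W4plus) :
    D.ContainsSubdivision W4minus := by
  obtain ⟨β, p, h1, h2, h3, h4⟩ := h
  refine ⟨β, fun a b hab => (p b a hab).reverse, h1, ?_, ?_, ?_⟩
  · intro a b hab
    obtain ⟨hc, hn⟩ := h2 b a hab
    have e : β a :: (p b a hab).reverse ++ [β b] = (β b :: p b a hab ++ [β a]).reverse := by simp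
    refine ⟨?_, ?_⟩
    · rw [e]
      show List.IsChain _ _
      rw [List.isChain_reverse]
      exact hc
    · rw [e]; exact List.nodup_reverse.2 hn
  · intro a b hab x hx
    exact h3 b a hab x (List.mem_reverse.1 hx)
  · intro a b hab a' b' hab' hne x hx hx'
    refine h4 b a hab b' a' hab' ?_ x (List.mem_reverse.1 hx) (List.mem_reverse.1 hx')
    intro he
    rw [Prod.mk.injEq] at he
    exact hne (Prod.ext he.2 he.1)

theorem bound_of {V : Type} (D : Digraph' V) (h : Col3 D.Adj) : D.dichromaticNumber ≤ 3 := by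
  obtain ⟨c, hc⟩ := h
  exact Nat.sInf_le ⟨c, good_acyclic D hc⟩

theorem mb_plus : Digraph'.MaderBound W4plus 4 := by
  intro n D hl hk
  by_contra h
  have := bound_of D (plus_bound D hl h)
  omega

theorem mb_minus : Digraph'.MaderBound W4minus 4 := by
  intro n D hl hk
  by_contra h
  obtain ⟨c, hc⟩ := plus_bound (⟨fun a b => D.Adj b a⟩ : Digraph' (Fin n)) hl
    (fun h' => h (sub_flip D h'))
  have := bound_of D ⟨c, hc.flip⟩
  omega

theorem not_mb (F : Digraph' (Fin 4)) (k : ℕ) (hk : k ≤ 3) : ¬ Digraph'.MaderBound F k := by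
  intro h
  obtain ⟨β, _, hβ, _⟩ := h 3 ⟨fun a b => a ≠ b⟩ (fun v hv => hv rfl) (by
    refine hk.trans ?_
    refine le_csInf ⟨3, id, ?_⟩ ?_
    · intro i v hv
      obtain ⟨y, ⟨h1, h2, h3⟩, _⟩ := TransGen.head'_iff.1 hv
      simp at h1 h2
      exact h3 (h1.trans h2.symm)
    · rintro m ⟨c, hc⟩
      by_contra hm
      have : ¬ Function.Injective c := by
        intro hi
        have := Fintype.card_le_of_injective c hi
        simp at this; omega
      rw [Function.Injective] at this
      push Not at this
      obtain ⟨a, b, hab, hne⟩ := this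
      refine hc (c b) a (.tail (.single ⟨hab, rfl, hne⟩) ⟨rfl, hab, hne.symm⟩))
  have := Fintype.card_le_of_injective β hβ
  simp at this

theorem mader_eq (F : Digraph' (Fin 4)) (h : Digraph'.MaderBound F 4) : Digraph'.mader F = 4 := by
  apply le_antisymm
  · exact Nat.sInf_le ⟨by omega, h⟩
  · refine le_csInf ⟨4, by omega, h⟩ ?_
    rintro k ⟨_, hk⟩
    by_contra hlt
    exact not_mb F k (by omega) hk

end W4proof

/-- Every digraph with dichromatic number at least `4`
contains a subdivision of `W₄⁺`; consequently `mader(W₄⁺) = 4`. By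
arc-reversal symmetry the same holds for `W₄⁻`. -/
theorem mader_W4 :
    (Digraph'.MaderBound W4plus 4 ∧ Digraph'.mader W4plus = 4) ∧
    (Digraph'.MaderBound W4minus 4 ∧ Digraph'.mader W4minus = 4) := by
  exact ⟨⟨W4proof.mb_plus, W4proof.mader_eq _ W4proof.mb_plus⟩,
    ⟨W4proof.mb_minus, W4proof.mader_eq _ W4proof.mb_minus⟩⟩
end
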